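/- Every 3-connected, 1-heavy, almost distance-hereditary graph on at least 3 vertices is Hamiltonian. -/

import Mathlib

open SimpleGraph

/-- A vertex is heavy if its degree is at least half the number of vertices. -/
def Heavy {V : Type*} [Fintype V] (G : SimpleGraph V) (v : V) : Prop :=
  Fintype.card V ≤ 2 * (G.neighborSet v).ncard

/-- `{x,y} ∈ Ẽ(G)`: distinct vertices that are adjacent or have degree sum at least `n`. -/
def TEdge {V : Type*} [Fintype V] (G : SimpleGraph V) (x y : V) : Prop :=
  x ≠ y ∧ (G.Adj x y ∨
    Fintype.card V ≤ (G.neighborSet x).ncard + (G.neighborSet y).ncard)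

/-- `a` is the center and `b,c,d` the end vertices of an induced claw `K_{1,3}`. -/
def IsClaw {V : Type*} (G : SimpleGraph V) (a b c d : V) : Prop :=
  G.Adj a b ∧ G.Adj a c ∧ G.Adj a d ∧
    ¬ G.Adj b c ∧ ¬ G.Adj b d ∧ ¬ G.Adj c d ∧ b ≠ c ∧ b ≠ d ∧ c ≠ d

/-- Every claw has at least one heavy end vertex. -/
def OneHeavy {V : Type*} [Fintype V] (G : SimpleGraph V) : Prop :=
  ∀ a b c d, IsClaw G a b c d → Heavy G b ∨ Heavy G c ∨ Heavy G d

/-- Every claw has at least two heavy end vertices. -/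
def TwoHeavy {V : Type*} [Fintype V] (G : SimpleGraph V) : Prop :=
  ∀ a b c d, IsClaw G a b c d →
    (Heavy G b ∧ Heavy G c) ∨ (Heavy G b ∧ Heavy G d) ∨ (Heavy G c ∧ Heavy G d)

/-- Every claw has two end vertices with degree sum at least `n`. -/
def ClawHeavy {V : Type*} [Fintype V] (G : SimpleGraph V) : Prop :=
  ∀ a b c d, IsClaw G a b c d →
    Fintype.card V ≤ (G.neighborSet b).ncard + (G.neighborSet c).ncard ∨
    Fintype.card V ≤ (G.neighborSet b).ncard + (G.neighborSet d).ncard ∨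
    Fintype.card V ≤ (G.neighborSet c).ncard + (G.neighborSet d).ncard

/-- `G` contains no induced claw. -/
def ClawFree {V : Type*} (G : SimpleGraph V) : Prop :=
  ∀ a b c d, ¬ IsClaw G a b c d

/-- Almost distance-hereditary: in every connected induced subgraph the distance
between two vertices exceeds their distance in `G` by at most one. -/
def AlmostDH {V : Type*} (G : SimpleGraph V) : Prop :=
  ∀ s : Set V, (G.induce s).Connected →
    ∀ x y : s, (G.induce s).dist x y ≤ G.dist (x : V) (y : V) + 1

/-- Distance-hereditary: every connected induced subgraph preserves distances. -/
def DistHered {V : Type*} (G : SimpleGraph V) : Prop :=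
  ∀ s : Set V, (G.induce s).Connected →
    ∀ x y : s, (G.induce s).dist x y = G.dist (x : V) (y : V)

/-- A cycle in `G`, encoded as an injective cyclic sequence of `m ≥ 3` pairwise
adjacent-in-order vertices. -/
def IsCycleMap {V : Type*} (G : SimpleGraph V) (m : ℕ) (f : ZMod m → V) : Prop :=
  3 ≤ m ∧ Function.Injective f ∧ ∀ i, G.Adj (f i) (f (i + 1))

/-- A longest cycle of `G`. -/
def IsLongestCycleMap {V : Type*} (G : SimpleGraph V) (m : ℕ) (f : ZMod m → V) : Prop :=
  IsCycleMap G m f ∧ ∀ (m' : ℕ) (f' : ZMod m' → V), IsCycleMap G m' f' → m' ≤ m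

/-- `R` is a connected component of the subgraph of `G` induced on `W`. -/
def IsCompOf {V : Type*} (G : SimpleGraph V) (W R : Set V) : Prop :=
  R.Nonempty ∧ R ⊆ W ∧ (G.induce R).Connected ∧
    ∀ x ∈ R, ∀ y ∈ W, G.Adj x y → y ∈ R

open SimpleGraph
namespace HamADH
/-- Reflexive adjacency. -/
def EE {V : Type*} (G : SimpleGraph V) (a b : V) : Prop := a = b ∨ G.Adj a b

/-- There is a walk of length at most `n` from `a` to `b`. -/
def Near {V : Type*} (G : SimpleGraph V) : ℕ → V → V → Prop
  | 0, a, b => a = b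
  | n + 1, a, b => ∃ c, EE G a c ∧ Near G n c b

/-- Adjacency in the graph where the set `K` is completed (reflexive). -/
def FF {V : Type*} (G : SimpleGraph V) (K : V → Prop) (a b : V) : Prop := EE G a b ∨ (K a ∧ K b)

/-- The properties of a maximal cycle used by the clause checker. -/
structure Ctx {V : Type*} (G : SimpleGraph V) (K A : V → Prop) (C : List V) : Prop where
  claw : ∀ a x y z, EE G a x → EE G a y → EE G a z → ¬ EE G x y → ¬ EE G x z → ¬ EE G y z →
    ¬ K x → ¬ K y → ¬ K z → False
  adh : ∀ (p : ℕ → V) (L d : ℕ), d + 2 ≤ L → (∀ i < L, EE G (p i) (p (i+1))) →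
    (∀ i j, i + 1 < j → j ≤ L → ¬ EE G (p i) (p j)) → Near G d (p 0) (p L) → False
  heavy : ∀ a b, K a → K b → Near G 2 a b
  noHam : ∀ (P : List V) (a b : V), P.Perm C → P.IsChain (FF G K) → P.head? = some a →
    P.getLast? = some b → A a → A b → False

variable {V : Type*} {G : SimpleGraph V} {K A : V → Prop} {C : List V}

theorem EE.symm {a b : V} (h : EE G a b) : EE G b a := h.imp Eq.symm G.adj_symm
theorem EE.comm {a b : V} : EE G a b ↔ EE G b a := ⟨EE.symm, EE.symm⟩
theorem FF.symm {a b : V} (h : FF G K a b) : FF G K b a := h.imp EE.symm And.symm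
theorem FF.comm {a b : V} : FF G K a b ↔ FF G K b a := ⟨FF.symm, FF.symm⟩

theorem Near.trans {n m : ℕ} {a b c : V} (h : Near G n a b) (h' : Near G m b c) : Near G (n + m) a c := by
  induction n generalizing a with
  | zero => obtain rfl : a = b := h; simpa using h'
  | succ n ih =>
    obtain ⟨d, h1, h2⟩ := h
    rw [Nat.add_right_comm]
    exact ⟨d, h1, ih h2⟩

/-- `l` is a list with first element `a`, last element `b`, consecutive elements adjacent. -/
structure Seg (G : SimpleGraph V) (a b : V) (l : List V) : Prop where
  chain : l.IsChain G.Adj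
  head : l.head? = some a
  last : l.getLast? = some b

/-! ### the checker -/

def val (G : SimpleGraph V) (K A : V → Prop) (f : ℕ → V) (v : ℕ) : Prop :=
  if v / 1024 = 0 then EE G (f (v / 32 % 32)) (f (v % 32))
  else if v / 1024 = 1 then FF G K (f (v / 32 % 32)) (f (v % 32))
  else if v / 1024 = 2 then K (f (v % 32)) else A (f (v % 32))

def lit (G : SimpleGraph V) (K A : V → Prop) (f : ℕ → V) (l : ℕ) : Prop :=
  if l % 2 = 0 then val G K A f (l / 2) else ¬ val G K A f (l / 2)

def eV (i j : ℕ) : ℕ := bif Nat.ble i j then 32 * (i % 32) + j % 32 else 32 * (j % 32) + i % 32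
def fV (i j : ℕ) : ℕ := 1024 + eV i j
def kV (i : ℕ) : ℕ := 2048 + i % 32
def aV (i : ℕ) : ℕ := 3072 + i % 32
def pos (v : ℕ) : ℕ := 2 * v
def neg (v : ℕ) : ℕ := 2 * v + 1
def flip (l : ℕ) : ℕ := bif Nat.beq (l % 2) 0 then l + 1 else l - 1

section
variable {f : ℕ → V}
theorem lit_pos (v) : lit G K A f (pos v) ↔ val G K A f v := by simp [lit, pos]
theorem lit_neg (v) : lit G K A f (neg v) ↔ ¬ val G K A f v := by
  have : (2 * v + 1) / 2 = v := by omega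
  simp [lit, neg, this]
theorem lit_flip (l) : lit G K A f (flip l) ↔ ¬ lit G K A f l := by
  rcases Nat.even_or_odd' l with ⟨v, rfl | rfl⟩
  · have : flip (2 * v) = neg v := by simp [flip, neg]
    rw [this, lit_neg]; rw [show 2 * v = pos v from rfl, lit_pos]
  · have : flip (2 * v + 1) = pos v := by
      have : (2 * v + 1) % 2 = 1 := by omega
      have h2 : Nat.beq 1 0 = false := rfl
      simp [flip, pos, this, h2]
    rw [this, lit_pos]; rw [show 2 * v + 1 = neg v from rfl, lit_neg, not_not]
theorem val_e (i j) : val G K A f (eV i j) ↔ EE G (f (i % 32)) (f (j % 32)) := by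
  unfold eV
  cases h : Nat.ble i j
  · have h1 : (32 * (j % 32) + i % 32) / 1024 = 0 := by omega
    have h2 : (32 * (j % 32) + i % 32) / 32 % 32 = j % 32 := by omega
    have h3 : (32 * (j % 32) + i % 32) % 32 = i % 32 := by omega
    simp only [cond_false, val, h1, h2, h3, if_true]; exact EE.comm
  · have h1 : (32 * (i % 32) + j % 32) / 1024 = 0 := by omega
    have h2 : (32 * (i % 32) + j % 32) / 32 % 32 = i % 32 := by omega
    have h3 : (32 * (i % 32) + j % 32) % 32 = j % 32 := by omega
    simp only [cond_true, val, h1, h2, h3, if_true]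
theorem val_f (i j) : val G K A f (fV i j) ↔ FF G K (f (i % 32)) (f (j % 32)) := by
  unfold fV eV
  cases h : Nat.ble i j
  · have h1 : (1024 + (32 * (j % 32) + i % 32)) / 1024 = 1 := by omega
    have h2 : (1024 + (32 * (j % 32) + i % 32)) / 32 % 32 = j % 32 := by omega
    have h3 : (1024 + (32 * (j % 32) + i % 32)) % 32 = i % 32 := by omega
    simp only [cond_false, val, h1, h2, h3, if_true]; simp; exact FF.comm
  · have h1 : (1024 + (32 * (i % 32) + j % 32)) / 1024 = 1 := by omega
    have h2 : (1024 + (32 * (i % 32) + j % 32)) / 32 % 32 = i % 32 := by omega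
    have h3 : (1024 + (32 * (i % 32) + j % 32)) % 32 = j % 32 := by omega
    simp only [cond_true, val, h1, h2, h3, if_true]; simp
theorem val_k (i) : val G K A f (kV i) ↔ K (f (i % 32)) := by
  unfold kV
  have h1 : (2048 + i % 32) / 1024 = 2 := by omega
  have h3 : (2048 + i % 32) % 32 = i % 32 := by omega
  simp [val, h1, h3]
theorem val_a (i) : val G K A f (aV i) ↔ A (f (i % 32)) := by
  unfold aV
  have h1 : (3072 + i % 32) / 1024 = 3 := by omega
  have h3 : (3072 + i % 32) % 32 = i % 32 := by omega
  simp [val, h1, h3]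

/-- A clause holds. -/
def holds (G : SimpleGraph V) (K A : V → Prop) (f : ℕ → V) (c : List ℕ) : Prop :=
  ∃ l ∈ c, lit G K A f l
end

inductive Tree where
  | leaf : Tree
  | node : Tree → List ℕ → Tree → Tree

def Tree.get : ℕ → Tree → ℕ → Option (List ℕ)
  | 0, _, _ => none
  | _ + 1, .leaf, _ => none
  | n + 1, .node l c r, i =>
    bif Nat.beq i 0 then some c
    else bif Nat.beq (i % 2) 1 then Tree.get n l (i / 2) else Tree.get n r (i / 2 - 1)

def Tree.ins : ℕ → Tree → ℕ → List ℕ → Tree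
  | 0, t, _, _ => t
  | _ + 1, .leaf, _, c => .node .leaf c .leaf
  | n + 1, .node l c r, i, d =>
    bif Nat.beq (i % 2) 1 then .node (Tree.ins n l (i / 2) d) c r
    else .node l c (Tree.ins n r (i / 2 - 1) d)

def Tree.All (P : List ℕ → Prop) : Tree → Prop
  | .leaf => True
  | .node l c r => l.All P ∧ P c ∧ r.All P

theorem Tree.all_get {P : List ℕ → Prop} {n : ℕ} {t : Tree} (h : t.All P) {i : ℕ} {c : List ℕ}
    (hc : t.get n i = some c) : P c := by
  induction n generalizing t i with
  | zero => simp [Tree.get] at hc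
  | succ n ih =>
    cases t with
    | leaf => simp [Tree.get] at hc
    | node l d r =>
      obtain ⟨h1, h2, h3⟩ := h
      rw [Tree.get] at hc
      cases h4 : Nat.beq i 0 <;> rw [h4] at hc
      · cases h5 : Nat.beq (i % 2) 1 <;> rw [h5] at hc
        · exact ih h3 hc
        · exact ih h1 hc
      · simp at hc; exact hc ▸ h2

theorem Tree.all_ins {P : List ℕ → Prop} {n : ℕ} {t : Tree} (h : t.All P) {i : ℕ} {c : List ℕ}
    (hc : P c) : (t.ins n i c).All P := by
  induction n generalizing t i with
  | zero => simpa [Tree.ins]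
  | succ n ih =>
    cases t with
    | leaf => exact ⟨trivial, hc, trivial⟩
    | node l d r =>
      obtain ⟨h1, h2, h3⟩ := h
      rw [Tree.ins]
      cases h5 : Nat.beq (i % 2) 1
      · exact ⟨h1, h2, ih h3⟩
      · exact ⟨ih h1, h2, h3⟩

def filt (F : ℕ) : List ℕ → List ℕ
  | [] => []
  | l :: c => bif Nat.testBit F l then filt F c else l :: filt F c

def rup (T : Tree) : List ℕ → ℕ → Bool
  | [], _ => false
  | h :: hs, F =>
    match T.get 12 h with
    | none => false
    | some c =>
      match filt F c with
      | [] => true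
      | l :: r => bif r.all fun m => Nat.beq m l then rup T hs (F ||| 1 <<< flip l) else false

def negMask : List ℕ → ℕ
  | [] => 0
  | l :: c => negMask c ||| 1 <<< l

section
variable {f : ℕ → V}

theorem testBit_or_shift {F l m : ℕ} (h : (F ||| 1 <<< l).testBit m = true) : F.testBit m = true ∨ m = l := by
  rw [Nat.testBit_or, Bool.or_eq_true] at h
  refine h.imp id fun h => ?_
  rw [Nat.one_shiftLeft, Nat.testBit_two_pow] at h
  simpa using (of_decide_eq_true h).symm

theorem filt_spec {F : ℕ} (hF : ∀ l, F.testBit l = true → ¬ lit G K A f l) {c : List ℕ}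
    (hc : holds G K A f c) : holds G K A f (filt F c) := by
  obtain ⟨l, hl, h⟩ := hc
  refine ⟨l, ?_, h⟩
  have hn : F.testBit l = false := by
    by_contra h'; exact hF l (by simpa using h') h
  clear h
  induction c with
  | nil => simp at hl
  | cons a c ih =>
    rw [filt]
    rcases List.mem_cons.1 hl with rfl | hl
    · rw [hn]; simp
    · cases F.testBit a
      · simp [ih hl]
      · simpa using ih hl

theorem rup_sound {T : Tree} (hT : T.All (holds G K A f)) {hs : List ℕ} {F : ℕ}
    (h : rup T hs F = true) (hF : ∀ l, F.testBit l = true → ¬ lit G K A f l) : False := by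
  induction hs generalizing F with
  | nil => simp [rup] at h
  | cons a hs ih =>
    rw [rup] at h
    cases h1 : T.get 12 a with
    | none => simp [h1] at h
    | some c =>
      rw [h1] at h
      have h2 := filt_spec hF (Tree.all_get hT h1)
      simp only at h
      split at h
      · rename_i h3; rw [h3] at h2; obtain ⟨l, hl, _⟩ := h2; simp at hl
      · rename_i l r h3
        rw [h3] at h2
        obtain ⟨l', hl, h4⟩ := h2
        cases h5 : (r.all fun m => Nat.beq m l) <;> rw [h5] at h
        · simp at h
        simp only [List.all_eq_true, Nat.beq_eq] at h5
        obtain rfl : l' = l := by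
          rcases List.mem_cons.1 hl with hl | hl
          · exact hl
          · exact h5 _ hl
        refine ih h fun m hm => ?_
        rcases testBit_or_shift hm with hm | rfl
        · exact hF m hm
        · rw [lit_flip]; simpa using h4

theorem negMask_spec {c : List ℕ} {m : ℕ} (h : (negMask c).testBit m = true) : m ∈ c := by
  induction c with
  | nil => simp [negMask] at h
  | cons a c ih =>
    rcases testBit_or_shift h with h | rfl
    · exact List.mem_cons_of_mem _ (ih h)
    · simp
end

/-! basic clauses -/
def clawC (a x y z : ℕ) : List ℕ :=
  [neg (eV a x), neg (eV a y), neg (eV a z), pos (eV x y), pos (eV x z), pos (eV y z),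
    pos (kV x), pos (kV y), pos (kV z)]

/-- negated adjacency to the head of the list, adjacency to the rest -/
def adhRow (a : ℕ) : List ℕ → List ℕ
  | [] => []
  | b :: l => neg (eV a b) :: l.map fun c => pos (eV a c)

def adhPath : List ℕ → List ℕ
  | [] => []
  | a :: l => adhRow a l ++ adhPath l

/-- walk steps: `n` encodes the next name `n % 32`, and a heavy jump if `32 ≤ n` -/
def walkC : ℕ → List ℕ → List ℕ
  | _, [] => []
  | a, n :: l =>
    bif Nat.ble 32 n then neg (kV a) :: neg (kV n) :: walkC (n % 32) l else neg (eV a n) :: walkC n l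

def walkW : List ℕ → ℕ
  | [] => 0
  | n :: l => bif Nat.ble 32 n then walkW l + 2 else walkW l + 1

def lastOf : ℕ → List ℕ → ℕ
  | a, [] => a
  | _, b :: l => lastOf b l

section
variable {f : ℕ → V}
theorem clawC_holds (cx : Ctx G K A C) (a x y z) : holds G K A f (clawC a x y z) := by
  by_contra h
  simp only [holds, clawC, List.mem_cons, List.not_mem_nil, or_false, exists_eq_or_imp, exists_eq_left,
    lit_pos, lit_neg, val_e, val_k, not_or, not_not] at h
  obtain ⟨h1, h2, h3, h4, h5, h6, h7, h8, h9⟩ := h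
  exact cx.claw _ _ _ _ h1 h2 h3 h4 h5 h6 h7 h8 h9

theorem walkC_near (cx : Ctx G K A C) (a : ℕ) (l : List ℕ) (h : ∀ m ∈ walkC a l, ¬ lit G K A f m) :
    Near G (walkW l) (f (a % 32)) (f (lastOf a l % 32)) := by
  induction l generalizing a with
  | nil => exact rfl
  | cons n l ih =>
    rw [walkC] at h
    rw [walkW, lastOf]
    cases hn : Nat.ble 32 n <;> rw [hn] at h <;> simp only [cond_true, cond_false, List.forall_mem_cons,
      lit_neg, val_k, val_e, not_not] at h ⊢
    · exact ⟨_, h.1, ih _ h.2⟩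
    · rw [Nat.add_comm]
      have h3 := ih _ h.2.2
      have h4 : lastOf (n % 32) l % 32 = lastOf n l % 32 := by cases l <;> simp [lastOf]
      rw [Nat.mod_mod, h4] at h3
      exact (cx.heavy _ _ h.1 h.2.1).trans h3

theorem adhPath_spec (l : List ℕ) (h : ∀ m ∈ adhPath l, ¬ lit G K A f m) :
    (∀ i, i + 1 < l.length → EE G (f (l.getD i 0 % 32)) (f (l.getD (i+1) 0 % 32))) ∧
    (∀ i j, i + 1 < j → j < l.length → ¬ EE G (f (l.getD i 0 % 32)) (f (l.getD j 0 % 32))) := by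
  induction l with
  | nil => simp
  | cons a l ih =>
    simp only [adhPath, List.forall_mem_append] at h
    obtain ⟨ih1, ih2⟩ := ih h.2
    have h1 := h.1
    constructor
    · intro i hi
      cases i with
      | succ i => simpa using ih1 i (by simpa using hi)
      | zero =>
        cases l with
        | nil => simp at hi
        | cons b l =>
          simp only [adhRow, List.forall_mem_cons, lit_neg, val_e, not_not] at h1
          simpa using h1.1
    · intro i j hij hj
      cases i with
      | succ i =>
        obtain ⟨j, rfl⟩ : ∃ k, j = k + 1 := ⟨j - 1, by omega⟩
        simpa using ih2 i j (by omega) (by simpa using hj)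
      | zero =>
        cases l with
        | nil => simp at hj; omega
        | cons b l =>
          obtain ⟨j, rfl⟩ : ∃ k, j = k + 2 := ⟨j - 2, by omega⟩
          simp only [adhRow, List.forall_mem_cons, List.forall_mem_map, lit_pos, val_e] at h1
          have hj' : j < l.length := by simpa using hj
          have := h1.2 l[j] (List.getElem_mem hj')
          simpa [hj'] using this

theorem getD_last (a : ℕ) (l : List ℕ) : (a :: l).getD l.length 0 = lastOf a l := by
  induction l generalizing a with
  | nil => rfl
  | cons b l ih => simpa [lastOf] using ih b

theorem adh_holds (cx : Ctx G K A C) (a : ℕ) (l w : List ℕ) (hw : walkW w + 2 ≤ l.length)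
    (hl : lastOf a w % 32 = lastOf a l % 32) : holds G K A f (adhPath (a :: l) ++ walkC a w) := by
  by_contra h
  have h' : ∀ m ∈ adhPath (a :: l) ++ walkC a w, ¬ lit G K A f m := fun m hm hh => h ⟨m, hm, hh⟩
  rw [List.forall_mem_append] at h'
  obtain ⟨h1, h2⟩ := adhPath_spec _ h'.1
  refine cx.adh (fun i => f ((a :: l).getD i 0 % 32)) l.length (walkW w) hw (fun i hi => h1 i (by simpa using hi))
    (fun i j hij hj => h2 i j hij (by simp; omega)) ?_
  have := walkC_near cx a w h'.2
  rw [hl] at this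
  simp only [getD_last]
  simpa using this
end
end HamADH

open SimpleGraph
namespace HamADH
variable {V : Type*} {G : SimpleGraph V} {K A : V → Prop} {C : List V}

theorem Seg.reverse {a b : V} {l : List V} (h : Seg G a b l) : Seg G b a l.reverse := by
  refine ⟨?_, by simp [h.last], by simp [h.head]⟩
  rw [List.isChain_reverse]
  exact h.chain.imp fun _ _ h => G.adj_symm h

/-- `F`-segments. -/
structure FSeg (G : SimpleGraph V) (K : V → Prop) (a b : V) (l : List V) : Prop where
  chain : l.IsChain (FF G K)
  head : l.head? = some a
  last : l.getLast? = some b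

theorem Seg.toF {a b : V} {l : List V} (h : Seg G a b l) : FSeg G K a b l :=
  ⟨h.chain.imp fun _ _ h => Or.inl (Or.inr h), h.head, h.last⟩

theorem FSeg.append {a b c d : V} {l m : List V} (h : FSeg G K a b l) (h' : FSeg G K c d m)
    (hbc : FF G K b c) : FSeg G K a d (l ++ m) := by
  refine ⟨?_, ?_, ?_⟩
  · rw [List.isChain_append]
    refine ⟨h.chain, h'.chain, ?_⟩
    rw [h.last, h'.head]
    simpa using hbc
  · simp [List.head?_append, h.head]
  · simp [List.getLast?_append, h'.last]

abbrev Blk := List (ℕ × ℕ)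
def blkOf (bl : Blk) (d : ℕ) : ℕ × ℕ := bl.getD (d / 2) (0, 0)
def inE (bl : Blk) (d : ℕ) : ℕ :=
  bif Nat.beq (d % 2) 0 then (blkOf bl d).1 else (blkOf bl d).2
def outE (bl : Blk) (d : ℕ) : ℕ :=
  bif Nat.beq (d % 2) 0 then (blkOf bl d).2 else (blkOf bl d).1

def linked (lk : Blk) (a b : ℕ) : Bool :=
  lk.any fun p => (Nat.beq p.1 a && Nat.beq p.2 b) || (Nat.beq p.1 b && Nat.beq p.2 a)

/-- literals of the exchange clause after leaving at name `o` -/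
def exchRest (bl lk : Blk) : ℕ → List ℕ → List ℕ
  | o, [] => [neg (aV o)]
  | o, d :: ds =>
    bif linked lk o (inE bl d) then exchRest bl lk (outE bl d) ds
    else neg (fV o (inE bl d)) :: exchRest bl lk (outE bl d) ds

def exchC (bl lk : Blk) : List ℕ → List ℕ
  | [] => []
  | d :: ds => neg (aV (inE bl d)) :: exchRest bl lk (outE bl d) ds

def isPermRange (m : ℕ) (l : List ℕ) : Bool :=
  Nat.beq l.length m && (List.range m).all fun i => l.any fun j => Nat.beq i j

theorem isPermRange_spec {m : ℕ} {l : List ℕ} (h : isPermRange m l = true) : l.Perm (List.range m) := by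
  simp only [isPermRange, Bool.and_eq_true, List.all_eq_true, List.any_eq_true, Nat.beq_eq] at h
  have h1 : (List.range m).Subperm l := List.subperm_of_subset List.nodup_range
    fun i hi => by obtain ⟨j, hj, rfl⟩ := h.2 i hi; exact hj
  exact (h1.perm_of_length_le (by simp [h.1])).symm

def orient (bs : List (List V)) (d : ℕ) : List V :=
  if d % 2 = 0 then bs.getD (d / 2) [] else (bs.getD (d / 2) []).reverse

section
variable {f : ℕ → V}
/-- blocks are segments with the named ends -/
def BlkOK (G : SimpleGraph V) (f : ℕ → V) (bl : Blk) (bs : List (List V)) : Prop :=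
  List.Forall₂ (fun p l => Seg G (f (p.1 % 32)) (f (p.2 % 32)) l) bl bs

theorem orient_seg {bl : Blk} {bs : List (List V)} (h : BlkOK G f bl bs) {d : ℕ} (hd : d / 2 < bl.length) :
    Seg G (f (inE bl d % 32)) (f (outE bl d % 32)) (orient bs d) := by
  have hl := List.Forall₂.length_eq h
  have h1 : Seg G (f ((bl.getD (d/2) (0,0)).1 % 32)) (f ((bl.getD (d/2) (0,0)).2 % 32)) (bs.getD (d/2) []) := by
    have := (List.forall₂_iff_get.1 h).2 (d/2) hd (hl ▸ hd)
    rw [List.getD_eq_getElem _ _ hd, List.getD_eq_getElem _ _ (hl ▸ hd)]; exact this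
  unfold orient inE outE blkOf
  rcases Nat.mod_two_eq_zero_or_one d with h2 | h2
  · rw [h2]; simpa using h1
  · have h0 : Nat.beq 1 0 = false := rfl
    rw [h2]; simpa only [h0, cond_false, one_ne_zero, if_false] using h1.reverse

theorem linked_spec {lk : Blk} (hlk : ∀ p ∈ lk, EE G (f (p.1 % 32)) (f (p.2 % 32))) {a b : ℕ}
    (h : linked lk a b = true) : FF G K (f (a % 32)) (f (b % 32)) := by
  simp only [linked, List.any_eq_true, Bool.or_eq_true, Bool.and_eq_true, Nat.beq_eq] at h
  obtain ⟨p, hp, ⟨rfl, rfl⟩ | ⟨rfl, rfl⟩⟩ := h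
  · exact Or.inl (hlk p hp)
  · exact Or.inl (hlk p hp).symm

theorem exchRest_spec {bl lk : Blk} {bs : List (List V)} (h : BlkOK G f bl bs)
    (hlk : ∀ p ∈ lk, EE G (f (p.1 % 32)) (f (p.2 % 32))) (o : ℕ) (ds : List ℕ)
    (hd : ∀ d ∈ ds, d / 2 < bl.length)
    (hn : ∀ m ∈ exchRest bl lk o ds, ¬ lit G K A f m) (a : V) (l : List V) (hl : FSeg G K a (f (o % 32)) l) :
    ∃ b, FSeg G K a b (l ++ (ds.map (orient bs)).flatten) ∧ A b := by
  induction ds generalizing o l with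
  | nil =>
    simp only [exchRest, List.forall_mem_singleton, lit_neg, val_a, not_not] at hn
    exact ⟨_, by simpa using hl, hn⟩
  | cons d ds ih =>
    simp only [List.forall_mem_cons] at hd
    rw [exchRest] at hn
    have key : FF G K (f (o % 32)) (f (inE bl d % 32)) ∧
        ∀ m ∈ exchRest bl lk (outE bl d) ds, ¬ lit G K A f m := by
      cases h1 : linked lk o (inE bl d) <;> rw [h1] at hn
      · simp only [cond_false, List.forall_mem_cons, lit_neg, val_f, not_not] at hn
        exact hn
      · exact ⟨linked_spec hlk h1, hn⟩
    have := ih (outE bl d) hd.2 key.2 (l ++ orient bs d) (hl.append (orient_seg h hd.1).toF key.1)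
    simpa using this

theorem flatten_orient (bs : List (List V)) (ds : List ℕ) :
    ((ds.map (orient bs)).flatten).Perm ((ds.map fun d => bs.getD (d / 2) []).flatten) := by
  induction ds with
  | nil => simp
  | cons d ds ih =>
    simp only [List.map_cons, List.flatten_cons]
    refine List.Perm.append ?_ ih
    unfold orient
    split
    · exact List.Perm.refl _
    · exact List.reverse_perm _

theorem exch_holds (cx : Ctx G K A C) {bl lk : Blk} {bs : List (List V)} (h : BlkOK G f bl bs)
    (hC : bs.flatten.Perm C)
    (hlk : ∀ p ∈ lk, EE G (f (p.1 % 32)) (f (p.2 % 32))) (ds : List ℕ)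
    (hp : isPermRange bl.length (ds.map (· / 2)) = true) (hne : bl.length ≠ 0) :
    holds G K A f (exchC bl lk ds) := by
  have hperm := isPermRange_spec hp
  have hlen := List.Forall₂.length_eq h
  have hd : ∀ d ∈ ds, d / 2 < bl.length := fun d hd => by
    have := hperm.mem_iff.1 (List.mem_map_of_mem hd)
    simpa using this
  have hfl : ((ds.map (orient bs)).flatten).Perm C := by
    refine (flatten_orient bs ds).trans (List.Perm.trans ?_ hC)
    have h1 : (ds.map fun d => bs.getD (d / 2) []) = (ds.map (· / 2)).map (fun i => bs.getD i []) := by simp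
    rw [h1]
    have h2 : (List.range bl.length).map (fun i => bs.getD i []) = bs := by
      rw [hlen]; apply List.ext_getElem <;> simp
      intro i h1; rw [List.getElem?_eq_getElem h1]; rfl
    conv_rhs => rw [← h2]
    exact (hperm.map _).flatten
  by_contra hc
  have hn : ∀ m ∈ exchC bl lk ds, ¬ lit G K A f m := fun m hm hh => hc ⟨m, hm, hh⟩
  cases ds with
  | nil => exact hne (by simpa using hperm.length_eq.symm)
  | cons d ds =>
    simp only [exchC, List.forall_mem_cons, lit_neg, val_a, not_not] at hn
    simp only [List.forall_mem_cons] at hd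
    obtain ⟨b, hb, hA⟩ := exchRest_spec h hlk (outE bl d) ds hd.2 hn.2 _ (orient bs d) (orient_seg h hd.1).toF
    exact cx.noHam _ _ _ (by simpa using hfl) hb.chain hb.head hb.last hn.1 hA
end

/-! definition clauses of `f` -/
def fdef (t i j : ℕ) : List ℕ :=
  bif Nat.beq t 0 then [neg (eV i j), pos (fV i j)]
  else bif Nat.beq t 1 then [neg (kV i), neg (kV j), pos (fV i j)]
  else [neg (fV i j), pos (eV i j), pos (kV i)]

theorem fdef_holds {f : ℕ → V} (t i j : ℕ) : holds G K A f (fdef t i j) := by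
  by_contra h
  unfold fdef at h
  cases h1 : Nat.beq t 0 <;> cases h2 : Nat.beq t 1 <;> rw [h1] at h <;> try rw [h2] at h
  all_goals
    simp only [holds, cond_true, cond_false, List.mem_cons, List.not_mem_nil, or_false, exists_eq_or_imp, exists_eq_left,
    lit_pos, lit_neg, val_e, val_k, val_f, not_or, not_not, FF] at h
    tauto

/-! rows -/
def digits : ℕ → ℕ → List ℕ
  | 0, _ => []
  | n + 1, N => bif Nat.beq N 0 then [] else (N % 1024 - 1) :: digits n (N / 1024)

/-- combine pairs of digits into literals -/
def takeLits : ℕ → List ℕ → List ℕ × List ℕ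
  | 0, l => ([], l)
  | _ + 1, [] => ([], [])
  | _ + 1, [_] => ([], [])
  | n + 1, a :: b :: l => match takeLits n l with
    | (x, y) => ((a * 512 + b) :: x, y)

def adhClause : List ℕ → List ℕ → Option (List ℕ)
  | [], _ => none
  | a :: l, w => bif Nat.ble (walkW w + 2) l.length && Nat.beq (lastOf a w % 32) (lastOf a l % 32) then
      some (adhPath (a :: l) ++ walkC a w) else none

/-- one step of the checker; `U` is the mask of literals known to be false -/
def stepC (bl lk : Blk) (hy : List (List ℕ)) (T : Tree) (U : ℕ) : List ℕ → Option (List ℕ)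
  | 0 :: i :: _ => hy[i]?
  | 1 :: a :: x :: y :: z :: _ => some (clawC a x y z)
  | 2 :: L :: l => adhClause (l.take L) (l.drop L)
  | 3 :: ds => bif isPermRange bl.length (ds.map (· / 2)) && !(Nat.beq bl.length 0) then some (exchC bl lk ds) else none
  | 4 :: t :: i :: j :: _ => some (fdef t i j)
  | 5 :: n :: l => match takeLits n l with
    | (c, hs) => bif rup T hs (U ||| negMask c) then some c else none
  | _ => none

def updU (U : ℕ) : List ℕ → ℕ
  | [l] => U ||| 1 <<< flip l
  | _ => U

def runC (bl lk : Blk) (hy : List (List ℕ)) : List ℕ → ℕ → Tree → ℕ → Bool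
  | [], _, _, _ => false
  | N :: rows, i, T, U =>
    match stepC bl lk hy T U (digits 400 N) with
    | none => false
    | some [] => true
    | some (l :: c) => runC bl lk hy rows (i + 1) (T.ins 12 i (l :: c)) (updU U (l :: c))

theorem updU_spec {f : ℕ → V} {U : ℕ} (hU : ∀ l, U.testBit l = true → ¬ lit G K A f l) {c : List ℕ}
    (hc : holds G K A f c) : ∀ l, (updU U c).testBit l = true → ¬ lit G K A f l := by
  unfold updU
  split
  · rename_i m
    intro l hl
    obtain ⟨m', hm, h⟩ := hc
    obtain rfl : m' = m := by simpa using hm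
    rcases testBit_or_shift hl with hl | rfl
    · exact hU l hl
    · rw [lit_flip]; simpa using h
  · exact hU

theorem stepC_holds (cx : Ctx G K A C) {f : ℕ → V} {bl lk : Blk} {bs : List (List V)} (h : BlkOK G f bl bs)
    (hC : bs.flatten.Perm C) (hlk : ∀ p ∈ lk, EE G (f (p.1 % 32)) (f (p.2 % 32)))
    {hy : List (List ℕ)} (hhy : ∀ c ∈ hy, holds G K A f c) {T : Tree} (hT : T.All (holds G K A f))
    {U : ℕ} (hU : ∀ l, U.testBit l = true → ¬ lit G K A f l)
    {row c : List ℕ} (hs : stepC bl lk hy T U row = some c) : holds G K A f c := by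
  unfold stepC at hs
  split at hs
  · exact hhy c (List.mem_of_getElem? hs)
  · obtain rfl := Option.some.inj hs; exact clawC_holds cx ..
  · rename_i L l
    generalize l.take L = p at hs
    cases p with
    | nil => simp [adhClause] at hs
    | cons a p =>
      rw [adhClause] at hs
      cases h1 : (Nat.ble (walkW (l.drop L) + 2) p.length && Nat.beq (lastOf a (l.drop L) % 32) (lastOf a p % 32)) <;>
        rw [h1] at hs
      · simp at hs
      · obtain rfl := Option.some.inj hs
        simp only [Bool.and_eq_true, Nat.beq_eq, Nat.ble_eq] at h1
        exact adh_holds cx _ _ _ h1.1 h1.2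
  · rename_i ds
    cases h1 : (isPermRange bl.length (ds.map (· / 2)) && !(Nat.beq bl.length 0)) <;> rw [h1] at hs
    · simp at hs
    · obtain rfl := Option.some.inj hs
      rw [Bool.and_eq_true] at h1
      refine exch_holds cx h hC hlk ds h1.1 fun h0 => ?_
      rw [h0] at h1; exact absurd h1.2 (by decide)
  · obtain rfl := Option.some.inj hs; exact fdef_holds ..
  · rename_i n l
    generalize takeLits n l = p at hs
    obtain ⟨c', hs'⟩ := p
    simp only at hs
    cases h1 : rup T hs' (U ||| negMask c') <;> rw [h1] at hs
    · simp at hs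
    · obtain rfl := Option.some.inj hs
      by_contra hc
      refine rup_sound hT h1 fun l hl hh => ?_
      rw [Nat.testBit_or, Bool.or_eq_true] at hl
      rcases hl with hl | hl
      · exact hU l hl hh
      · exact hc ⟨l, negMask_spec hl, hh⟩
  · simp at hs

theorem runC_sound (cx : Ctx G K A C) {f : ℕ → V} {bl lk : Blk} {bs : List (List V)} (h : BlkOK G f bl bs)
    (hC : bs.flatten.Perm C) (hlk : ∀ p ∈ lk, EE G (f (p.1 % 32)) (f (p.2 % 32)))
    {hy : List (List ℕ)} (hhy : ∀ c ∈ hy, holds G K A f c) {rows : List ℕ} {i : ℕ} {T : Tree}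
    (hT : T.All (holds G K A f)) {U : ℕ} (hU : ∀ l, U.testBit l = true → ¬ lit G K A f l)
    (hr : runC bl lk hy rows i T U = true) : False := by
  induction rows generalizing i T U with
  | nil => simp [runC] at hr
  | cons N rows ih =>
    rw [runC] at hr
    split at hr
    · simp at hr
    · rename_i hs
      obtain ⟨l, hl, _⟩ := stepC_holds cx h hC hlk hhy hT hU hs
      simp at hl
    · rename_i l c hs
      have hc := stepC_holds cx h hC hlk hhy hT hU hs
      exact ih (Tree.all_ins hT hc) (updU_spec hU hc) hr

/-! ### hypothesis groups -/
/-- no vertex of the first list is equal or adjacent to one of the second -/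
def NAdj (G : SimpleGraph V) (X Y : List V) : Prop := ∀ a ∈ X, ∀ b ∈ Y, ¬ EE G a b
def AllNot (P : V → Prop) (X : List V) : Prop := ∀ a ∈ X, ¬ P a
def AllP (P : V → Prop) (X : List V) : Prop := ∀ a ∈ X, P a
def AdjImp (G : SimpleGraph V) (P : V → Prop) (X Y : List V) : Prop := ∀ a ∈ X, ∀ b ∈ Y, EE G a b → P a
def AdjImp' (G : SimpleGraph V) (P : V → Prop) (X Y : List V) : Prop := ∀ a ∈ X, ∀ b ∈ Y, EE G a b → P b
def NBoth (G : SimpleGraph V) (X Y Z : List V) : Prop := ∀ a ∈ X, ∀ b ∈ Y, ∀ c ∈ Z, ¬ (EE G a b ∧ EE G a c)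

inductive HG where
  | x (X Y : List ℕ) | l (X : List ℕ) | k (X : List ℕ) | n (X : List ℕ) | a (X : List ℕ) | e (X : List ℕ)
  | cc (X Y : List ℕ) | rx (X Y : List ℕ) | xx (X Y Z : List ℕ)

def prs (X Y : List ℕ) : List (ℕ × ℕ) := X.flatMap fun i => Y.map fun j => (i, j)

def HG.cls : HG → List (List ℕ)
  | .x X Y => (prs X Y).map fun p => [neg (eV p.1 p.2)]
  | .l X => X.map fun i => [neg (kV i)]
  | .k X => X.map fun i => [pos (kV i)]
  | .n X => X.map fun i => [neg (aV i)]
  | .a X => X.map fun i => [pos (aV i)]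
  | .e X => (X.zip X.tail).map fun p => [pos (eV p.1 p.2)]
  | .cc X Y => (prs X Y).map fun p => [neg (eV p.1 p.2), pos (kV p.1)]
  | .rx X Y => (prs X Y).map fun p => [neg (eV p.1 p.2), pos (aV p.2)]
  | .xx X Y Z => X.flatMap fun i => (prs Y Z).map fun p => [neg (eV i p.1), neg (eV i p.2)]

def HG.ok (G : SimpleGraph V) (K A : V → Prop) (f : ℕ → V) : HG → Prop
  | .x X Y => NAdj G (X.map fun i => f (i % 32)) (Y.map fun i => f (i % 32))
  | .l X => AllNot K (X.map fun i => f (i % 32))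
  | .k X => AllP K (X.map fun i => f (i % 32))
  | .n X => AllNot A (X.map fun i => f (i % 32))
  | .a X => AllP A (X.map fun i => f (i % 32))
  | .e X => (X.map fun i => f (i % 32)).IsChain (EE G)
  | .cc X Y => AdjImp G K (X.map fun i => f (i % 32)) (Y.map fun i => f (i % 32))
  | .rx X Y => AdjImp' G A (X.map fun i => f (i % 32)) (Y.map fun i => f (i % 32))
  | .xx X Y Z => NBoth G (X.map fun i => f (i % 32)) (Y.map fun i => f (i % 32)) (Z.map fun i => f (i % 32))

theorem mem_prs {X Y : List ℕ} {p : ℕ × ℕ} (h : p ∈ prs X Y) : p.1 ∈ X ∧ p.2 ∈ Y := by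
  simp only [prs, List.mem_flatMap, List.mem_map] at h
  obtain ⟨i, hi, j, hj, rfl⟩ := h
  exact ⟨hi, hj⟩

theorem holds_one {f : ℕ → V} {l : ℕ} (h : lit G K A f l) : holds G K A f [l] := ⟨l, by simp, h⟩

theorem chain_zip {R : V → V → Prop} {g : ℕ → V} {X : List ℕ} (h : (X.map g).IsChain R) :
    ∀ p ∈ X.zip X.tail, R (g p.1) (g p.2) := by
  induction X with
  | nil => simp
  | cons a X ih =>
    cases X with
    | nil => simp
    | cons b X =>
      simp only [List.map_cons, List.isChain_cons_cons] at h
      intro p hp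
      simp only [List.tail_cons, List.zip_cons_cons, List.mem_cons] at hp
      rcases hp with rfl | hp
      · exact h.1
      · exact ih (by simpa using h.2) p hp

theorem HG.ok_holds {f : ℕ → V} {g : HG} (h : g.ok G K A f) : ∀ c ∈ g.cls, holds G K A f c := by
  have mm : ∀ {X : List ℕ} {i : ℕ}, i ∈ X → f (i % 32) ∈ X.map fun i => f (i % 32) :=
    fun hi => List.mem_map_of_mem (f := fun i => f (i % 32)) hi
  cases g <;> simp only [HG.cls, HG.ok, List.mem_flatMap, List.forall_mem_map] at h ⊢
  case x => exact fun p hp => holds_one ((lit_neg _).2 (by rw [val_e]; exact h _ (mm (mem_prs hp).1) _ (mm (mem_prs hp).2)))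
  case l => exact fun p hp => holds_one ((lit_neg _).2 (by rw [val_k]; exact h _ (mm hp)))
  case k => exact fun p hp => holds_one ((lit_pos _).2 (by rw [val_k]; exact h _ (mm hp)))
  case n => exact fun p hp => holds_one ((lit_neg _).2 (by rw [val_a]; exact h _ (mm hp)))
  case a => exact fun p hp => holds_one ((lit_pos _).2 (by rw [val_a]; exact h _ (mm hp)))
  case e => exact fun p hp => holds_one ((lit_pos _).2 (by rw [val_e]; exact chain_zip h p hp))
  case cc =>
    intro p hp
    by_contra hc
    simp only [holds, List.mem_cons, List.not_mem_nil, or_false, exists_eq_or_imp, exists_eq_left, lit_pos, lit_neg,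
      val_e, val_k, not_or, not_not] at hc
    exact hc.2 (h _ (mm (mem_prs hp).1) _ (mm (mem_prs hp).2) hc.1)
  case rx =>
    intro p hp
    by_contra hc
    simp only [holds, List.mem_cons, List.not_mem_nil, or_false, exists_eq_or_imp, exists_eq_left, lit_pos, lit_neg,
      val_e, val_a, not_or, not_not] at hc
    exact hc.2 (h _ (mm (mem_prs hp).1) _ (mm (mem_prs hp).2) hc.1)
  case xx =>
    rintro c ⟨i, hi, hc⟩
    obtain ⟨p, hp, rfl⟩ := List.mem_map.1 hc
    by_contra hc
    simp only [holds, List.mem_cons, List.not_mem_nil, or_false, exists_eq_or_imp, exists_eq_left, lit_pos, lit_neg,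
      val_e, not_or, not_not] at hc
    exact h _ (mm hi) _ (mm (mem_prs hp).1) _ (mm (mem_prs hp).2) hc

def AllOK (G : SimpleGraph V) (K A : V → Prop) (f : ℕ → V) : List HG → Prop
  | [] => True
  | g :: gs => g.ok G K A f ∧ AllOK G K A f gs

theorem AllOK.holds {f : ℕ → V} {gs : List HG} (h : AllOK G K A f gs) :
    ∀ c ∈ gs.flatMap HG.cls, holds G K A f c := by
  induction gs with
  | nil => simp
  | cons g gs ih =>
    intro c hc
    rw [List.flatMap_cons, List.mem_append] at hc
    exact hc.elim (HG.ok_holds h.1 c) (ih h.2 c)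

/-! ### blocks of a cycle -/
/-- consecutive (cyclically) elements of `l` are related -/
def Cyc (R : V → V → Prop) (l : List V) : Prop :=
  l.IsChain R ∧ ∀ a ∈ l.getLast?, ∀ b ∈ l.head?, R a b

def Ends (a b : V) (l : List V) : Prop := l.head? = some a ∧ l.getLast? = some b

theorem Ends.single (a : V) : Ends a a [a] := ⟨rfl, rfl⟩

def linkG (z : ℕ) : Blk → Blk
  | [] => []
  | [p] => [(p.2, z)]
  | p :: q :: l => (p.2, q.1) :: linkG z (q :: l)

def links : Blk → Blk
  | [] => []
  | p :: l => linkG p.1 (p :: l)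

theorem linkG_spec {f : ℕ → V} (z : ℕ) {bl : Blk} {bs : List (List V)}
    (h : List.Forall₂ (fun p l => Ends (f (p.1 % 32)) (f (p.2 % 32)) l) bl bs)
    (hc : bs.flatten.IsChain G.Adj) (hz : ∀ a ∈ bs.flatten.getLast?, G.Adj a (f (z % 32))) :
    BlkOK G f bl bs ∧ ∀ p ∈ linkG z bl, EE G (f (p.1 % 32)) (f (p.2 % 32)) := by
  induction h with
  | nil => exact ⟨List.Forall₂.nil, by simp [linkG]⟩
  | @cons p b bl bs h1 h2 ih =>
    rw [List.flatten_cons, List.isChain_append] at hc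
    obtain ⟨hc1, hc2, hc3⟩ := hc
    cases h2 with
    | nil =>
      refine ⟨List.Forall₂.cons ⟨hc1, h1.1, h1.2⟩ List.Forall₂.nil, ?_⟩
      simp only [linkG, List.forall_mem_singleton]
      exact Or.inr (hz _ (by simp [h1.2]))
    | @cons q c bl bs h3 h4 =>
      have := ih hc2 fun a ha => hz a (by
        rw [List.flatten_cons, List.getLast?_append]
        rw [Option.mem_def] at ha ⊢
        rw [ha]; rfl)
      refine ⟨List.Forall₂.cons ⟨hc1, h1.1, h1.2⟩ this.1, ?_⟩
      simp only [linkG, List.forall_mem_cons]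
      refine ⟨Or.inr (hc3 _ (by rw [h1.2]; rfl) _ ?_), this.2⟩
      simp [List.head?_append, h3.1]

theorem links_spec {f : ℕ → V} {bl : Blk} {bs : List (List V)}
    (h : List.Forall₂ (fun p l => Ends (f (p.1 % 32)) (f (p.2 % 32)) l) bl bs)
    (hc : Cyc G.Adj bs.flatten) :
    BlkOK G f bl bs ∧ ∀ p ∈ links bl, EE G (f (p.1 % 32)) (f (p.2 % 32)) := by
  cases h with
  | nil => exact ⟨List.Forall₂.nil, by simp [links]⟩
  | @cons p b bl bs h1 h2 =>
    refine linkG_spec p.1 (List.Forall₂.cons h1 h2) hc.1 fun a ha => hc.2 a ha _ ?_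
    simp [List.head?_append, h1.1]

def unitMask : List (List ℕ) → ℕ
  | [] => 0
  | c :: cs => updU (unitMask cs) c

theorem unitMask_spec {f : ℕ → V} {cs : List (List ℕ)} (h : ∀ c ∈ cs, holds G K A f c) :
    ∀ l, (unitMask cs).testBit l = true → ¬ lit G K A f l := by
  induction cs with
  | nil => simp [unitMask]
  | cons c cs ih =>
    rw [List.forall_mem_cons] at h
    exact updU_spec (ih h.2) h.1

/-- all hypothesis clauses of a model -/
def hyC (bl : Blk) (gs : List HG) : List (List ℕ) :=
  gs.flatMap HG.cls ++ (links bl).map fun p => [pos (eV p.1 p.2)]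

def runM (bl : Blk) (gs : List HG) (rows : List ℕ) : Bool :=
  runC bl (links bl) (hyC bl gs) rows 0 .leaf (unitMask (hyC bl gs))

theorem runM_sound (cx : Ctx G K A C) (f : ℕ → V) {bl : Blk} {gs : List HG} {rows : List ℕ}
    (hr : runM bl gs rows = true) {bs : List (List V)}
    (hc : Cyc G.Adj bs.flatten) (hC : bs.flatten.Perm C)
    (h : List.Forall₂ (fun p l => Ends (f (p.1 % 32)) (f (p.2 % 32)) l) bl bs)
    (hg : AllOK G K A f gs) : False := by
  obtain ⟨h1, h2⟩ := links_spec h hc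
  have hh : ∀ c ∈ hyC bl gs, holds G K A f c := by
    intro c hc
    rcases List.mem_append.1 hc with hc | hc
    · exact hg.holds c hc
    · obtain ⟨p, hp, rfl⟩ := List.mem_map.1 hc
      exact holds_one ((lit_pos _).2 (by rw [val_e]; exact h2 p hp))
  exact runC_sound cx h1 hC h2 hh (T := .leaf) trivial (unitMask_spec hh) hr
end HamADH

open SimpleGraph
namespace HamADH
variable {V : Type*} {G : SimpleGraph V} {K A : V → Prop} {C : List V}

def rows_B0 : List ℕ := [
  49522446735582174126564973571,
  2385258735849906976629134705177628445884362236854911950096391068264036064001753327991014529321486425342887942,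
  7472377583826896163606371331, 6741125974371244987308055499238149992042279092202234531768130363427147489721471187460954507522037793798,
  14296874484738, 7343201929958952057722137358356080087111302127622, 45808623066722182796646816771,
  16462753240797631323247241198535224172303459920657060918230405461241719280685798213088657015027098943558273030,
  16480709056554124344844427992067,
  21198837147229164024697959477874399478408104100726631615771421298723355633863626353958354937974564602886,
  16341577014011164559150896842132381770755,
  52671483553276644851138206176016721639044684741584818347143533580044514525888405350427028157595999796757287536835101548690273579898562623416177743485825739923071999587245901586193148597816134227493894,
  16480698176221747819778925403139,
  29595694281663717398072787567618248198023984950677529096408670068116555968293421769606404754622204888070, 18578789719701042881863097347,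
  34221729572922971752265918828542572270075481860591574966650867969844073289345939915281003680437376140294, 45808623069035893921806294019,
  39948179068535302366287357112846240179057461425803969865192176923036716422315478747796812827096514418938234886,
  14900024903090028017375779843,
  44645264234083237905859401364262126671113396311491272666681420885943774362763917598037804201244497717484341254,
  16111369746852662945899355139, 45452307283469155365381520483876091752660814697803669582417667132409627488328601923198312894185478,
  16498036590311676219647865134083,
  52139687368503035535858756743177296678002058734056960313807928681751585469948426396215162229234148066310, 7472377588431828981615959043,
  53420553495676451064894487853719160420329867267999467548501578079111467675604047522864209889083398, 9671017477, 30117389666310,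
  7472377583828023163024841731, 56356385938998151800864155087671032916974968559892981158647806656675088377681290475526,
  17765687191720497241861979642883, 63844371976741451056124026431405726626593064101554869485227669940490603102108874774739434502,
  16506635158530, 41863429525317032813522326656006, 8802538624002, 53659805764682524296476997396720570088957250080299033606,
  17332386021400463790669044739, 76066587838542058367665940179208889040362019195528894876975856716162083875450668910159870982,
  16480709056555277266349034839043, 72771713941319844013325336301191136933744096525481050383625612327251392620147718,
  16934422349609612141926403, 63064290317753638437201027634826711756297405233017922566, 16094444793457516966315039747,
  69842174492630734416267521089307085002066530384389834217105414, 7835353319033860032425198974148611,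
  96140294214094897443194856515526223445431957074001129167399947669378320614976337525904497871699974, 17763202849177326704478203681795,
  91969440080534857968981413029811847030542909482603279689393996270694027828886766630918, 15219239692854083282665164774403,
  91414239865091815735545053656808788772573204929652028342483456099408396080395270, 17765687191734321049714286402563,
  86510760053722161195541265700988631212773702010699958202197848632326, 7472377588431826782592703491,
  85183422904511270543640159604832619717342132936521533247989766, 45808623069035907105208409091,
  112056889127067448473633282864367040079950624212292236268910833863209171863538412546354592774, 46908030020323516309674832961539,
  116130961079736764401931865421050862081888703153341848889933375833071629370168698004682324998, 10739516421, 64960311855110,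
  43687663595561236305923, 98038927258583192747902355426297228063530600479134153169709062, 7472377583825757071707479043,
  106171259522489959893236335663987903249794852305039198635378900741126, 7835353319038574329584535789903875,
  138860034932513099090979498102793563520556978729198039642534823382667976203587864778515406400798726, 48033820263719908225726183081254915,
  143132009004354797839428753686821264106484738727812348712317335942086967401977912353458492263120902,
  8023401798695500112340517252932576259, 140575392795750132460987336985962992368817140057315277179975779223380179638518642433378499590,
  14976458565532245519318805595480616084483,
  174870472727800262694461193280864165748292488517409317494765474180925929505257620360415213558764033074114406911069190,
  14900024903088902117468937219, 128997105272837875317349544806973908432315825253583849095179914798699655174,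
  18189519717557582553259275815231491, 139583748987815353031750583420422975566592943317095427231994505468828592215438342,
  8023401798695500113493438757539423235,
  180860734034965565123449275864214830850123987402039204115178810955885081745699352805538243078662990195892176902,
  7835353319038574329570252876161027, 153489830935642451401065531790180619284355914123380456720770712144130667076433709381638,
  10385313940227752964, 100306995481614541041047703558, 16496798650272390841573069298691,
  121523008230941424494965620390841427583442948726790, 14625447825318148660721517860395951107,
  165542332953577702251174225976477730835836427683866716971251718474459056434895941285894, 16500196909058,
  115659722598670341128899450153640925190, 7835353319033860031286115665190915,
  157742867257412733515984639430820959958901925117710944612090091793839828998, 16926158216139291464046595,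
  140169467042584949433502257330931068489230202815908946950, 43687663596660747933699,
  136599023937527396345346120041517064586631628988422, 7835353319038574327318453062475779,
  139061027876190070673890226471455259873632823812102, 45808623066722183896158444547,
  156619967434980560238325915722128790278580451821944523468056582, 16506645651458, 125850225012556275559099265979398,
  50367111124455029727629986255067462771715, 206309575696845652658987648416441135887481018449262694530808268665017992909343678132772682758,
  7472377588431827882104331267, 158174794822742857542132066830765442277821321427886810118, 7835353319033860032412015572033539,
  169277744829397664104293584999893005085313001714273686463195142, 7472377583828008871521164291,
  164692388943136277189595021373818227803102044812219524102, 45808623069034781205301566467,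
  167754387065047823591189252970261455322781184204156707846, 14305464419330, 122137059788806, 7258284210721166317328387,
  150818052385031773908052402767821543430, 46908030020323517435574739804163, 176952353270063483335612804492957922850917027271729488902,
  8023401798695500113494564657446265859, 179632725183417486661320003320436010081696318547649635334, 17340848499824039689449380867,
  166509691806071346839014016174050169095986182, 17332386013334517958625467395,
  185759714558328856992582313319471008763550246342455469062, 43687663597760259561475, 171807207526845021140689657796258903020805126,
  15584542297503876544950795883257859, 183367076605703323116899704021701681060885793087494, 18570327233211518950935895043,
  185926132924685817551443125488088977341286257270790, 16094444801523470496004316163, 180189044136244216533017774847399973079751686,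
  16498036590311666088748806839299, 166416282228371608003312262059014, 7651714650554190625373851492355,
  195056235021129268002409034487494388171788824616966, 14305472807938, 148525339904006, 12690126981298978067858309782531,
  195722947576091355750926034190953440973916478470, 7835353319033858878364611058343939, 185380576593466795237426079552479696902,
  14280090214570580245894342006284291, 188039032585036625802642072960997791750, 8594130949, 10383057749884797956, 3222275077,
  7835353319038574328444352969318403, 208381081589574019987263176992130088940229103622,
  172474525171730088884815594566103008596901147708422, 8596227077, 10742662149, 17332386021400464892328156163,
  68718556811307641138548825753923563867559957510, 10385313939157156868, 5369758725, 7433691957600340746519452675,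
  190907692301618165600201028284506908580158004235406680758959476742, 186648273253858931574353199067609952507875231364970440926696454,
  18524850604747677608592252465889727511916539099191710726, 28487791790819345752392786913762957295322924742930565435398,
  46908030020323515183774926118915, 45808623069033642121992608771, 230010531154777911391821241628091599169589877766,
  266610461969013306791069296434757850571745981451348521938400054278, 37911024559831481865985909552180429884334884583593456177158,
  45808623069034768021899451395, 247020563295199571890563877608286142862760581589377030,
  260548971636623108240158725176556490971451320338202634488838, 67553516435235097526584024073507846,
  223527288503585440681924233283683485702, 192747467226898259871223012921350,
  182063693930193949951687039389362361488832427065501102904326, 8594129925, 44736165210397587168828419,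
  39169318000138210490922631362821950305468323820825001978550453052107659270, 15216762603849692907486200208387,
  15584542297503877698998200396947459, 47155151446122960536685198151081974048593780312059449185286,
  266666422021906435935595818011090223351727557552502740998, 166668516492637473103063536460578396766429225423878,
  18135085188675425245599747, 230057237731587706325669232545693394943008943155102590453972727136386283941663750,
  279542782748836320128163923671192804395323063814850241105926, 16934422349600816048904195, 44736167522980604808272899,
  302924035360338279094939570393748674662362326549034983951413809158, 45903944297417471086488456291096315083262794758,
  259498214024803245603158896067033937092807686, 37022484914610446728259449905222723853035032324810477574, 15717231243603157690882051,
  16094444793449633466878532611, 344091806103447079218715438478417926170196032060023643483781132802667559522310,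
  6318565585982828310137281624549140559671457512061668358, 119464166623709567252894430797012452761770460133819419727878, 5369759749,
  15401753787394, 19024671003942324786578839313411, 15257625500764188689791721676803,
  401336248382450986837989632686130433360514299830299285839128772804099825338449274821690789894,
  378332941729536620822691210128460529305604017785535079533821667827219845543523660466228230,
  34479876009193784927817097158329420499471305734, 17666750970753566036314025862166583956722443880454,
  164484596937556975501822954846920819155671046, 95473392491622040995270432796049736209414, 257429874169389214282615249440774,
  240933032654118717491206, 6980873413986310, 163480891749828614, 170037542967252880459782, 193883705734858758,
  172675596515566022513508855267636643861889957372009542327302, 314404184021314087320270013849119173756053306213404678,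
  7651714650554191751273758334979, 145243675990515264419926274428939095965176838, 283284183213120590877843566483102240774,
  271538450969073464875261170289670, 89930515643188854740439037140252801111046, 261168365562539845659659270,
  90045180876531084599707285781400625212095095958561554789571590, 283147528739314184480541880601284614,
  281195956143736735613098331466788761447607310342, 285854181885884050822787136972917766, 7651714650554192877173665177603,
  295122620050579779461149405704851820550, 282844783416993667457411080784902, 291049014031416582519155304697958406,
  259651895719206324230, 14511846045937969006647299, 261944239748214163462, 54742816503897057340146321414,
  67122216919813793570448476166, 166157420062644190510074299398]

theorem model_B0 (cx : Ctx G K A C) {v1 s1 y k1 k2 y2 s2 v2 t2 t1 a a2 x1 z x2 : V} {Bs1 Bk1 By2 Bt2 : List V}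
    (hc : Cyc G.Adj [[v1], Bs1, Bk1, By2, [v2], Bt2].flatten) (hC : [[v1], Bs1, Bk1, By2, [v2], Bt2].flatten.Perm C)
    (es1 : Ends s1 y Bs1) (ek1 : Ends k1 k2 Bk1) (ey2 : Ends y2 s2 By2) (et2 : Ends t2 t1 Bt2)
    (h0 : AllP A [v1, v2])
    (h1 : AllNot A [s1, y, k1, k2, y2, s2, t2, t1, a, a2])
    (h2 : List.IsChain (EE G) [v1, x1, z, x2, v2])
    (h3 : AllNot K [x1, z, x2])
    (h4 : AllNot K [s1, t1, y, a, s2, y2, a2, t2])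
    (h5 : NAdj G [x1, z, x2] [s1, y, k1, k2, y2, s2, t2, t1, a, a2])
    (h6 : NAdj G [s1, t1, y, a] [s2, y2, a2, t2, v2])
    (h7 : NAdj G [v1] [s2, y2, a2, t2])
    (h8 : List.IsChain (EE G) [s1, t1])
    (h9 : List.IsChain (EE G) [v1, a, y])
    (h10 : List.IsChain (EE G) [v2, a2, y2])
    (h11 : AllP K [k1, k2])
    (h12 : List.IsChain (EE G) [s2, t2])
    (h13 : NAdj G [v1] [v2]) : False :=
  runM_sound cx (fun i => [v1, s1, y, k1, k2, y2, s2, v2, t2, t1, a, a2, x1, z, x2].getD i v1) (bl := [(0, 0), (1, 2), (3, 4), (5, 6), (7, 7), (8, 9)])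
    (gs := [.a [0, 7], .n [1, 2, 3, 4, 5, 6, 8, 9, 10, 11], .e [0, 12, 13, 14, 7], .l [12, 13, 14], .l [1, 9, 2, 10, 6, 5, 11, 8], .x [12, 13, 14] [1, 2, 3, 4, 5, 6, 8, 9, 10, 11], .x [1, 9, 2, 10] [6, 5, 11, 8, 7], .x [0] [6, 5, 11, 8], .e [1, 9], .e [0, 10, 2], .e [7, 11, 5], .k [3, 4], .e [6, 8], .x [0] [7]])
    (rows := rows_B0) (by decide +kernel)
    hc hC (.cons (Ends.single _) (.cons es1 (.cons ek1 (.cons ey2 (.cons (Ends.single _) (.cons et2 (.nil))))))) ⟨h0, h1, h2, h3, h4, h5, h6, h7, h8, h9, h10, h11, h12, h13, trivial⟩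

def rows_kk : List ℕ := [
  18143349322145745923479555, 2037744553166479920173542927090591902298721372160512762543105128977674246, 15717231243604257194121219,
  6118400389127707986739268907158593476571955486018280386820298291090042886, 16502339149826,
  7705891634742115081282633957440334564896585927160243206, 16505568763906, 10271914219891930325084495493300825888817343897606,
  7263006573815351861057539, 15717861573161433129215976325456924878352128756082361464521476811782, 15725495377073477292922883,
  17182211904873172885299850824208269260965678783612855302, 15725495377066888809945091,
  23343434992566583239384629730126992175932547962320591494752392236590182406, 9672596385427188987467779,
  25841005700819484326187357855223581864049998437529824024847029644294, 7259464802328691737630723,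
  27845225140464187030528639812823277691638641236410385365477382, 6194541809590000816472726531,
  37800468942613097863558632967085540201538806857589145853799376797944528361396764686342, 15717231243607556802746371,
  35426071572283118945457287133907916514226030425834147750523131931654, 10739516421, 25377893255174, 8802538624002,
  36558962207816730225461508870332220318573696917510, 8594130949, 31146905140768803846, 10142456049507711137865316441091,
  54333630871462295034329410242207248362181288624921444765584536304810042659451910, 10384180351256757252,
  40270744090809432255487324239959046, 9672596385426088402098179, 50991396446317297305759249365496887763195404838272771078,
  9671017477, 38913482688518, 16504495022082, 44764502878186324534235142, 15717231243603157682493443,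
  52455180617719840340674449466324948998, 8820791183366, 42286101563398, 7612098144366475559541744344067,
  50814239571615847287814, 7258284215219268386560003, 54797161458204837206298630, 16503421280258, 52179558729734,
  6049357238171849133660163, 27287734559463152176680838695558119953414, 8596227077, 10385313939157156868, 5369759749,
  5369758725, 68059139697143356485472232956303638530054, 14304391726082, 63111025763813382, 3222275077, 65362673110353926,
  10740564997, 67616824418633734, 36093893696030726, 10383057749883749380, 72674654480430532614, 9667871749,
  73251889152526342, 8594129925, 75505885841983494, 31595583325079558, 14304396968962, 80758624892190984198,
  15725495377065781778978819, 75363085509940333882397641814192621622396934, 53096394190184515590, 15725495377065789298317315,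
  16094444793457514766226430979, 15673324952638836643531210483566598, 39921044208090832372849734939409648646,
  15725495377064682273642499, 19160850137245130015386336676653866945542, 90158045439461382, 30775016002372385114118,
  47305598877278474863622]

theorem model_kk (cx : Ctx G K A C) {v1 s1 y k1 k2 y2 s2 v2 t2 t1 a a2 x1 z x2 : V} {Bs1 Bk1 By2 Bt2 : List V}
    (hc : Cyc G.Adj [[v1], Bs1, Bk1, By2, [v2], Bt2].flatten) (hC : [[v1], Bs1, Bk1, By2, [v2], Bt2].flatten.Perm C)
    (es1 : Ends s1 y Bs1) (ek1 : Ends k1 k2 Bk1) (ey2 : Ends y2 s2 By2) (et2 : Ends t2 t1 Bt2)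
    (h0 : AllP A [v1, v2])
    (h1 : AllNot A [s1, y, k1, k2, y2, s2, t2, t1, a, a2])
    (h2 : List.IsChain (EE G) [v1, x1, z, x2, v2])
    (h3 : AllNot K [x1, z, x2])
    (h4 : AllNot K [s1, t1, y, a, s2, y2, a2, t2])
    (h5 : NAdj G [x1, z, x2] [s1, y, k1, k2, y2, s2, t2, t1, a, a2])
    (h6 : NAdj G [s1, t1, y, a] [s2, y2, a2, t2, v2])
    (h7 : NAdj G [v1] [s2, y2, a2, t2])
    (h8 : List.IsChain (EE G) [s1, t1])
    (h9 : List.IsChain (EE G) [v1, a, y])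
    (h10 : List.IsChain (EE G) [v2, a2, y2])
    (h11 : AllP K [k1, k2])
    (h12 : List.IsChain (EE G) [s2, t2])
    (h13 : List.IsChain (EE G) [v1, v2])
    (h14 : List.IsChain (EE G) [k1, k2]) : False :=
  runM_sound cx (fun i => [v1, s1, y, k1, k2, y2, s2, v2, t2, t1, a, a2, x1, z, x2].getD i v1) (bl := [(0, 0), (1, 2), (3, 4), (5, 6), (7, 7), (8, 9)])
    (gs := [.a [0, 7], .n [1, 2, 3, 4, 5, 6, 8, 9, 10, 11], .e [0, 12, 13, 14, 7], .l [12, 13, 14], .l [1, 9, 2, 10, 6, 5, 11, 8], .x [12, 13, 14] [1, 2, 3, 4, 5, 6, 8, 9, 10, 11], .x [1, 9, 2, 10] [6, 5, 11, 8, 7], .x [0] [6, 5, 11, 8], .e [1, 9], .e [0, 10, 2], .e [7, 11, 5], .k [3, 4], .e [6, 8], .e [0, 7], .e [3, 4]])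
    (rows := rows_kk) (by decide +kernel)
    hc hC (.cons (Ends.single _) (.cons es1 (.cons ek1 (.cons ey2 (.cons (Ends.single _) (.cons et2 (.nil))))))) ⟨h0, h1, h2, h3, h4, h5, h6, h7, h8, h9, h10, h11, h12, h13, h14, trivial⟩

def rows_c31 : List ℕ := [
  16502345441282, 1502904387740334412134899264986043695944480858118, 10739516421, 3387660699654, 46908030020323501683972234027011,
  8047258444708811930524398013506307546348182813364888494155782, 2629594777606, 9671017477, 9015326411851782,
  45808623069020142319300516867, 14831961189950295180210535825878209510303996059654, 8596227077, 13553848289286,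
  10385313939157156868, 16538663501489241065478, 5369759749, 18030893340821510, 5369758725, 20282701736052742,
  16499117924354, 22536720974088198, 18143349322145745923479555, 25387938188616534022, 7263006573825247465707523,
  27691533798210537478, 7437318731586921415966727171, 30724226593803039934470, 7283096255820795479066630,
  13015356790911797298182]

theorem model_c31 (cx : Ctx G K A C) {v1 s1 y k1 k2 y2 s2 v2 t2 t1 a p x1 z x2 : V} {Bs1 Bk1 By2 Bt2 : List V}
    (hc : Cyc G.Adj [[v1], Bs1, Bk1, By2, [v2], Bt2].flatten) (hC : [[v1], Bs1, Bk1, By2, [v2], Bt2].flatten.Perm C)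
    (es1 : Ends s1 y Bs1) (ek1 : Ends k1 k2 Bk1) (ey2 : Ends y2 s2 By2) (et2 : Ends t2 t1 Bt2)
    (h0 : AllP A [v1, v2])
    (h1 : AllNot A [s1, y, k1, k2, y2, s2, t2, t1, a, p])
    (h2 : List.IsChain (EE G) [v1, x1, z, x2, v2])
    (h3 : AllNot K [x1, z, x2])
    (h4 : AllNot K [s1, t1, y, a, p, s2, y2, t2])
    (h5 : NAdj G [x1, z, x2] [s1, y, k1, k2, y2, s2, t2, t1, a, p])
    (h6 : NAdj G [s1, t1, y, a, p] [s2, y2, t2, v2])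
    (h7 : NAdj G [v1] [s2, y2, t2])
    (h8 : List.IsChain (EE G) [s1, t1])
    (h9 : List.IsChain (EE G) [v1, a, p, y])
    (h10 : List.IsChain (EE G) [v2, y2])
    (h11 : AllP K [k1, k2])
    (h12 : NAdj G [v1] [p, y])
    (h13 : NAdj G [a] [y])
    (h14 : List.IsChain (EE G) [s2, t2])
    (h15 : List.IsChain (EE G) [v1, v2]) : False :=
  runM_sound cx (fun i => [v1, s1, y, k1, k2, y2, s2, v2, t2, t1, a, p, x1, z, x2].getD i v1) (bl := [(0, 0), (1, 2), (3, 4), (5, 6), (7, 7), (8, 9)])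
    (gs := [.a [0, 7], .n [1, 2, 3, 4, 5, 6, 8, 9, 10, 11], .e [0, 12, 13, 14, 7], .l [12, 13, 14], .l [1, 9, 2, 10, 11, 6, 5, 8], .x [12, 13, 14] [1, 2, 3, 4, 5, 6, 8, 9, 10, 11], .x [1, 9, 2, 10, 11] [6, 5, 8, 7], .x [0] [6, 5, 8], .e [1, 9], .e [0, 10, 11, 2], .e [7, 5], .k [3, 4], .x [0] [11, 2], .x [10] [2], .e [6, 8], .e [0, 7]])
    (rows := rows_c31) (by decide +kernel)
    hc hC (.cons (Ends.single _) (.cons es1 (.cons ek1 (.cons ey2 (.cons (Ends.single _) (.cons et2 (.nil))))))) ⟨h0, h1, h2, h3, h4, h5, h6, h7, h8, h9, h10, h11, h12, h13, h14, h15, trivial⟩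

def rows_k1v2c : List ℕ := [
  18135085197688122068965379, 2157260135770896951141148279174135860598631953306121730350600170502, 16506645644290,
  4220874474802899801872520201700684506078214, 13204880101378, 6994856303980660751222851813909242538105862, 11820598277,
  7719136266246, 4631050586118, 20300979932075847603167896280067, 12992268608718077254602792306217990, 10741613573,
  13420704303110, 15721947846612113666606084, 16149922720615761926, 12888048645, 18031054393706502, 13199511392258,
  25714165272615479887301262172587149835184905222, 18135085190926135220770819, 2489201885037299173967268870,
  14508304276694324419237891, 24817807458591864522758, 12889097221, 27047117391398918, 15725490777777856463242244,
  29984994103181445126, 101377, 102401, 22464707067760245475334, 6936694635235379206, 10742663173, 36062914119992326]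

theorem model_k1v2c (cx : Ctx G K A C) {v1 s1 y k1 c1 c2 k2 y2 s2 v2 t2 t1 a a2 x1 z x2 : V} {Bs1 Bc1 By2 Bt2 : List V}
    (hc : Cyc G.Adj [[v1], Bs1, [k1], Bc1, [k2], By2, [v2], Bt2].flatten) (hC : [[v1], Bs1, [k1], Bc1, [k2], By2, [v2], Bt2].flatten.Perm C)
    (es1 : Ends s1 y Bs1) (ec1 : Ends c1 c2 Bc1) (ey2 : Ends y2 s2 By2) (et2 : Ends t2 t1 Bt2)
    (h0 : AllP A [v1, v2])
    (h1 : AllNot A [s1, y, k1, c1, c2, k2, y2, s2, t2, t1, a, a2])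
    (h2 : List.IsChain (EE G) [v1, x1, z, x2, v2])
    (h3 : AllNot K [x1, z, x2])
    (h4 : AllNot K [s1, t1, y, a, s2, y2, a2, t2])
    (h5 : NAdj G [x1, z, x2] [s1, y, k1, c1, c2, k2, y2, s2, t2, t1, a, a2])
    (h6 : NAdj G [s1, t1, y, a] [s2, y2, a2, t2, v2])
    (h7 : NAdj G [v1] [s2, y2, a2, t2])
    (h8 : List.IsChain (EE G) [s1, t1])
    (h9 : List.IsChain (EE G) [v1, a, y])
    (h10 : List.IsChain (EE G) [v2, a2, y2])
    (h11 : AllP K [k1, k2])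
    (h12 : List.IsChain (EE G) [s2, t2])
    (h13 : AdjImp G K [c1, c2] [s1, t1, y, a, s2, y2, a2, t2])
    (h14 : List.IsChain (EE G) [v1, v2])
    (h15 : List.IsChain (EE G) [k1, v2]) : False :=
  runM_sound cx (fun i => [v1, s1, y, k1, c1, c2, k2, y2, s2, v2, t2, t1, a, a2, x1, z, x2].getD i v1) (bl := [(0, 0), (1, 2), (3, 3), (4, 5), (6, 6), (7, 8), (9, 9), (10, 11)])
    (gs := [.a [0, 9], .n [1, 2, 3, 4, 5, 6, 7, 8, 10, 11, 12, 13], .e [0, 14, 15, 16, 9], .l [14, 15, 16], .l [1, 11, 2, 12, 8, 7, 13, 10], .x [14, 15, 16] [1, 2, 3, 4, 5, 6, 7, 8, 10, 11, 12, 13], .x [1, 11, 2, 12] [8, 7, 13, 10, 9], .x [0] [8, 7, 13, 10], .e [1, 11], .e [0, 12, 2], .e [9, 13, 7], .k [3, 6], .e [8, 10], .cc [4, 5] [1, 11, 2, 12, 8, 7, 13, 10], .e [0, 9], .e [3, 9]])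
    (rows := rows_k1v2c) (by decide +kernel)
    hc hC (.cons (Ends.single _) (.cons es1 (.cons (Ends.single _) (.cons ec1 (.cons (Ends.single _) (.cons ey2 (.cons (Ends.single _) (.cons et2 (.nil))))))))) ⟨h0, h1, h2, h3, h4, h5, h6, h7, h8, h9, h10, h11, h12, h13, h14, h15, trivial⟩

def rows_lg : List ℕ := [
  16483193399098446688838766042115,
  2997607371820032127724420342014217729420905940687226818207393952241612529545172058292974395978229335175743494,
  17343266345705433325464722435, 7148469080829757656462583043992611546086536543759022225395522941923069469011698772651504208723974,
  18135085190930523604654083, 8579664115418149294900282006497436159218984825081916477773664234502, 20563564450461649488320515,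
  12375843433597038598384092973383239814742796783895158950565912783878, 18145710505377287291017219,
  15319651391083131611249479385744937817555038513029060953225823267846, 18145710505379487394306051,
  18223998818933818575806608261395405481437522245312521887033350, 18135085198822818068830211,
  20946693715541542409228384529482712559638459578005335252674566, 46051152676706737723395,
  24126055012818964654561590539665314615376515420189882017916934, 16506639370242,
  26095838136550776535032700971770678603587790283891287046, 18145710505379484173080579,
  32589221119137667644004465789474361942478472684081559018579499691014, 21765407887906872612624387,
  37718047634049248656881325302062793863908030859783155672028482944946417670, 15737301293279562626504707,
  41141313808893032105256485849875992477741331313108325249513079093045768198, 17759489029050258449507621542915,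
  56770097440725911756880125784121534107264242733086231469234682713882480158876464939137545346805121696774, 18145710505389381925214211,
  43935007809930846720922980730633428498974996698240614319269894, 19807329059842, 42433513735494817475793264158745521488939870855174,
  21765407883393390255020035, 52713741864591665652732605761913624069412249881960952613713937968134, 19796581158914,
  46007549106732666248914383866848900465826822, 18135085190941518710446083,
  56900361170498321016088828246135864167918665798758160273516550, 16480707847615618103262316600323,
  75949220173214925747774235240468124245924328655529357777933554506319834304734513488370613254, 19806255321090,
  54394828912561521018510293288773563582520326, 21765407881151473171568643,
  66341122179023304072390524810696864966983965087141272853948422, 16505562465282,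
  65940722196209383299902680877203558392271929989487666182, 19799805533186, 68984761173342063489422533002986917315442811278187308038,
  9679679937407705277274115, 83654345567408873405716667768347504260903479258771083569043340531390754822, 15720773010589511349966851,
  86729074073363860459327815196125188327937250081175259199453857130973507590, 21095775633877816655292144643,
  94522545807556179464465962392563823063287273494319750387416109637010586583708678, 17759489029053716103515771771907,
  93705015789523370315591950912276962342772369739246275503521125769237508102, 18701367650306,
  84336654988743078988937191014259197869247291548452791302, 15725490777777856463242244, 72258575835103545574955622077446,
  15725490777777855391597572, 78427064406439367150468165311185033222, 18145710505379498131724291,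
  94109297470432584137574038654494751930529751286202508294, 15618731725514750443235593112526851,
  155150231017809100926534891008594104798030371226057308448525430377831848985559949156994156076725643901266706633346054, 7520389125,
  71688378124294, 16506645644290, 89095931307152905188165154654441707526, 18707805897730,
  105791592577992484429803912266820146893680204443357815814, 15721947846612113666606084, 90005684238298685138246709548038,
  12887000069, 80357769611270, 22822666212302617910472936004611, 121077449598938088517332051786628322424538090839750145232349190,
  5500780417026, 118015639006426603679071855038387869205781192157831373830, 18570327235519611559876762627,
  133689021120952562384181398545818739690443219107250230999088819612678, 18704588883970,
  124181539059819675462409493930351794573167254383606375430, 19799802384386, 105221200969698983673732856288262, 18706741602306,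
  118517638137739311026775378958944264922340358, 9679679937407687019468803, 121895951326877628421173189688500209048361990,
  15724305564330332411397124, 112823395042406958480295986205702, 18570327235512856160435706883,
  146378877116539787980725032517834897618728434181432602245736454, 18703517231106, 123745417522798309009844324896995284998,
  16505570853890, 120455290783830814464450067698694, 18145710505388282413586435,
  156420670815272528463960273227519767809489356909378534854633478, 16934422359731724778215427,
  138545286988566443849038973375806988744662022, 16498045223938, 147624523147920443958524486521788263032437181784070,
  17378325196773339673011428355, 158463632486027383578045510790536172187900064933809759238, 10163492567697135642354836839427,
  140197209323068870110558566978006554630, 15398534647810, 149172995985547392802922207888153966648761350, 19799802387458,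
  145512823173811008474553489991748556806, 10744760325, 127996815337824717830, 20563564469595358347925507,
  190463866878725462046049346061322169942247800273794365322226771700742, 18581207557507468085916867587,
  160761643079138495766420807645513599020964870, 15729040614071250289951748, 138215064993746840980486, 16936783540727962219321347,
  174425371218308620152537567425908857311964248940550, 10741614597, 139526030177734757382, 15724310186157137980294148,
  159756961786698664968727264867914758, 18135085190937120674420739, 174699608828219900021060660937506073131097094, 16503413933058,
  168836630398748709645459392133266937862, 18135085199933334475511811, 207954106892123779646894671458490480534171551903058696982243334,
  46051159432106178779139, 183148138506008626602337954743318892709420038, 19804104688642,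
  194412557031985216975287909484644860870619703549958, 44869407008584812730371,
  206904870679139177065837367455756274669065968128143401990, 18703509891074, 190951503982152021268100221582028116348378118,
  47156380340947697279179779, 224098811190658266898604155394625737354373273746479558513666054, 15726674832653493188166660,
  174639032030278155203207237638, 13202735766530, 190109470526663649585609147466455717894, 15724305571089034669720580,
  183891130562177065794007257321478, 14508304276696526663718915, 236561998227743538471846588208532973849513652378614311465003014,
  19805178430466, 198079646551128993712569102114225133574, 12677747580921104362283231878147,
  280395975546860682829047104799483552822833096498850950538361743783593804865483782, 49443333640999710608791572586499,
  224276277137344476017920891146543035173380742455302, 21768949648132340010981379, 227039429639548820624049373029171515876501890277382,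
  14302247394306, 199034772940640637602239184114694, 11820598277, 174844903688198, 17759489029051399001516079586307,
  271868621126590987060189579440895856067186595185278085654922902121478, 17759489029051399001506415909891,
  262487997493729780827195450856152631153896798845975426031953926, 15729040618579244736316420, 194874239416431344094214,
  8801464881154, 221992769708351261327759719034679990278, 18698145384450, 235566605558370311646100168931840791724170246,
  74999794763782, 105576739637254, 46051154918614169032707, 278015988808222887517426737369617755545415067845178813167183878,
  94724432070662, 46051154918613094242307, 245858095091904188387856050954385600432577542, 16506635158530, 205324737706430827526,
  17339639570545661645965761539, 367486067034788925904500413902237707482774769835954873185617224088598693318910800302112259078,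
  47156387258476724920261635, 279530780477046181568510479322321602145289052973977052166, 21768949651500139838183427,
  296233696135825572784606964092682507191381385351204379967891462, 7521437701, 214454669040388410374, 18145710505378386808936451,
  238434682110856652992449860342790, 16507713112066, 252567609944288043326588998751056041990, 13310002622005749153273859,
  287594617609458473659671695651854403513356695408484358, 18698143287298, 257884521452059940657068721550029494278,
  18135085190933822139537411, 248575886683647794850259102864390, 15721942088758883049800708, 239556292497898991858486278,
  17759489029051399001507489651715, 337583491127771053185824769465673997297682473016909063443087652563974, 18135085198814025197033475,
  256582882710173055476723805590534, 18135085199933323739142147, 259120660024465008643373655921670, 17759489029050258449518357912579,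
  373008530614525724132193593193454621594204966065918498044854344504553568743430, 12090450337252665557260291,
  304407672567114279334018252458560641142471212933126, 18581207557518727084985293827, 253985400500008974023659526,
  20563564450451752802588675, 282320758609305799955635681017652582406, 14508304276695438963251203,
  291509381814015319872912783279423738615814, 47156387258476735657679875, 301620847378395086681257959158906510935858182, 7517243397,
  251339149713674865670, 196908145444870, 17759489029051411371012228389891, 323498537964725272318540517192622120029243644583942,
  46051154918623831660547, 283192403012849109819453225309190, 9683221704380856207939587, 285800742681526278593857669043206,
  21765407887906872602138627, 302196872121445377443080602369051858950, 20563564469595351908620291, 290336557339569140485414978589702,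
  139265, 131073, 177255511766088093083534029886778679235590, 130049, 129025, 19805176339458, 8483739469321745041725443,
  446803497976497391366297322182459744538769261126658253354705507014576527620840156523897347997966342, 138241,
  40808526238370236662431978028094104095696153065088482284215038124038,
  40808526238370225866613492202846597479501054684210578136584632146950, 33756021476516861470086578631878472264325126,
  318886419293782027894861236013983135752181057151419092572166, 60050628361357337522550353018125003915223112710, 12888048645,
  49596378425374126643203, 19809477601282, 19805176336386,
  103878772767429842267755950584118473973464714527091960038605896056162358654223889631026182,
  40183454948652134477049390224065494278286400134834139431116646155836706528262, 10743711749, 7518290949, 6443501573,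
  12889097221, 4296016901,
  134784413264457584817937863766382265336635869904217285124571193699557421368605845308615721138291664892961004742142587834374, 5369758725,
  10742663173, 101377, 102401, 106497, 105473, 13199511392258,
  144723661745312921670926064061987084500740613789483908979867609605478756704049831326246265918307621598900485541737517477113818516486,
  371445440964910343856828504090892169418077610653523974, 375728883166692134940219318123903067004527971334,
  30704644618774866299707477368643085697815558, 15726674832656791717807108, 12891194373, 113665, 111617,
  503193888578576268793281239175345633301808427034607662443400669853169660952127215622, 112641, 6443500549,
  14528374320743421327710211, 114264798092933194468233721419213524743233521993599964595143429200327692092762915147363121023258989574,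
  41195603145215079578311632068336944156678, 110593, 8802538626050, 114689, 135169,
  310689184631720284278916962176464273424378169948935781979788932174488186778344925319667718, 11819549701,
  77877067151737105769652147298430077562816173341668753936089485744269865087206356703374445226196432793494794224095218740752615659734776679430,
  10542874561455407416823256747914501114659579477925954557556620476800968231952877505211174198334910190869779279189642246,
  6774888800853891453579994881021350796960134358900761242035554310, 144429748261488646, 5459919967532055223447324554431494,
  61168195743402627152599839651692285958, 10744759301, 10743710725, 3222275077, 100353,
  189114329379177077715928477517854193889098441957271221670791477792044702267084806, 19807330117634,
  386169605806368611892356852294427087173191203116386018799131641977376601931525670846361417812998,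
  264452077912000197582319481269532352870584686598, 16480707847616786775278510676995,
  526853830880456685393387940351794001532333406237071092953557519409326593030, 365552672244571713224622964198862399338262517132563462,
  51425548746562433483213101027972884147820564486, 18155155248489320955254787, 214558370233641998258447711634028068300047841849156573190,
  22712188331400121318186873875415015497930758, 16501269612546, 415190021820954940082334694623281874473990, 10742662149,
  11003712510978, 10745807877, 15730221205691968772899844, 12890145797,
  168082618126568573335445222693303262762303104133570117944230618307881084988532376466207749186628561091893366424072588591592909695826805621019897295316981766,
  149287354146715299856742074941571523585774266791140914526588340151800896214913892487929432758263212119522590633460570868868815654052326021126,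
  349057553119335929422788295059225983962177618975086974463906822, 199413119908774214415348754655406461958, 126977,
  439330812281948480229320948909310168579182598, 579281913191304015081920628006325884022347679292328824954946455788752925950688555438086,
  101468667048061044742, 383816844611606478651902029103461279000575075785123037843270541750268072966,
  80579417360152287784898354101920023934220251773892052999218182, 49933959946082425075932166048194939445741339285510, 134145,
  1076630399074474172120451995076449370522054001329792024078462457340956823885604166769022233685587540536944145065207889251950533650456015090194927100185124233285638,
  125953,
  1051315577452142134282192033281360822144510457845328361531836172992471658108477392848513170182204839927910818467282918093952493435607768882431397928635398,
  434293091277094697734244124282575987828662996998, 69352560591199657305942905749110596030521067934197617982973153286,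
  313245558810843594441720726974956142045973132554013702, 332908045411547740255962223765877680878826885102844252166,
  381801305356483469907407931542866950, 514505554396271473996822464202092586874658165740605392513195384253712390, 92557218915896264710,
  8483739472699444763301891, 357850013692134368251445387856244552196618612163737098914822,
  410974804123810071178759574439037311476076843634694,
  534488247357255957974982969743863985228402905346304665280569972095851511803587661401094, 411563663447537559450595440449966487971564550,
  77831239138903750232685240883448914540280527324049308636662424669190, 394819917191203448565284995664303884294, 243589945019497187334,
  324633320658831366, 42582064820553628124949482620345912326, 306049624297451284738017855494, 177418864093968049637382,
  19801955113986, 3583137423004483608621799881835035148700472128316641286, 410038085731771780959238,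
  241901874006169114420185586882775152926473415139095263316998, 134566931335639506726568979361090039604281129046022,
  403915848691111430150, 316763978498836486, 242415955587892997261318, 276049872676622955053058054, 77169701078306530928240887814,
  19951418435950133755000297130088734723, 485015788640396388319712456702711997401094, 127218075318231238662, 267207251476801075021830,
  119735002017563654]

theorem model_lg (cx : Ctx G K A C) {v1 s1 y k1 c1 c2 k2 y2 s2 v2 t2 t1 a a2 x1 z x2 g : V} {Bs1 Bc1 By2 Bt2 : List V}
    (hc : Cyc G.Adj [[v1], Bs1, [k1], Bc1, [k2], By2, [v2], Bt2].flatten) (hC : [[v1], Bs1, [k1], Bc1, [k2], By2, [v2], Bt2].flatten.Perm C)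
    (es1 : Ends s1 y Bs1) (ec1 : Ends c1 c2 Bc1) (ey2 : Ends y2 s2 By2) (et2 : Ends t2 t1 Bt2)
    (h0 : AllP A [v1, v2])
    (h1 : AllNot A [s1, y, k1, c1, c2, k2, y2, s2, t2, t1, a, a2])
    (h2 : List.IsChain (EE G) [v1, x1, z, x2, v2])
    (h3 : AllNot K [x1, z, x2])
    (h4 : AllNot K [s1, t1, y, a, s2, y2, a2, t2])
    (h5 : NAdj G [x1, z, x2] [s1, y, k1, c1, c2, k2, y2, s2, t2, t1, a, a2])
    (h6 : NAdj G [s1, t1, y, a] [s2, y2, a2, t2, v2])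
    (h7 : NAdj G [v1] [s2, y2, a2, t2])
    (h8 : List.IsChain (EE G) [s1, t1])
    (h9 : List.IsChain (EE G) [v1, a, y])
    (h10 : List.IsChain (EE G) [v2, a2, y2])
    (h11 : AllP K [k1, k2])
    (h12 : List.IsChain (EE G) [s2, t2])
    (h13 : AdjImp G K [c1, c2] [s1, t1, y, a, s2, y2, a2, t2])
    (h14 : List.IsChain (EE G) [v1, v2])
    (h15 : NAdj G [k1] [k2])
    (h16 : List.IsChain (EE G) [k1, g, k2])
    (h17 : NAdj G [k1] [v2])
    (h18 : NAdj G [k2] [v1])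
    (h19 : AllNot K [g])
    (h20 : NBoth G [g] [s1, t1, y, a] [s2, t2, y2, a2]) : False :=
  runM_sound cx (fun i => [v1, s1, y, k1, c1, c2, k2, y2, s2, v2, t2, t1, a, a2, x1, z, x2, g].getD i v1) (bl := [(0, 0), (1, 2), (3, 3), (4, 5), (6, 6), (7, 8), (9, 9), (10, 11)])
    (gs := [.a [0, 9], .n [1, 2, 3, 4, 5, 6, 7, 8, 10, 11, 12, 13], .e [0, 14, 15, 16, 9], .l [14, 15, 16], .l [1, 11, 2, 12, 8, 7, 13, 10], .x [14, 15, 16] [1, 2, 3, 4, 5, 6, 7, 8, 10, 11, 12, 13], .x [1, 11, 2, 12] [8, 7, 13, 10, 9], .x [0] [8, 7, 13, 10], .e [1, 11], .e [0, 12, 2], .e [9, 13, 7], .k [3, 6], .e [8, 10], .cc [4, 5] [1, 11, 2, 12, 8, 7, 13, 10], .e [0, 9], .x [3] [6], .e [3, 17, 6], .x [3] [9], .x [6] [0], .l [17], .xx [17] [1, 11, 2, 12] [8, 10, 7, 13]])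
    (rows := rows_lg) (by decide +kernel)
    hc hC (.cons (Ends.single _) (.cons es1 (.cons (Ends.single _) (.cons ec1 (.cons (Ends.single _) (.cons ey2 (.cons (Ends.single _) (.cons et2 (.nil))))))))) ⟨h0, h1, h2, h3, h4, h5, h6, h7, h8, h9, h10, h11, h12, h13, h14, h15, h16, h17, h18, h19, h20, trivial⟩

def rows_gM : List ℕ := [
  21561205313459476356806426493956, 1498628496153722156825266995152081620675391922182, 22006353376258,
  4423053719625833142704993887197261126503235592198, 14305464428546, 7699905329744805356207185205366768123164729413991408646,
  16498046275586, 10740951145814770144148522922440345182190517367029638150, 21556259586122057942676284638212,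
  11441057818848459029502011380742, 19807328011266, 15379413848278093665978530335520302321114118, 24193887142925616734541827,
  23036309514730109853668368117171396907657725490790357429494114342419836934, 51998329178794940630375078915,
  32056512227709912720658488403967648566035829065658340381354081308240913737022923432537135602745350, 21761866111915525146679299,
  29125434521866220595910494013069878671253026258484702304809255971846, 21558731832336160241317551539204,
  24117563821130897159571219944454, 20772995357044161056434322907602947,
  63918203897063589077694203345971859007710477195640426588229064023679061038018828748380616664340098648068064249922500672642187576678586276870,
  19346373336580504560867331, 41467421335297724154184289195375698827625538448253656477942246730592432134, 19805170041858,
  38364781929538029575958592767318593948791063600845300742, 21060716786257410312054512643,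
  55956825703395237848217327310475294792388717323687665752781343743750188455992174641836735494, 22818951183264702255647146646531,
  62552718365934224776999158092652462400458779420016497017524660750713993533129338019386728379334662, 22284150905533673377600904195,
  57619234966599414809594955019529543113488843302543441996601355252130718325683206, 19344012155584272485324803,
  53783780443228868035017665583420366922534528595893170069317638, 15717231246979756816603139,
  62105368228664653338505925555693546382563432794140050588407575428838993926, 19346373336570598218799107,
  65537261925416461693849831977345100339869617243163350023242361515327631366, 51998329171877411602733997059,
  76308569278173482586475197625347779079524614777150147424850047547499739927982449375238, 21776033197863237256747011,
  69879645707867481129796283727996344644198384236658697423323604724742, 21566166730844534881090035254276,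
  62881697264051229338985653815038666446442098335750, 18135085197681528220424195,
  80225903377350315933430947725005496855463743404328785531360474511273111558, 21761866111926523498862595,
  79252441573039198781506261671786855229730411855299976120694857542662, 21574823846281080890192269673476,
  65165938707585134461042447618805864454, 21761866111918826917468163, 82711803793751541687974390930408046510534431676472816890292230,
  24193887142935504819853315, 81951100339880978525829052940971157761181197188732036102, 21761866111926520262957059,
  97236984378826555358126095386743594276668152608980057508638022068771762182, 16108225541, 62772026017798, 14302243200002,
  90454664527939753111837979060326214860309451289540961286, 14300095716354, 93519655603962454306489994608245663037548031570967798790,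
  14643591695991900623637657547150729219,
  179674547354224541079800953881410293476647287849812752431777744112056883534663094589847556498146294216475191341302771399079934152431622,
  18697069531138, 90641706616210617007161387675036333995203590, 19808391267330, 93432022053520185290929223339979978669300742,
  14302244248578, 96206003887890475830701188000310848266443782, 19344012156710164875974659,
  114542986399071316378531948128158892549870127266147018986235910, 22007427118082, 101789356979905983590722582602322538936671238,
  19347553928201221973219331, 115657022764307460410525838774445242083511708953376465926, 10738468869, 88777217570551892998,
  19351095703063367763630083, 127398490848924301230402471179903812982459333280522939833264134, 53141612055338715977731,
  124171063392867210397689135172137627573723768829978354694, 13952827031494921668190052293635,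
  147478245222000783929273430561005844950874659514477494900319829239190794246, 8463669403880569226401795,
  150898058741588302197626159087312035851644736914404224995324746068755755014, 49596391922992827865091,
  133756632907118950640624395015773203737360091139678413830, 50786703036795965610662915,
  165407194032154022343109410254024242793785381960532373805127766428564013639021574, 19806243783682,
  126883139846123664688372944516311543752694790, 19807318574082, 117934844795370463046311418532870, 21761866118677524880824323,
  132810849715973229422223390616281137363819526, 21561206505848941707168390841348, 128968882272529665264645710395013601286,
  22833824597609578099035377507331, 183942974793128381293274422704786621936680544576044757068535006305308315147580422,
  21558731832347692834057960293380, 131179051615234429464212906238284806, 21569891427752998309926271976452,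
  133775200044501843062306478243189766, 21563688432914324891281891787780, 136371348473769256732456538331943942, 14305465474050,
  149170273913525995866871277137657564429818886, 22005277537282, 144920910981690267358029880443950602246, 21761866111926520277637123,
  170159390328664592707513586010341330551492596742942106630, 12099999764482, 150214457943393451510156471038341289990,
  22818964481434876203119802326019, 184852804761465726840364442190535516821976378909941440902604806, 22008487228418,
  163119128501050239017566405931368664729132038, 21761866111915538031581187,
  191983590803362880425259290330526975053862624928387864017774598, 18707812195330, 168694314818856480975122514605108871933467654,
  13302919083534934386677763, 171831709116396600648715950047990088773671942, 5500780417026,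
  174236833993091261811216032000171060654775302, 19939734511509308215521349395693969411,
  313753871109666098772821084741548870931532976256610911841334931176198831672703089690077156029752735096259464519502854,
  13302919079018156725901315, 198121445714830222137129353491354364022453553161265226758, 22083742365080760667231675635212291,
  308762256291460175433677044342770759176379800724921294188566292746790953744891776762148061674327138064426616838,
  21776033197853349169338371, 194429676013097277828891925999177446955882464157702, 23366623342823606261409030685597699,
  250639217959163117611326568090935392093589490288565446217981396120908987150382086, 24193887142921211168692227,
  191159747470534852526873530846652722511354886, 22005273342978, 176222013747936404974646045185030, 13962840069,
  162591215675755203590, 16501267504130, 199333339736117843238975107769594877794327558, 21556253553302334835708979577860,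
  188294317059117533233933173488882694, 13668128322685128734553414659,
  248486001360779444201828327700250317409192079473259689962659592023046, 13956544478390236652892613254147,
  263524207961254597762323430873296999913288862255259558970680688230192394246, 19344012155587564577757187,
  243098030035571601069423741828467520363742731007512271307941894, 19344012155580963213023235,
  213641523315332886997299906597208077666098182, 21761866111919923193190403, 206409379743281639722860236089433528326,
  21761866111918826902788099, 219223514840431108208493264885605043125885958, 13219910387718, 18145710505389392659486723,
  213046433201465701429918161884440172550, 24179720056998787840743427, 215959311904987860830861113457965537286,
  22298657994601821851758894083, 239736226770355100841221473192880620121010948022278, 18631273159190538451788386006796869635,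
  372571918828727825063770622637249430954478251118293367251157491921402789994456862558568663899941633016838, 22008498762754,
  184959547475974, 21776033197847844093958147, 226347799680055226701856322468480817158, 74868797212678, 101185135577094,
  24110135943609715735133832616963, 220682621504782296840281344971782, 19344012155584266042873859,
  270148736135526998480232576992807643935104766580767073286, 14300096764930, 248129830547687971133579227668767461189098502,
  18708885937154, 239280522358810698107454273389549590534, 22008500859906, 200490149218310, 4705138771974, 81673100199942,
  121181430614022, 15044969477, 210748026898089990, 19346373336580501333350403, 251464454512672272658123698549245875206,
  24107645556423628956137353649155, 260222015845621034734576325656315937429510, 19346373336580493817157635,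
  275717221929198796099669752364195093062540598278, 21776033197850044189906947, 247553348060083496212650416673798,
  21561210132620643827028021216260, 249959971120755212977712831401990, 19808404898818, 219248418883590, 15717231253735156257658883,
  255077546387501662064155439404038, 18135085197680428708796419, 304097832980562222976580451908904191408005012614290438,
  21561216186709463959269760041988, 260101175922581048189682162077702, 21761866119803424787666947, 262532423981661553594140407632902,
  12104294737922, 264960031333495069421663096411142, 21776033197853341658388483, 280512543872562254632865580272256555014,
  22818968108226184741754940431363, 283504603825621952012340126257941321734, 21559974618708664863867586741252,
  260141069628796692966935558, 19794432623618, 250261654699213065222, 16500516097167696817987596065795,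
  320195886964415191661351922175023020022128563986438, 19344012156710165949716483, 315679802071510325906661284085264437145003629574,
  122776846274509048325918356477830536020105222, 318351677681218564125553479203954133917511981062,
  101213677456080223176676633311480648710, 16109274117, 337057586363595631410386964992378641985659049421574150, 5369758725,
  4296016901, 13963888645, 114689, 198083055663497598499207170432135301981735343011412304727046,
  267707189734539791176629152625824220547389446, 13970179077, 19354637477925526441039875, 5369759749, 118785, 13965985797,
  8590985221, 143361, 140289, 22984960170386173676492803,
  292589883348918606578270052992499116888752511152603059975604067938815854893236069112446101730997558320000110698173569030,
  40822426801799730457091967553542, 6443501573, 133121, 22003123762178, 134145, 135169, 6443500549,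
  534142319497150917739441265935238618863658016558934074649596631891177297167414856081325065166404982790, 113665, 138241,
  108198496369105810251306063647034490392937748900163232067222309090077771895638916791257779510377364606025733126,
  370092108082337382787247430843708378242985650321411211067464249146692496733220263550446703957009177252870, 13968082949, 125953,
  122881, 49596389688781975853059, 28043554564449053048058124370796046716855259378793258845688710261902342,
  394066002499087229926415213467659824809083933391502300943366, 214922589058243149143321374326378160085538822, 117761,
  99214212796224448372143949517137198251359320318152886674090538994655122462829231199552061435719653944674689871341655086483939866511937542,
  19346373336580497041528835,
  808267443876265091103745569281580394070551225628143830198895560486478207578405347467885239470263758419911359406759517612725166878188883758026758,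
  139265,
  419403345269817592709429534084996947025976988500959852760771192888185033158679327469185469030014702091714144891929894446553997026247314438,
  125796725240397114332421386424405236121555562870353168390, 29569478666749958, 144385, 186183128469080919118750240923280478214,
  7517242373, 13964936197, 11818501125, 8596228101, 131073,
  373945354856993533439590683842895306334175030444667374270028235979127712941285741482275452754950,
  249866986991454274799079398311624857932010502, 7518290949, 129025, 86798229259512904267703625043552963679752198, 13965984773,
  137217, 265710913824043346448901092444922287708009650369858537566723488282569879714977028102, 277487662160239130576902,
  211695318163253827291122240518, 21566154653399176958094117706755, 452190478455766590825910169396580897167351200701242657480710,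
  452260943346861420285790043994234449181930797520825193865222, 13969130501, 22818968108226181364055219903491,
  365736696193445409805705747228461921194995691967585001979372483357702130633625919404987355527252025350,
  48425035598378769246337986381300530006675568059848054354745350,
  320942870315239447053919227646013569059367073110158079251904194919956077316703985343494,
  278373581815487056797625112187286905219343228407282280213073167915014, 22818952392190529755976938036227,
  302390958836005484576533984094069210075779840613553158, 209425119228265962566353750593542, 14305465477122,
  423818696591722628884952373274272728954666587457535172022672677530099379577667301938182,
  153579195790881119778264165128869975011159692308179329030, 32966058094436874103874706669112675599775322731452422,
  25571256956014619447128429146874637779033044213617650571270, 204696242193688329571929033797430644705015955983366,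
  178195208631824673473813369598811658213536308279888949027937457158, 12097533879105553397979139,
  480819952267654171596343210309881848844039894761496089801527302, 283025975332872830174146887175638022,
  391980441860333481117098249818118, 384033428753427646229760708614, 385134970630296625565513288710,
  45471600815193374639662104578651852806, 12892242949, 504869954671045974360752854884718972126093587225795147704470677830453578173446,
  286368954081515842607914435665320483760756978090464610951391152429932033870854,
  33424202140896661201225948405339799195596621589982976752292049325312069340341492112034370685958, 357253325614221318,
  258180730886031366, 18694919950338, 25749068585252533031064700414213533275558078314396871761595398,
  162087783543490471370335621959441426296082438, 466360620727517370259633426391133005958913324481179811187788806,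
  463076218975336121933890333250225800326201580351481552869266438, 217632622242760750036587574654369278760314438573042362847106961414,
  401453216676310027064998628358, 609600985726921022830821487617736806870565883795429503247968381596335791466368484664499243014,
  318989653104396294, 343759095642195974, 21562306510243425683462, 148948342178192272662943762438, 15717231242476171147876355,
  421089418723920367177896207321094, 186393369961880007360907270, 7519339525, 377543857078798342, 313963185775599159302,
  2703545734557538106421020678, 318587259988315473926, 329762443934738450221062, 277344480893339654, 278470376861729798]

theorem model_gM (cx : Ctx G K A C) {v1 s1 y k1 c1 gm g gp c2 k2 y2 s2 v2 t2 t1 a a2 x1 z x2 : V} {Bs1 Bc1 Bgp By2 Bt2 : List V}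
    (hc : Cyc G.Adj [[v1], Bs1, [k1], Bc1, [g], Bgp, [k2], By2, [v2], Bt2].flatten) (hC : [[v1], Bs1, [k1], Bc1, [g], Bgp, [k2], By2, [v2], Bt2].flatten.Perm C)
    (es1 : Ends s1 y Bs1) (ec1 : Ends c1 gm Bc1) (egp : Ends gp c2 Bgp) (ey2 : Ends y2 s2 By2) (et2 : Ends t2 t1 Bt2)
    (h0 : AllP A [v1, v2])
    (h1 : AllNot A [s1, y, k1, c1, gm, g, gp, c2, k2, y2, s2, t2, t1, a, a2])
    (h2 : List.IsChain (EE G) [v1, x1, z, x2, v2])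
    (h3 : AllNot K [x1, z, x2])
    (h4 : AllNot K [s1, t1, y, a, s2, y2, a2, t2])
    (h5 : NAdj G [x1, z, x2] [s1, y, k1, c1, gm, g, gp, c2, k2, y2, s2, t2, t1, a, a2])
    (h6 : NAdj G [s1, t1, y, a] [s2, y2, a2, t2, v2])
    (h7 : NAdj G [v1] [s2, y2, a2, t2])
    (h8 : List.IsChain (EE G) [s1, t1])
    (h9 : List.IsChain (EE G) [v1, a, y])
    (h10 : List.IsChain (EE G) [v2, a2, y2])
    (h11 : AllP K [k1, k2])
    (h12 : List.IsChain (EE G) [s2, t2])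
    (h13 : AdjImp G K [c1, c2, gm, gp] [s1, t1, y, a, s2, y2, a2, t2])
    (h14 : List.IsChain (EE G) [v1, v2])
    (h15 : NAdj G [k1] [k2])
    (h16 : List.IsChain (EE G) [k1, g, k2])
    (h17 : NAdj G [k1] [v2])
    (h18 : NAdj G [k2] [v1])
    (h19 : AllP K [g]) : False :=
  runM_sound cx (fun i => [v1, s1, y, k1, c1, gm, g, gp, c2, k2, y2, s2, v2, t2, t1, a, a2, x1, z, x2].getD i v1) (bl := [(0, 0), (1, 2), (3, 3), (4, 5), (6, 6), (7, 8), (9, 9), (10, 11), (12, 12), (13, 14)])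
    (gs := [.a [0, 12], .n [1, 2, 3, 4, 5, 6, 7, 8, 9, 10, 11, 13, 14, 15, 16], .e [0, 17, 18, 19, 12], .l [17, 18, 19], .l [1, 14, 2, 15, 11, 10, 16, 13], .x [17, 18, 19] [1, 2, 3, 4, 5, 6, 7, 8, 9, 10, 11, 13, 14, 15, 16], .x [1, 14, 2, 15] [11, 10, 16, 13, 12], .x [0] [11, 10, 16, 13], .e [1, 14], .e [0, 15, 2], .e [12, 16, 10], .k [3, 9], .e [11, 13], .cc [4, 8, 5, 7] [1, 14, 2, 15, 11, 10, 16, 13], .e [0, 12], .x [3] [9], .e [3, 6, 9], .x [3] [12], .x [9] [0], .k [6]])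
    (rows := rows_gM) (by decide +kernel)
    hc hC (.cons (Ends.single _) (.cons es1 (.cons (Ends.single _) (.cons ec1 (.cons (Ends.single _) (.cons egp (.cons (Ends.single _) (.cons ey2 (.cons (Ends.single _) (.cons et2 (.nil))))))))))) ⟨h0, h1, h2, h3, h4, h5, h6, h7, h8, h9, h10, h11, h12, h13, h14, h15, h16, h17, h18, h19, trivial⟩

def rows_gQ : List ℕ := [
  21761866108538924937779203, 1939394888222524365061178759564515938959081556368794513571389489070223366, 21772491423001081798465539,
  5219544427661237990015241233212782156456085273006326904994191649798, 26585878276060565276427018847360393219,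
  15727647260828430190282008653310524858919616435893281101273916925285779651338908630134326110605537321386779280533000552833514834748841191256645638,
  19796580107266, 10779862171115675046230891211257913806656626447503860742, 10149886107600831755510560594947,
  22240060773100248974398253567972914978519729650778282852677543206142515802807909890919884288227038058981115910, 19808404898818,
  16126484266261335315856504295274066208859318394886, 20772995357044157597666507337244675,
  40101152576572472793891755178224646967278510843458308579290020713711723348653548676889420537615269689065543739065076645624153798116132281350,
  9679679940785386739996675, 25436213417340282030622893545684533211290658079808353212602514418694, 21057090005336419812942814211,
  37315113727610625618021080308895523699788117728841432790059176345611465696678908342066863722741766, 22005277537282,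
  29175794997903334416518150203780148924056497931920876550, 8477836507848164508702723,
  35546193417521771954079743910072559682550504920407266314054230092806, 19018488557286990663419656412163,
  49332126719559046617046065034859707079908463744262757744320434603865778436985104548469053057941510, 16505562480642,
  38346822968873723728126229444049442657978597085696500742, 13629442686074413859080248323,
  55316272987883937811488497761363339247413315614348432351268695908822927516550477081153125382, 46051154918627052886019,
  48887954873023567952372361379899680435216499229663370699090166819846, 13310002633259242073626627,
  55272639254840755749960192012675134827186217569103459227702093625491992582, 46051162809805899307011,
  55627941539811232390776426773905342535379227078662299011415484148742, 9950677877511337017683745795,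
  82231119552928131427006374905831259391307173242938370671768578253109162623279847696429708513314355965642950662, 15406048752642,
  56742755795660791016140025585024153432245350847417951238, 12103224138754, 54378495340776418091483474341191822930353158,
  22002052114434, 57198755603009079078163274978468601112042502, 17763210102719554379907227196419,
  97081128283874979625502905295995513156045749779172003516575678369013940100654176316429414230231033594886, 20905764860930,
  65820394425452848103057792022358834258913410424838, 19807318574082, 62480218100519096281370680505781983238,
  11421236022017676923983571721219,
  110381799419799119977463924362803553906362731291544085345913266914855767712682550285312702533032683258886, 9676138165923234507134979,
  90278297252322839435707261482735765364778279568803989597349253462900092934, 15724314802330269806237699,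
  85619670877843336661807009076422698603135307305605139438512134, 22008495613954,
  84336654988743117092594706726504365130521304456629330950, 9950677885591904156418841603,
  121780482523527901332860580211018398122456837174651619435610996333838353775144894087124081208999942, 15406057141250,
  90457657694710367678095143122392617128985409772742255622, 19809477604354, 89198711631976468358717125406290472726199984463878,
  48284505508784266412261645315, 122414716982425922923450625720609502284657248297268673802467404510417655787940465358854, 13203804271618,
  99646644620635685515250117375796543599054815433528976390, 19358179252784370472196099,
  103108218667478329796396126383983152023670584220654248966, 10741614597, 79574111938178714630, 21772491422997783273019395,
  114549263791142786596949084396805353046967160727864396217329670, 16098071569761182064745389059,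
  142359311498056069607569132032840059469347149421254877622016271957878882773707355338758, 19351095703060075669100547,
  121275178014763271663956025328693593519907670898060695809566726, 20560022685719411928602627,
  130536234395402242322546385832098536502454928641868753741156845628422, 10738467845, 86881824933894, 21761866108548830207154179,
  130618644235229267028995549480094011011916826825347232741468166, 21761866119800132695234563,
  146827757322039969052840662834615834475884743399341432260827413387217481734, 21559972206756508080784751467523,
  166039382902665035572220679167921704627562729733759251512915867965715934896754332284934, 19808391267330,
  115683087346521540518447034707674667014, 21562440833277862062651204443139,
  165758189026961612183291265028820657916381661927370197957806677149904420729795590, 21057090005336430808059091971,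
  154126188028890948846628902056458821900974256999707934146307394907142, 18142168730523941887547395,
  123745418013021339112690684102834132998, 16098071581290397110813858819,
  185466072172298925276556657905986425188172163411853691415383572566799548557556754429958, 19806254281730,
  141804207084288219783952899901004758649814906839046, 16493086032001407285296156902404, 125499901202888252699963215057926,
  21772491422986788147304451, 154931711007483400198840472723478889325068310458653484038, 21772491422997794002049027,
  174033502164931893621773266356788277134978215867941315792473917762566, 9686763490509691209914371,
  177085913420062641352196671637663844732207491689539277864704526003206, 16499285401246673374490189104132,
  142230008211542900811255939641474291718, 22818960854657430876626082601987,
  193416268907884284194504297757603422123223823956514982284837962725314277382, 21761866111912225552734211,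
  178828354833943270194798154536642479900077215911355771377428486, 16504221445368159905406233084932,
  150205376265480327168138380510166521862, 12090450336126754912999427,
  193935879685296886558750296406325180132574032171726201667970053188614, 16500512465680568282068850574340,
  170998564481913102248437564742865108088029178765318, 16499278152412964749978108953604, 150852913051614886406929169519622,
  15227905273134839908335413632003, 235607418556475253838420426721706490419128612730338735615652800495854394019662487631878,
  48284505512243030926082186243, 188639129921096893365729866984588704515030752598237914118, 15724314785451674324441091,
  191994456619657722664741378617732026797356673888311845894, 16500526966890898676954770179076, 168928789777147064724794692293008300038,
  21559972206756508080784758807555, 207748531804303371030239643186049475092860063789293083219208198, 15402827524098,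
  182624113772958497352589699125138071370079238, 11003712510978, 194406848035769594890327415406248005744190972502022,
  3645670388055584919263235, 179723568841752574125025810297826318342, 19344012156716758721370115,
  200635347310877179878508958509880454833769622282246, 16493094490940375344053640758276, 168595573214402715489144838,
  12090450325993655751415811, 206739684464840192509359289235165615715747942637574, 19850580848702341731226491907,
  209134607835446783122836270117873561312579799752710, 19804096300034, 202131821306398373137261590315043485691943942, 11820598277,
  161650764154886, 22818968108222725983838189657091, 276574836931587006212101105568591393845002321695423564310661306492200972591313926,
  22002050017282, 182560796029863771184828422, 24190345368073349361571843, 204004048612277582713204631485948106758, 15404982354946,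
  226571302038591552000061442376611139933481204719622, 47046564287754343915344370691,
  252308118667409275007096524108845211987802707021787279557404678, 19801948816386, 211371926152459883608207873263105218566,
  16940325316719294644492291, 271751789989165795346328638561423715724057177724082201554387611954182, 19808398607362,
  197091509283803319927574534, 20563564458336358195271683, 230369804061678041463326050590811460893416454,
  16490613789327928032310647063556, 216966506266889461222248368185545734, 20561203277340116465489923,
  272026053291809788324739298530813948735200489850628047077648390, 13962839045, 188249495570438, 17600782277634,
  229975925806494065562208271220752783366, 8802538626050, 243934829528286140399946435570047147817573382, 20556480910857259694692355,
  224495477048913251035744375411718, 16488129431434768471577571886084, 232543406746009536024399186720986118, 7520389125,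
  199231726946310, 16493094506292676969085428302852, 232561898188907642218025688503302, 22077411539718664274723583361556483,
  343267461824316155593854845581954435698109273160272660815388923613956442269168646, 22005276488706,
  260676722432517626172701614635293170001255430, 16488134277759921768019602179076, 245524059760581135134895396688499718,
  19030865532751567396752596141060, 230933180839111066853052422, 19030865532751567412146817991684, 228052512333313831078918,
  5500780417026, 285005677059747208562157086620060764040665735634950, 25354254786219352501150340363268, 238191458474562826078785542,
  18708892234754, 277402281323627216327760406292367947753069574, 17763210102733389437962509360131,
  323548504715994672210310277667223436670949802238515531956103174, 21772491423001080723675139,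
  283076820850284214916440482481446635088911366, 21761866108548820542429187, 272621549213993133608999278528592615430,
  16494332446327351793658091275268, 275342528726509082993074972265567753222, 22002044774402, 240961730300219493382,
  16488129431434775225869985121284, 287395329009088915591310003181026303547398, 16485657185209143715488703972356,
  251636886291937886211078, 21772491422997784346761219, 329922048725545297884933114781690956804191073201315390470,
  48284505519160559953723268099, 302587250643957378918878292124611465150733318, 13965985797, 241232212133894, 16108225541,
  243091932973062, 25354269311040361272866977618947, 326335906191349470751355554308692989386500758052870, 19808403862530,
  299111358903728129732156489832809371654, 19794432623618, 287762886913798892857297283847174, 24190345368060161663440899,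
  304776145963492910910993888397138860038, 21574823846289150210416904766468, 300043030788653571103521353032011782,
  16493086032001407285295083160580, 288708670422695533797054615558, 22008497711106, 258558107060230, 61608086734854,
  13639744489478, 19808397558786, 262800459958278, 96859029768198, 180339235358726, 25354254786219343490660072174596,
  13969131525, 13969130501, 25354254786219343490656849904644, 68609, 20567106235443716396423171,
  224849456773472497672399669620975634944274514967531526, 25357969818805950408570017154052, 13959693317,
  22818960854657430876625008860163, 151791487008556937868164367766563587281934348680103243892454854662,
  108066911298119958308035827985312185122325613115356016351437271342086, 13959694341, 74753, 20283659651843244212424541215747,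
  322825632581340159044102118037685510554278485740691055838589466504607509328197947493524834062586189191174, 8799315300354,
  24179720053610102655031299, 62852845458933907969837195502930915450302984659706413217872182423860143211214003811642382917464056926214,
  11818501125, 13964937221, 120833, 119809, 122881,
  224478223550560538329149029373720520583738374589522442937322209656125185330182,
  286545266684339982247696377599208663454784968844026942046979123845126, 158165047219929322945638963484023613033478,
  20286128278363435153970131115011, 12168722303173118304123384898714656792121051285133608985759319284548489190108109475846,
  202672178062758301199507176572206618994510139398, 12677763296949840704116991466499,
  171248651882753073312541616991290541651937431234103514174203509921249331119515505670, 21772491422987894100334595,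
  46051154918613094242307, 433541826029993209592851714135683858004406594655306352955398, 15720773018470804253317123,
  19344012155590859888269315, 470571961011244719325916925057200497804026458845506854808318317169670,
  214201826699196522862558530436636180032280070150, 69633, 317813118751213574, 72705, 320064920712382470, 75777,
  322316722673551366, 406695992432444487419580035029200831680120931490822, 73729, 12894340101, 22003126904834, 15406058189826,
  15044969477, 16500508837719054544969598501892, 519959003269530895111314439451095263448478429520161520500377018571211937798,
  11819549701, 15033435141, 12887000069, 10745807877, 16494332446344641108216640439300, 7517243397, 3222275077,
  16493094492124426863984076915716, 16109274117, 15041823749, 15039727621, 12889098245, 67585,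
  16493094509828684975219789530116,
  794168941648887358575548518785817075662101465096860366169077355176752204205263012189116789047851846966287052709738017739227796486,
  24604093583478420297214319117671961990150, 477070151891246347329774077274509298071197847022098976774,
  22914560759315777549366534868998, 111617, 109569, 11149973720065021257532694413519837205510, 4296016901,
  21568653484170781767192077677572, 21568645033501727544473579160580, 15043920901, 15037630469,
  374611278170171452252057661858800484334942822554394968911364429066531083536105226349061126, 12097850183682,
  16493094495667363658121528476676, 12890146821, 16499278152412964734583887102980, 15042873349,
  808860930210478865666995364054546888009962210333817515847252142587659910609050351803966587422208939924168508341185459395314830413123303235789750979794950,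
  9676138158032055660713987, 49423501715993619874833130376759869595900218733919910599133762566, 21556259586122057942676284638212,
  873261896477188995387589214186875986836623083995007506815183002627055290847753327245317613807639809779386489107631625364393395687124248825862,
  184329653136416791328183031503524870,
  937658059315244742619724651923165668413839973809179840473218050323769450509662091662805793459158878234322897349047725333680761198674503898246239226886,
  82827826358845791152450425803671067298706233350, 158165135382279087110346106417463589604358, 19822775554851205260208249859,
  19344012155580969652328451, 265610446042412159945414754541731600473516823580236210798939654965987119110, 124929,
  207070141358686180386050329406330660459526, 21568645033501725279496804762628, 15038679045,
  169587054460207733892793613648031610489918248621761189632320649551681542, 10744759301, 16490613789339474136939787977732,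
  16490613789325625582395375748100, 6443501573, 12885951493, 16500526966879366084214361424900,
  212123353448369228274660423570728154818355863192932006802902798323551105657956503705147299093768409547817186819155101223942,
  469597758468683845287701665471805599083933270546438, 20558842094098694517299203,
  138750868789797709525943106235879565960575622801531046544286726, 3733166477371167468262792195, 3645670388057783942518787,
  508595184641734929205932523315915400636053593094,
  128414096412962220126354697667836311558672470518653163655344350047279578556033118773254, 7521437701,
  500632005438708388666901751132642642941187078, 6443500549, 10743710725, 12891195397,
  260059124842989832836799563428099248223260646201731323805895812223035011461138559875643877524087400630939314086632210769645574,
  49596378428672661526531, 508776685180840216634502605155887719757385734, 16500520930519019928294913999876,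
  16500520930519019911801180521476, 13963888645, 16498040212373679354308987978756, 12895389701,
  792531209757230679272739482033773809401924658754496995939782257818040771423634737802956918924251142, 15033436165,
  16490607731707726217745901028356, 15040775173, 16493094506305355727941741315076, 15042872325, 16500520930519019911801181570052,
  15034483717, 18706732168194, 10885065130568189442267139, 19808268447314907433946586115, 12090450336136651591391235,
  8889648639313269200176898120707, 13968081925, 16499289026840080703939463349252,
  1276507558739474388270084850575574454431232044485975543193968873328130592952726423903459134288175846023243184197279947812573597276038494067680029707549618394044608182822954936926854813061126,
  21761866118674232788391939, 21761866118685224692881411, 596267044995722479389339474078479154237884194022729195526,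
  16500526979872792564826880607236, 16118711301, 12888048645, 12895388677, 20908989232130, 22008500859906,
  19344012156711271900649475,
  1657001546785011123302049273602015783092395996241175363748744323015305117842569899286642006668691347771023197737489210370748164793764492727886650435757139587529804318601354084726594674940248264209579694186435687277770312710,
  140786767641001162971673324353163403894371647490054, 23870232269474312883817313351638034897911731545366081406229929793542,
  410099011146348920401695949800743151602694, 462407356069733992454, 31208389869320260165979656853134432535580678,
  473373304192195652295320408070, 510864042848932977599069959504063116956176358749246470,
  555931929538523190431459953820878342900826978783921150691054635485799513329989852166, 13310002633252654667536387, 13970179077,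
  1307497271482268514132818636752733027576545147987529069172767067389761785859309712985172508583728118367812932936078252917453236690499962854208465035418670086,
  128572609054458589833929222859789311468901382, 210628469019371151069699509463500651576340738171662610867783955193538566,
  1623362370986892261848186811906867683358988860177536595701216310441186678567143110732563988904322261670622542992868873969999146382283248669070187301105740102798830563018597733382,
  19028387232457866068501575250948, 33381377695445366852165332320230244077241514208915125237880724486,
  596825051157838805095763325858059946152185630050349071051455871326214, 10742663173,
  555850801611387386800226583520777852433402723957301609339124044777550186024966,
  44371339114361895510262394180411957554556569613393555656875591633459793184812475204823398597185769478,
  119117504091003353881732443905998505210126433000334738261544966,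
  44371462159290307002430332208765391710313310212410060977167903707187298808744907733093075906865400838,
  47148248999253137059195714792329222,
  282680907584189044985660005719077886991142851341244003684746916126826472699745074582701890278553180706822,
  534895501488841668551230161589631897281671698716822534, 518262439618046919284877085280375650698815746420961714182,
  619708294842963361475679106666132072699412513556486, 340489069682231302, 54510656548767750, 257172545291159558,
  378769903807629318, 127760037734709142226950, 342743231727929350, 343872291653814278, 218898497222477830, 241416697214404614,
  325861410722547718, 347253504657590278, 79290203009714182, 180624577978697734, 74024153238269111238997618723846,
  873197985761462021013846584885331787122788843028556743257390058797586506300788050956031966567336891861419524549632437352777684678143093245958,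
  780387675059075564597546776182072565351099327203944855197239311876459664500946562013599092435687675322125817198901799959924742,
  23580375241465439772985577257845985278856946702990523596526324742,
  300463419523158848666097744188644466829585139688851975657608802593380821371910,
  656969232702267504490824246849928085164198998146201236472687733927286972532178385063971818884829216245766, 40647884066111020337158,
  498136250153175046, 82731602158545028791666694, 407932697392674238313268230]

theorem model_gQ (cx : Ctx G K A C) {v1 s1 y k1 c1 c2 k2 y2 s2 v2 t2 gm g gp t1 a a2 x1 z x2 : V} {Bs1 Bc1 By2 Bt2 Bgp : List V}
    (hc : Cyc G.Adj [[v1], Bs1, [k1], Bc1, [k2], By2, [v2], Bt2, [g], Bgp].flatten) (hC : [[v1], Bs1, [k1], Bc1, [k2], By2, [v2], Bt2, [g], Bgp].flatten.Perm C)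
    (es1 : Ends s1 y Bs1) (ec1 : Ends c1 c2 Bc1) (ey2 : Ends y2 s2 By2) (et2 : Ends t2 gm Bt2) (egp : Ends gp t1 Bgp)
    (h0 : AllP A [v1, v2])
    (h1 : AllNot A [s1, y, k1, c1, c2, k2, y2, s2, t2, t1, a, a2])
    (h2 : List.IsChain (EE G) [v1, x1, z, x2, v2])
    (h3 : AllNot K [x1, z, x2])
    (h4 : AllNot K [s1, t1, y, a, s2, y2, a2, t2])
    (h5 : NAdj G [x1, z, x2] [s1, y, k1, c1, c2, k2, y2, s2, t2, t1, a, a2])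
    (h6 : AdjImp' G A [x1, z, x2] [gm, g, gp])
    (h7 : NAdj G [s1, t1, y, a] [s2, y2, a2, t2, v2])
    (h8 : NAdj G [v1] [s2, y2, a2, t2])
    (h9 : List.IsChain (EE G) [s1, t1])
    (h10 : List.IsChain (EE G) [v1, a, y])
    (h11 : List.IsChain (EE G) [v2, a2, y2])
    (h12 : AllP K [k1, k2])
    (h13 : List.IsChain (EE G) [s2, t2])
    (h14 : AdjImp G K [c1, c2] [s1, t1, y, a, s2, y2, a2, t2])
    (h15 : List.IsChain (EE G) [v1, v2])
    (h16 : NAdj G [k1] [k2])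
    (h17 : List.IsChain (EE G) [k1, g, k2])
    (h18 : NAdj G [k1] [v2])
    (h19 : NAdj G [k2] [v1])
    (h20 : AllP K [g]) : False :=
  runM_sound cx (fun i => [v1, s1, y, k1, c1, c2, k2, y2, s2, v2, t2, gm, g, gp, t1, a, a2, x1, z, x2].getD i v1) (bl := [(0, 0), (1, 2), (3, 3), (4, 5), (6, 6), (7, 8), (9, 9), (10, 11), (12, 12), (13, 14)])
    (gs := [.a [0, 9], .n [1, 2, 3, 4, 5, 6, 7, 8, 10, 14, 15, 16], .e [0, 17, 18, 19, 9], .l [17, 18, 19], .l [1, 14, 2, 15, 8, 7, 16, 10], .x [17, 18, 19] [1, 2, 3, 4, 5, 6, 7, 8, 10, 14, 15, 16], .rx [17, 18, 19] [11, 12, 13], .x [1, 14, 2, 15] [8, 7, 16, 10, 9], .x [0] [8, 7, 16, 10], .e [1, 14], .e [0, 15, 2], .e [9, 16, 7], .k [3, 6], .e [8, 10], .cc [4, 5] [1, 14, 2, 15, 8, 7, 16, 10], .e [0, 9], .x [3] [6], .e [3, 12, 6], .x [3] [9], .x [6] [0], .k [12]])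
    (rows := rows_gQ) (by decide +kernel)
    hc hC (.cons (Ends.single _) (.cons es1 (.cons (Ends.single _) (.cons ec1 (.cons (Ends.single _) (.cons ey2 (.cons (Ends.single _) (.cons et2 (.cons (Ends.single _) (.cons egp (.nil))))))))))) ⟨h0, h1, h2, h3, h4, h5, h6, h7, h8, h9, h10, h11, h12, h13, h14, h15, h16, h17, h18, h19, h20, trivial⟩

def rows_gS : List ℕ := [
  13962840069, 1182205030796626950, 22833824597609582599336469994499,
  7715334457987407091957745894971443291344886465920806753382334414462406546945185216710818784390411072228575238, 19807321719810,
  7714871117928862073001443588771525467409914391329514502, 19808391267330, 10280477716937806719395359500153849315552043999238,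
  13956540851612777809013678021635,
  21802002946462170606421562107920018129550805113754295405378276369697085706508823864179851206645124618553149446,
  21761866111918825843726339, 20268707434421516595716358908535996577600543500924683881642172892939563014,
  23943000452618030077898450882554503171,
  42055203337991466164380353636898288052655765322570415831740663126017302616982724877546738310881471988538162356693200365232199736400592955870568454,
  19799801332738, 21972490793806958580797318859371325096872740134918, 13668128322685128734556560387,
  36353517397628931050476598587353974095125361721026242144815608543179821131384291952912161332805638, 22818968108226184738459629919235,
  42631710893801497364080054853615374299496969056113611445913371008209035989359001244872534865950029136902, 15717231245853861208922115,
  37259081696155795302762691080266905681296920719323196211944220015054565382, 21776033197863230814296067,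
  41470872211761927683548694822118921648977195786100872767934379639847268358, 24193887142922311760353283,
  42189096630481561912257110775699105121544994429167525469935702649862, 21776033197863230813247491,
  46289692374110569542082154909986740385061614235270265312285331303430, 13313544400232411263145987,
  46842874907492491607772968967913125380550337147258943438858246, 20556480914234959419414531,
  55602197853524798791328076476806924169215551723467661145211594089048322054, 22009577747458,
  48285229283756131035947181584279443507683465895942, 21761866111918823696242691,
  59769665707686176782336710859647623760912074897305159569156751764486, 19806243783682, 49226879883845149598699639619856635910,
  15736120701665434772969475, 63125677096428171400722200562439578340393349257903714702731270, 16940325325726497117313027,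
  69667375315533503630605755566994557378683171243114422464464230034438, 22008487228418,
  62900245610786675240304811697267959143244583936006, 20567106239950604892903427,
  80118926313911783009508112776175096009619776142188615591707890658132897798, 24179720056992193992202243,
  76290328724437277973152619240832453452101048564131451615848454, 19344012160084566061619203,
  83037099839060474925269797543473051399928388646580384167817458494470, 22833824597609592734634654833667,
  95360217278638346193468979524647047161072839792405872954426477527057529842971654, 19344012158958666154776579,
  94138098259956213873477112169268659912238456330976508900326848810263261190, 20563564463959253146671107,
  93152016357622136393509837318925315038047522905163216694507994098694, 22008498762754,
  87410625545098142033325833993661294100098346910956397574, 19344012158961972205852675,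
  95564169593962802167158544493935282165500190387313042017757190, 14299021971458,
  93519655601107783335211888053215378034469937457912620038, 19351095703063368838420483,
  101587048601312351423323427876035201117989311288725690444163078, 19347553928201221972170755,
  110316274696340150264378831352538111031098884178561090693807689706502, 21776033197850044197246979,
  103114205256497794247469976894470175386273152836113015814, 24193887142925616732444675,
  121979745038652652178113923831016053696927168293108384368950458599489941510, 7614574024449650138011204066307,
  145586408662112969400347943728276886081744896185967234516590799646057420745105294223532375046, 16506636210178,
  111909602085789464310540503902251931383509248087107314694, 24774540434365956935541332995,
  132580827741614720922927285094745694471557321867918694098150868954758787078, 24774540434365950337391533059,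
  143536963413840738310059250392661468019134560397423510607724685601330986151326726, 7517243397, 91083060573323136006,
  20567106235447005265532931, 124566149399235686190364916875602530432848495261210649606, 18700293905410,
  115705545246820308268798032997222437291564038, 18707809046530, 118484971370600119782464502596453073882717190, 15404983396354,
  121297064497768549137804997823782116732705798, 16499122126850, 130086504062086861468789409121824734937613010477062, 16504495024130,
  115377260592747054376300597744646, 18609012868655804821459180547,
  198688531174760614072581593691014105061694064474421478171905085937039299793743892312258664847130630, 19808404898818,
  115418181389289985194070022, 8802536528898, 141787080082030874013637664365371654844629694554118, 52001955949340772267922037763,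
  159118266116787506072349353203648048626277997083382903148128262, 22003123762178, 134302664147376390036513749975050491910,
  24193887142935504826144771, 157905412318152979989821015224332826405772922367513732102, 24193887142922310680320003,
  146558257261693178943327439734248504745270278, 16500516097167700198982630251523,
  198760743365903944355370964109731612445908565417117993402318810901599223809061894, 52001955956253784517902343171,
  201977605389328534529824610744604348983046651078038277594873764003049284643599366, 19344012158958673670969347,
  179124947895430202296897575402037983907626469814113887507720198, 22005276488706, 143292808399540953301272609428486, 22005270197250,
  152911855851926714036481907900734773254, 13949116838154524371252882185219,
  188766576160983859929261824105721548099926664865802937294661638, 16108225541, 130941746939910, 16501270649858,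
  168669815088138236419590168952054111966075910, 15736120701652243854661635, 180178606218434519663902977567828364017659177607174,
  7272451309033992624281603, 211297596860383792456873126729978769042638289523693985763071215283206, 15717231250357460836292611,
  195242029160309325172921503000546739683323125794088166406, 22083742365080760663857277670793219,
  276147250104367123583420782146672258901195964649846353599992843048491163801307327338872911004975110, 50786703036795965613808643,
  210540283329540548088064210600901795715033361751162507538475014, 19351095703063374199789571,
  194793622949719447453678486405164301295915688271878, 16507712049154, 197341269283806627261646551888085577369874370404358,
  21761866111912229847701507, 191607559332806426289633578514934043434294278, 17607223676930,
  203187275833130241530609720488725706955181087793158, 19344012158961958247208963, 197090187577291688361499404175541108831427590,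
  16945047687695871540992003, 219676653985577672609611513514110521119490856143664718854, 42505921309549960108035,
  222214860148326626000603066169680435838677095028095984646, 25369125800446817553943574354947,
  205029658340267519096070833931371577988881414, 18708880691202, 198061473431656957909440318688866605062,
  21556253540308908355096460395524, 191417732490314184915346093249542, 8898099546118, 105998721222662,
  18626068193253646311467065811834773507, 301785268987655251518478419064092443070073145671917385207991015073385738508568080955398,
  12104297883650, 199042200121627356716822801945606, 19807329059842, 192248730813176893455470598, 15044969477, 177256527824902,
  17605082487810, 206813979692112850603375892370438, 24179720056984507073435651, 224791433233134034775817310136688293451782,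
  21761866111919923198433283, 233161480672589492456908373151275641920822278, 112521701754886, 13965985797, 196025939515512196102,
  18135085197684823534082051, 245701635743057703303389578752158898251432467462, 19808401753090, 191340794087430, 41811507677190,
  19344012158961965763401731, 219319877230909864475016302598, 12093992104243401167214595, 243867014152754124895187099644560302675974,
  22008500859906, 199390637590534, 64013268420614, 19808268450773674140351077379,
  289005902050214445601781106133408373289655186249250228937734, 4296017925, 214445661559813311494, 19344012158965270740736003,
  244252306623229329526301287871681542, 12093992106482022947493891, 8481378278199023755073539,
  207640797753592415055564893638295904143477511138400058841449373702, 122869195626159762574342,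
  280677091274496008941809338559991285182578953296902, 51946301280433002265833247063675910, 21561216186709463962568289682436,
  16112419845, 21564931219299513881293847790596, 21564931219299508249598517838852, 16113468421, 7517242373,
  53141612055341940348931, 18135085197684837492725763, 196430766987585882811043793668705588439721889611517715724427839008843896120676358,
  21561210132620635943532880724996, 8592032773, 13967034373, 118785, 114689,
  201145105395287942142191403575916192318949616044004009167334669614737880184712596486, 117761, 12103224138754, 113665, 119809,
  15401759022082, 10738468869, 21568653487713712929651372852228, 15043920901, 21556253553302334835708979577860, 5369759749,
  21568645033501727544473579160580, 15037629445, 21556253553302329204013649626116, 11816403973, 5369758725, 15404979209218,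
  21563688432914324891281891787780, 13968082949, 125953, 128001, 122881, 19354637477925526441039875,
  53250002892124950802362903044099, 18152794055103788632512515,
  847746670513523211424683670893558672042488272654621303282635692475304972542559625120603818649034464621721993930319956553316356323808872992428511877063113017504092105230885021703574590891639347389585692678,
  718069360850089835003434153650454001001556021953816493824290609058335568146497618071185793712135643858476618261232342528329160551117812862510961976560986449109746587270192964041708550,
  21556259579046580917395686163460, 6445597701, 21553797011312203329346131198980, 13961790469, 21556259586122057942676285686788,
  3222275077, 3222276101, 21556259586122057942676284638212, 16109274117, 16499120029698,
  490897396611784328081335488925042017186719471333920385819844153286439306455805817091206821965694186833831769471892262352621936800148700643926946447888819243870314497486630162438,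
  638075847569172746545215061474385197288040111762215575686697312730368282214402830694948246220641143473469990535644744086598734528425901813726168809425502843295860002822,
  566109177824346717400003585222458295064692863205339108009941533866263862698440988791823352721508334642643818955528344496471892134458068831238,
  579695798092130994953325472164485117765611998033767353381886450731090723183703744900492825499537089377402287040909230398375083356305203533975558,
  421749938741616553809217670033298424089660742923574862908818144293526746172422, 121857,
  409367794832764453794074286386692121218933050801690450382881516227551571300584424878085013670485349142945319097087946196307256037908775503529733558476314896711876572578272223330605571509254,
  994664330616347248323720350463382153674513000558032600257886086634408051686182560519086991682810405904740564538303286324224568047334826523649992459998005134654934409446223549097935113222,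
  21566154653398020662191546440707,
  883439393298519316116223630552284426961420935297361763504949865023535928929889255650196738928947041069199064402369331732386424380995932795779024724580679732213005283231750,
  180425772532500486, 38563281919543302, 185628397455560114702379307055597572999078849155176454, 4296016901, 13962839045,
  24179720056984507059804163, 5370807301, 499062327408981650421351180386599728836625895574937961192520642877460600650715895814,
  419812713147498531905111692709602851052887604497217416706890147846, 4297065477, 21556254749234727969725635101700, 5371856901,
  533274773919439213724359956563816216515720813056942496711444166550956681831102495690068998, 19808268450777052946025683971,
  436492675377729484038131300574519228164549138180707443399912858630, 204123128985761395681649474802434864757664576518580169813108201478,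
  190104477789922399803705265027662976146397109449477068806, 28069291855954698849778056969944733280375814,
  21568645033501742166879788598276, 15039726597, 24193887142922318199658499,
  432096599342188849525106285514876723829505552073515634149893758134381109381330832556301318,
  244856931588402395629700105329905001929129531488204355449023843928259601259042822, 21761866111926520277637123, 17606156226562,
  15398532550658,
  758813871648885561692115660114084159382203343480022393782814752736300996441799211730825556724326827133015715927735352080527887789200390,
  153426185570033676650203606135029214960481454145569561606, 139697025736366540951591598372548342261487622,
  355777759319304723234643192643436318980819073148840597912602809350, 220411537245599662154709995526,
  209835063605593376576051464702260593482912869897088920672073367961826624709179999263750, 184501683783618112843469472496881670,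
  45387735364277828700417699429064373554535882109591748263368398483150789210097995123784685574,
  303961798646678586361851928783206072280577807487410084049156569482232508453894, 20289845725258753516386358664195,
  142918886872880837078762220107549335946782613520404585696926810622310516905625752276783076358,
  417134418481256452113890534996614592708828205062, 21761866111912228773959683,
  88048425493312283434959005730789916472709283547045382067206, 104395436176448498120004814885248332978003117132854858758,
  400021103709969997710195059005950380636656111622,
  630056345118684478592186463423248611690216787419547943228454511344237890567960896339407316472419631337414071302,
  13302919079018156729047043, 95919249401784908859111413152307802071637555031134676443522510681757716486,
  438714782979698446653448311055036665104722090265606, 20564745055579970564265987, 393556087915904549259813698227145734,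
  342605726199318534, 261544293718558726, 217634076017821702, 128689206370240518, 49877147053983750, 245784995709323270,
  243534149377329158, 244452554366256134]

theorem model_gS (cx : Ctx G K A C) {v1 s1 gm g gp y k1 c1 c2 k2 y2 s2 v2 t2 t1 a a2 x1 z x2 : V} {Bs1 Bgp Bc1 By2 Bt2 : List V}
    (hc : Cyc G.Adj [[v1], Bs1, [g], Bgp, [k1], Bc1, [k2], By2, [v2], Bt2].flatten) (hC : [[v1], Bs1, [g], Bgp, [k1], Bc1, [k2], By2, [v2], Bt2].flatten.Perm C)
    (es1 : Ends s1 gm Bs1) (egp : Ends gp y Bgp) (ec1 : Ends c1 c2 Bc1) (ey2 : Ends y2 s2 By2) (et2 : Ends t2 t1 Bt2)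
    (h0 : AllP A [v1, v2])
    (h1 : AllNot A [s1, gm, g, gp, y, k1, c1, c2, k2, y2, s2, t2, t1, a, a2])
    (h2 : List.IsChain (EE G) [v1, x1, z, x2, v2])
    (h3 : AllNot K [x1, z, x2])
    (h4 : AllNot K [s1, t1, y, a, s2, y2, a2, t2])
    (h5 : NAdj G [x1, z, x2] [s1, gm, g, gp, y, k1, c1, c2, k2, y2, s2, t2, t1, a, a2])
    (h6 : NAdj G [s1, t1, y, a] [s2, y2, a2, t2, v2])
    (h7 : NAdj G [v1] [s2, y2, a2, t2])
    (h8 : List.IsChain (EE G) [s1, t1])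
    (h9 : List.IsChain (EE G) [v1, a, y])
    (h10 : List.IsChain (EE G) [v2, a2, y2])
    (h11 : AllP K [k1, k2])
    (h12 : List.IsChain (EE G) [s2, t2])
    (h13 : AdjImp G K [c1, c2] [s1, t1, y, a, s2, y2, a2, t2])
    (h14 : List.IsChain (EE G) [v1, v2])
    (h15 : NAdj G [k1] [k2])
    (h16 : List.IsChain (EE G) [k1, g, k2])
    (h17 : NAdj G [k1] [v2])
    (h18 : NAdj G [k2] [v1])
    (h19 : AllP K [g]) : False :=
  runM_sound cx (fun i => [v1, s1, gm, g, gp, y, k1, c1, c2, k2, y2, s2, v2, t2, t1, a, a2, x1, z, x2].getD i v1) (bl := [(0, 0), (1, 2), (3, 3), (4, 5), (6, 6), (7, 8), (9, 9), (10, 11), (12, 12), (13, 14)])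
    (gs := [.a [0, 12], .n [1, 2, 3, 4, 5, 6, 7, 8, 9, 10, 11, 13, 14, 15, 16], .e [0, 17, 18, 19, 12], .l [17, 18, 19], .l [1, 14, 5, 15, 11, 10, 16, 13], .x [17, 18, 19] [1, 2, 3, 4, 5, 6, 7, 8, 9, 10, 11, 13, 14, 15, 16], .x [1, 14, 5, 15] [11, 10, 16, 13, 12], .x [0] [11, 10, 16, 13], .e [1, 14], .e [0, 15, 5], .e [12, 16, 10], .k [6, 9], .e [11, 13], .cc [7, 8] [1, 14, 5, 15, 11, 10, 16, 13], .e [0, 12], .x [6] [9], .e [6, 3, 9], .x [6] [12], .x [9] [0], .k [3]])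
    (rows := rows_gS) (by decide +kernel)
    hc hC (.cons (Ends.single _) (.cons es1 (.cons (Ends.single _) (.cons egp (.cons (Ends.single _) (.cons ec1 (.cons (Ends.single _) (.cons ey2 (.cons (Ends.single _) (.cons et2 (.nil))))))))))) ⟨h0, h1, h2, h3, h4, h5, h6, h7, h8, h9, h10, h11, h12, h13, h14, h15, h16, h17, h18, h19, trivial⟩

def rows_a1 : List ℕ := [
  10384180341600420868, 1225469182613539926315014, 15406058177538, 4637907406220594332202269987075565411340076373926487046,
  15229146839937749077729286822915, 10622828380105656600950198930836737059013486215448280488480061694569180591790471657238313990,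
  14515387812915526587389955, 11385096464761281802746372366758742075452186349590619496654854, 18181926193354249446719327363407875,
  25120132530793171308193166948390025870243663427805175566371654000509280710686592963962818252588243109114890150040643457944409094,
  13950351151404822830572621536259, 20777446813661235176301210393543649052675814784485212767359894763297416349234182, 8594130949,
  14996996877018205190, 15404975004674, 19965690905385747685714749603359758342, 5500780417026, 21551309184813184084758106215430,
  16933241757987794150496259, 25539611705489411245562813673865484294, 15967628669997720436807285131296382979,
  31089738173932678737005814032973981578068545773574, 15615432591366, 17298145871396050478112964616326750211,
  39007481409169156233947595669790733619731905994291902870988806, 10384180351256757252, 30721991662555018300422, 9665774597,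
  30873303910406, 2283702836004870, 30431189769652230, 8590985221, 36061784524720134, 3222275077, 38314688136611846,
  20789780271347009542, 16496797441346570098842815962115, 30993273779351790546125327366, 45948667842864305060973574,
  7454279145642102386521541638, 13302919072262750842394627, 25976743188794927118772139980752902, 4549809181558790,
  18483946064668788742, 13950351151404822831672133164035, 15724314785451660368943107, 59768470575542914125678851832940550,
  26014560288349241739270, 16496797441346570099943401331715, 57903217311070798481414, 11854387363699750863878]

theorem model_a1 (cx : Ctx G K A C) {v1 s1 y k1 y2 s2 v2 t2 t1 a a2 x1 z x2 : V} {Bs1 By2 Bt2 : List V}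
    (hc : Cyc G.Adj [[v1], Bs1, [k1], By2, [v2], Bt2].flatten) (hC : [[v1], Bs1, [k1], By2, [v2], Bt2].flatten.Perm C)
    (es1 : Ends s1 y Bs1) (ey2 : Ends y2 s2 By2) (et2 : Ends t2 t1 Bt2)
    (h0 : AllP A [v1, v2])
    (h1 : AllNot A [s1, y, k1, y2, s2, t2, t1, a, a2])
    (h2 : List.IsChain (EE G) [v1, x1, z, x2, v2])
    (h3 : AllNot K [x1, z, x2])
    (h4 : AllNot K [s1, t1, y, a, s2, y2, a2])
    (h5 : NAdj G [x1, z, x2] [s1, y, k1, y2, s2, t2, t1, a, a2])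
    (h6 : NAdj G [s1, t1, y, a] [s2, y2, a2, v2])
    (h7 : NAdj G [v1] [s2, y2, a2])
    (h8 : List.IsChain (EE G) [s1, t1])
    (h9 : List.IsChain (EE G) [v1, a, y])
    (h10 : List.IsChain (EE G) [v2, a2, y2])
    (h11 : AllP K [k1])
    (h12 : AllP K [t2]) : False :=
  runM_sound cx (fun i => [v1, s1, y, k1, y2, s2, v2, t2, t1, a, a2, x1, z, x2].getD i v1) (bl := [(0, 0), (1, 2), (3, 3), (4, 5), (6, 6), (7, 8)])
    (gs := [.a [0, 6], .n [1, 2, 3, 4, 5, 7, 8, 9, 10], .e [0, 11, 12, 13, 6], .l [11, 12, 13], .l [1, 8, 2, 9, 5, 4, 10], .x [11, 12, 13] [1, 2, 3, 4, 5, 7, 8, 9, 10], .x [1, 8, 2, 9] [5, 4, 10, 6], .x [0] [5, 4, 10], .e [1, 8], .e [0, 9, 2], .e [6, 10, 4], .k [3], .k [7]])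
    (rows := rows_a1) (by decide +kernel)
    hc hC (.cons (Ends.single _) (.cons es1 (.cons (Ends.single _) (.cons ey2 (.cons (Ends.single _) (.cons et2 (.nil))))))) ⟨h0, h1, h2, h3, h4, h5, h6, h7, h8, h9, h10, h11, h12, trivial⟩

def rows_ac : List ℕ := [
  11735914219572344092626999223263235,
  3182747019157629426199873570887611665301282609922674077282467165975291404161558645888490772791798291091208296935852155325628323058534417318305798,
  10741614597, 3525099653126, 51998329169573820389039021059,
  9431631202468802691754344489351248553557606225219209288003254872195098936882182, 19353456886303695558416387,
  10857674285208955425064597839128587948612918085336179718, 12996892008244927529988, 11146317322486299718614781958, 15406049788930,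
  16897871733147683420831408492139623772948553161539331078, 5500780417026, 19012379060078620481127368223545759189844639096838,
  19344012162342964007278595, 23225392009321393579074254834445015729714135366804448262, 17606145745922,
  22629339193813973769905453956833744902, 53246289069644760750394291789827,
  35358203583186522313331066824969263133639388715277243964557614408640989706073094, 10738468869, 24213613312568462342,
  53246289069644759624494384947203, 47552062630539327478935514191315575105334233766764670994657940933283470568541914679420664838,
  20299741992027338849755555961859, 44778533918090554365773454553466779843888394530413625158399771656596762630,
  50786700717454238184119299, 47854987455837822936021094448170199541677972687448549028469983544496631814,
  53246289069643606702989778100227, 56510041257997296576070535739326336002983166822880884800190538211126065699486939756550,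
  19353456900928308309399555, 45808944856549192407092376049695642899043511705606, 15406059226114,
  43891795015196330546417006646448363526, 19344012162336368020690947, 51369501772052715518289816233199492631684398981126,
  11813258245, 40773203527686, 17607226827778, 47165826610767936836603910, 51998329169574946288945863683,
  66020990080311872364160386639133105794862794852331237785217030, 51998329169572694489132178435,
  69241143162812931403199373995335433175681237472212364857190406, 37545532459014, 49596387419388905527299,
  67353248948085670706221752236438986149893334114310, 12996892008244928578564, 58033205521268345003838470, 15404979192834,
  60456926993486841344167942, 17607229965314, 60347111340241849350, 12996892017031356875780, 60803291521484806, 11156182796294,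
  12996892008233127904260, 62762362341382, 12996892008233126855684, 66469897425651718, 53882517456902, 11816403973,
  69866565865048070, 11814306821, 72119327751407622, 10739516421, 74373255721388038, 24835770805127174, 3222275077,
  77754170224936966, 20299741992027332094356114906115, 99020894501270060144354023362108699920308230, 10738467845,
  82256685373065222, 13287556122630, 19344012162342965081020419, 40658992189986185251318558362630,
  62832450413677417616965352032819785264633223174, 19817939866550587701313149955, 103782354447296400315211874555709623302,
  12996892018129796858884, 4296016901, 12996892018130868503556, 11815355397,
  85049012567565857980789557558081730794513488900278966830636870147866736201734, 19817939851574983145868499971,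
  49620226819946180123603691985193720740329936329398564733527535477525056518, 8605400870300390792374368034894566159831537670,
  19825193415713801050345446403, 17765696863127055284800655989763, 29233010018722111731691598707039203891618912408582,
  110033561384055052414486534, 86795542388017158, 90173180904212486, 98054743323052038, 18522282813904914438, 10742663173,
  109316755315230726, 32297715430742354449371498502, 92161, 112697891001206790, 58870036191958272006, 12099999764482,
  124638671881345529633835014, 52106022812217592699964884998, 17449715677071763409225123846,
  40082899995672803689768979692723882570200123398, 43574564620891830384330758, 10016061513412664105913812998,
  58295738392116635051371791366]

theorem model_ac (cx : Ctx G K A C) {v1 s1 y k1 c1 k2 y2 s2 v2 t2 t1 a a2 x1 z x2 : V} {Bs1 Bc1 By2 Bt2 : List V}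
    (hc : Cyc G.Adj [[v1], Bs1, [k1], Bc1, By2, [v2], Bt2].flatten) (hC : [[v1], Bs1, [k1], Bc1, By2, [v2], Bt2].flatten.Perm C)
    (es1 : Ends s1 y Bs1) (ec1 : Ends c1 k2 Bc1) (ey2 : Ends y2 s2 By2) (et2 : Ends t2 t1 Bt2)
    (h0 : AllP A [v1, v2])
    (h1 : AllNot A [s1, y, k1, c1, k2, y2, s2, t2, t1, a, a2])
    (h2 : List.IsChain (EE G) [v1, x1, z, x2, v2])
    (h3 : AllNot K [x1, z, x2])
    (h4 : AllNot K [s1, t1, y, a, s2, y2, a2])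
    (h5 : NAdj G [x1, z, x2] [s1, y, k1, c1, k2, y2, s2, t2, t1, a, a2])
    (h6 : NAdj G [s1, t1, y, a] [s2, y2, a2, v2])
    (h7 : NAdj G [v1] [s2, y2, a2])
    (h8 : List.IsChain (EE G) [s1, t1])
    (h9 : List.IsChain (EE G) [v1, a, y])
    (h10 : List.IsChain (EE G) [v2, a2, y2])
    (h11 : AllP K [k1, k2])
    (h12 : AllP K [t2])
    (h13 : AdjImp G K [c1] [s1, t1, y, a, s2, y2, a2]) : False :=
  runM_sound cx (fun i => [v1, s1, y, k1, c1, k2, y2, s2, v2, t2, t1, a, a2, x1, z, x2].getD i v1) (bl := [(0, 0), (1, 2), (3, 3), (4, 5), (6, 7), (8, 8), (9, 10)])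
    (gs := [.a [0, 8], .n [1, 2, 3, 4, 5, 6, 7, 9, 10, 11, 12], .e [0, 13, 14, 15, 8], .l [13, 14, 15], .l [1, 10, 2, 11, 7, 6, 12], .x [13, 14, 15] [1, 2, 3, 4, 5, 6, 7, 9, 10, 11, 12], .x [1, 10, 2, 11] [7, 6, 12, 8], .x [0] [7, 6, 12], .e [1, 10], .e [0, 11, 2], .e [8, 12, 6], .k [3, 5], .k [9], .cc [4] [1, 10, 2, 11, 7, 6, 12]])
    (rows := rows_ac) (by decide +kernel)
    hc hC (.cons (Ends.single _) (.cons es1 (.cons (Ends.single _) (.cons ec1 (.cons ey2 (.cons (Ends.single _) (.cons et2 (.nil)))))))) ⟨h0, h1, h2, h3, h4, h5, h6, h7, h8, h9, h10, h11, h12, h13, trivial⟩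

def rows_a31 : List ℕ := [
  16506643547138, 1433281662476756475104095145826808073559046, 7835353319033857711943303759405059,
  7068582909702298411957873715701161666361220571950440587232915086265831574718249109961524529351265945813796870,
  8023401798690671491445361733402633219,
  15639255394734552747343015398266288575199897745240008822942809372600938933807775195601490262301926125682938167729207668884313291173595344100417542,
  13201656785922, 10761903244705140960136715759100131753463136680758223878, 15717231243607564327327747,
  11438568405643816525080086713350, 16506640408578, 14659163530818291470851238024348440582, 10384180341600420868,
  15718411920792283048316934, 18135085188679830807255043, 20936896242003243733350656756636299973106694, 16500196909058,
  22634531505527922475002167124638570502, 9535929675586205589686964292319829828611,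
  46813952589517923099073145412713416693809604195580616890585053698871061787990334930465432494033954105255128562945030,
  18143349335645556134909955, 26974715899855429570317593351174, 10384180341601469444, 26519460787474402310,
  19030853450578078399862028639235, 32045318301948929791060587058182, 20148766377990, 7835353319033860017786312973099011,
  34252505878573871577174022, 26476331141126, 9665774597, 34935970508834822, 10739516421, 36373009532934,
  15800001423738886, 9664727045, 40570881710229510, 9664726021, 42822698695395334, 13200583044098, 45077045424687110,
  9048317125199878, 7835353319033858864864808366252035, 55869436015707172345582967025832966, 50760387948528146288542227459,
  58462806506989261863736714193802246, 10436572353128300224388818965372931, 59933632038235062031277620204550, 15404977106946,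
  56516807755609148422, 14305464419330, 56166362122246, 55211806689286, 27908167431595783678656392465414,
  18135085188679831890434051, 16500191666178, 62378563181985820249081133746097158, 65372767311338969724744575247040448040966,
  66933683242607314950, 13576179022825478, 2316703213029382, 64605329641926821894, 54476688541305972472253777926,
  9764791987800274523839465259133472103999491, 85147245369966744231154656371505367046, 24822945918689215334738560006]

theorem model_a31 (cx : Ctx G K A C) {v1 s1 y k1 k2 y2 s2 v2 t2 t1 a p x1 z x2 : V} {Bs1 Bk1 By2 Bt2 : List V}
    (hc : Cyc G.Adj [[v1], Bs1, Bk1, By2, [v2], Bt2].flatten) (hC : [[v1], Bs1, Bk1, By2, [v2], Bt2].flatten.Perm C)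
    (es1 : Ends s1 y Bs1) (ek1 : Ends k1 k2 Bk1) (ey2 : Ends y2 s2 By2) (et2 : Ends t2 t1 Bt2)
    (h0 : AllP A [v1, v2])
    (h1 : AllNot A [s1, y, k1, k2, y2, s2, t2, t1, a, p])
    (h2 : List.IsChain (EE G) [v1, x1, z, x2, v2])
    (h3 : AllNot K [x1, z, x2])
    (h4 : AllNot K [s1, t1, y, a, p, s2, y2])
    (h5 : NAdj G [x1, z, x2] [s1, y, k1, k2, y2, s2, t2, t1, a, p])
    (h6 : NAdj G [s1, t1, y, a, p] [s2, y2, v2])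
    (h7 : NAdj G [v1] [s2, y2])
    (h8 : List.IsChain (EE G) [s1, t1])
    (h9 : List.IsChain (EE G) [v1, a, p, y])
    (h10 : List.IsChain (EE G) [v2, y2])
    (h11 : AllP K [k1, k2])
    (h12 : NAdj G [v1] [p, y])
    (h13 : NAdj G [a] [y])
    (h14 : AllP K [t2]) : False :=
  runM_sound cx (fun i => [v1, s1, y, k1, k2, y2, s2, v2, t2, t1, a, p, x1, z, x2].getD i v1) (bl := [(0, 0), (1, 2), (3, 4), (5, 6), (7, 7), (8, 9)])
    (gs := [.a [0, 7], .n [1, 2, 3, 4, 5, 6, 8, 9, 10, 11], .e [0, 12, 13, 14, 7], .l [12, 13, 14], .l [1, 9, 2, 10, 11, 6, 5], .x [12, 13, 14] [1, 2, 3, 4, 5, 6, 8, 9, 10, 11], .x [1, 9, 2, 10, 11] [6, 5, 7], .x [0] [6, 5], .e [1, 9], .e [0, 10, 11, 2], .e [7, 5], .k [3, 4], .x [0] [11, 2], .x [10] [2], .k [8]])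
    (rows := rows_a31) (by decide +kernel)
    hc hC (.cons (Ends.single _) (.cons es1 (.cons ek1 (.cons ey2 (.cons (Ends.single _) (.cons et2 (.nil))))))) ⟨h0, h1, h2, h3, h4, h5, h6, h7, h8, h9, h10, h11, h12, h13, h14, trivial⟩

def rows_a13 : List ℕ := [
  3222275077, 1104885581830, 10739516421, 3387660699654, 9667872773, 5721975425030, 10384180351256757252,
  7887900714730502]

theorem model_a13 (cx : Ctx G K A C) {v1 s1 y k1 k2 y2 s2 v2 t2 t1 a2 p2 x1 z x2 : V} {Bs1 Bk1 By2 Bt2 : List V}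
    (hc : Cyc G.Adj [[v1], Bs1, Bk1, By2, [v2], Bt2].flatten) (hC : [[v1], Bs1, Bk1, By2, [v2], Bt2].flatten.Perm C)
    (es1 : Ends s1 y Bs1) (ek1 : Ends k1 k2 Bk1) (ey2 : Ends y2 s2 By2) (et2 : Ends t2 t1 Bt2)
    (h0 : AllP A [v1, v2])
    (h1 : AllNot A [s1, y, k1, k2, y2, s2, t2, t1, a2, p2])
    (h2 : List.IsChain (EE G) [v1, x1, z, x2, v2])
    (h3 : AllNot K [x1, z, x2])
    (h4 : AllNot K [s1, t1, y, s2, y2, a2, p2])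
    (h5 : NAdj G [x1, z, x2] [s1, y, k1, k2, y2, s2, t2, t1, a2, p2])
    (h6 : NAdj G [s1, t1, y] [s2, y2, a2, p2, v2])
    (h7 : NAdj G [v1] [s2, y2, a2, p2])
    (h8 : List.IsChain (EE G) [s1, t1])
    (h9 : List.IsChain (EE G) [v1, y])
    (h10 : List.IsChain (EE G) [v2, a2, p2, y2])
    (h11 : AllP K [k1, k2])
    (h12 : NAdj G [v2] [p2, y2])
    (h13 : NAdj G [a2] [y2])
    (h14 : AllP K [t2]) : False :=
  runM_sound cx (fun i => [v1, s1, y, k1, k2, y2, s2, v2, t2, t1, a2, p2, x1, z, x2].getD i v1) (bl := [(0, 0), (1, 2), (3, 4), (5, 6), (7, 7), (8, 9)])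
    (gs := [.a [0, 7], .n [1, 2, 3, 4, 5, 6, 8, 9, 10, 11], .e [0, 12, 13, 14, 7], .l [12, 13, 14], .l [1, 9, 2, 6, 5, 10, 11], .x [12, 13, 14] [1, 2, 3, 4, 5, 6, 8, 9, 10, 11], .x [1, 9, 2] [6, 5, 10, 11, 7], .x [0] [6, 5, 10, 11], .e [1, 9], .e [0, 2], .e [7, 10, 11, 5], .k [3, 4], .x [7] [11, 5], .x [10] [5], .k [8]])
    (rows := rows_a13) (by decide +kernel)
    hc hC (.cons (Ends.single _) (.cons es1 (.cons ek1 (.cons ey2 (.cons (Ends.single _) (.cons et2 (.nil))))))) ⟨h0, h1, h2, h3, h4, h5, h6, h7, h8, h9, h10, h11, h12, h13, h14, trivial⟩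

def rows_bkk : List ℕ := [
  8275682960364385862660, 1270142359269960251649708528646, 8275682960365457507332, 3461030905790860294,
  13959016731672901839773754203139,
  12394071339328284270668920633554047173796923278985337092870722415431631524205051964748688185429520709187553286, 14305465467906,
  10266205226398831973217998047305764924697401630726, 6194541809597882116894366723,
  19684877483203667312949491312192406090303430617782026746163347971720186777919429249126448384458758, 13945399391240762656749863836675,
  20893239235906555437075177400214901926437527681293347666788090128210611995161606, 16506640406530,
  19040924046599601577456482273616183288844652650502, 10738468869, 17296084284927380486, 18140988153530013698758659,
  26576229711310131861866257576902918438025943491233719302, 11813258245, 20981994227718, 14511846038056675029555203,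
  34288670275373290181362086500285668801272718092955748926498822, 15717231241351366467131395,
  35474880663595561123398816170726898530216369862590080006, 19022192706012114806664146721795,
  40622267346630574847008466651963322058206333087525421951494150, 16496807112753129267677095795715,
  50655424667509170740937869660734219888389188199995312620860993977132906926060550, 4696551983110, 12996892008233126855684,
  33799008917915654, 11816403973, 36060981357447174, 18048485526865926, 16094444801521211008208608259,
  47683767144741143260438763760333460871174, 17763202849177324452679464786947, 50406109156858387527749000349163696691206,
  7612098144369939953556172839939, 57406759953203611616491713953346385569285328084998, 15717231250359657718355971,
  52404479359260114734031599309830, 8275682960364386911236, 48435696969451526, 5369758725, 50713885058009094,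
  18586043266551665515597667331, 72453818473940844859131878114992816722163633140182033414, 16876247311851470684952601992110083,
  75518809558527292185899855329633575575991575093430985734, 10741614597, 56301657786374, 12996892008244927529988,
  59730030733821958, 11814306821, 61984029566568454, 9068778349398022, 14306547598338, 63933811525638, 16500191664130,
  6049357235920050393716739, 18135085186423624367609859, 80558002325984028296642663466142726, 6194541809595630317080681475,
  39001664182550478732407967710162627384583999003299846, 13664500222653569967007698320513406340102, 77993994747854542867462,
  19478725330957599976327854489083907, 19022192706013267728168753568771, 91805073364653837622423117467774620678, 16506644595714,
  6194541809596756216987524099, 9754692763542372216650209291934223126400627685833572336274438, 52039507030536041062384797702,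
  4296016901, 84523864395089926, 2328444718415874054, 5371855877, 87905003306485766, 18150432877491849056491523,
  71379219108558312932682972184541218690729773062, 74398824735442950, 28402258511147203299334, 79323765708886820173554649094,
  69358441202694]

theorem model_bkk (cx : Ctx G K A C) {v1 s1 y k1 k2 v2 u2 w3 v3 u3 t1 a x1 z x2 : V} {Bs1 Bk1 Bu2 Bu3 : List V}
    (hc : Cyc G.Adj [[v1], Bs1, Bk1, [v2], Bu2, [v3], Bu3].flatten) (hC : [[v1], Bs1, Bk1, [v2], Bu2, [v3], Bu3].flatten.Perm C)
    (es1 : Ends s1 y Bs1) (ek1 : Ends k1 k2 Bk1) (eu2 : Ends u2 w3 Bu2) (eu3 : Ends u3 t1 Bu3)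
    (h0 : AllP A [v1, v2, v3])
    (h1 : AllNot A [s1, y, k1, k2, u2, w3, u3, t1, a])
    (h2 : List.IsChain (EE G) [v1, x1, z, x2, v2])
    (h3 : AllNot K [x1, z, x2])
    (h4 : AllNot K [s1, t1, a, y, u2, w3])
    (h5 : NAdj G [x1, z, x2] [s1, y, k1, k2, u2, w3, u3, t1, a])
    (h6 : AdjImp' G A [x1, z, x2] [v3])
    (h7 : NAdj G [s1, t1, a, y] [u2, v2])
    (h8 : NAdj G [v1] [u2])
    (h9 : List.IsChain (EE G) [s1, t1])
    (h10 : List.IsChain (EE G) [v1, a, y])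
    (h11 : AllP K [k1, k2, u3])
    (h12 : List.IsChain (EE G) [k1, k2]) : False :=
  runM_sound cx (fun i => [v1, s1, y, k1, k2, v2, u2, w3, v3, u3, t1, a, x1, z, x2].getD i v1) (bl := [(0, 0), (1, 2), (3, 4), (5, 5), (6, 7), (8, 8), (9, 10)])
    (gs := [.a [0, 5, 8], .n [1, 2, 3, 4, 6, 7, 9, 10, 11], .e [0, 12, 13, 14, 5], .l [12, 13, 14], .l [1, 10, 11, 2, 6, 7], .x [12, 13, 14] [1, 2, 3, 4, 6, 7, 9, 10, 11], .rx [12, 13, 14] [8], .x [1, 10, 11, 2] [6, 5], .x [0] [6], .e [1, 10], .e [0, 11, 2], .k [3, 4, 9], .e [3, 4]])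
    (rows := rows_bkk) (by decide +kernel)
    hc hC (.cons (Ends.single _) (.cons es1 (.cons ek1 (.cons (Ends.single _) (.cons eu2 (.cons (Ends.single _) (.cons eu3 (.nil)))))))) ⟨h0, h1, h2, h3, h4, h5, h6, h7, h8, h9, h10, h11, h12, trivial⟩

def rows_bc : List ℕ := [
  15406050837506, 1566929988092122984931198617815319593076735947849081862, 12887000069, 3391955666950, 16926158224022791993169923,
  9438141964911082653314034418114472240105426388273436635964426480958582790, 19344012160084569281796099,
  11598518122809271358072744484418447771318354486948293097039878, 11815356421, 10124316903430, 17607232062466,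
  15365802979360794297513330287964355566771206, 16926158215014490005575683,
  21334303204728522506574664015326154213369726910295116451162118, 15729032546998426346193924, 18581213474299510580027854854,
  19344012160086757568681987, 26675002462100579472948457857977696806270604602913072134, 47046564287761099311564200963,
  36933492030081414950740847731676132025016916288308802407155840515606237540775468480518, 19344012160084558545426435,
  34398519367173662796006506065785887959643011746727420381636614, 15729032547009409651311620, 28484733788582552916659802118,
  10894514481978633330099204, 30953353228685901099179184134, 20778108049422939094568997650178051,
  63438192643718064062633193066596765360811680327157177241936608376915952188907793294834628770226125932661327878,
  7258284209582085155854339, 47142605145986887403730616835322422024821731357616153820145670, 11817453573, 35754087703450225670,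
  13199511392258, 48242411812141296667748404579675151357931743617030, 17607226825730, 44386351403300119378894393447430,
  47046564287759973411657358339, 68570644461179773655583802786298996523576007264509681936113272384376539370763270, 15407134016514,
  47404297681783748140470278, 48175681830667381444457031278595,
  87600518731706890128684732341622343599974008251453779011848171995721971559382599200400492282789894, 35550523295750,
  16136757189075840153824533507, 74715783793284947271516113314307132412462287026791461572948727442438, 28600192468998, 6443501573,
  52967875313403910, 6443500549, 55219685856118790, 6446647301, 56293067851782, 15729040610692447835530244, 58778780174342,
  17755400046598, 26688932022278, 11819550725, 64235685507237894, 12888048645, 66488730853050374, 12890145797,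
  68741767617316870, 16926158215014500741945347, 88105913636433652176267217218334705901902854, 17600777034754,
  82469148056680106699389609709574, 13201658875906, 83014533539607914737113763846, 11816404997, 79562853009977248774,
  10898389669341195725415498595303754310659, 120212339301797526991996038979497573267376364868096370057282266868742,
  10894514481978633329050628, 84221821040244819974, 5369758725, 84523867612121094, 44869406998702092982275,
  109968231758382879629889719071649789906556820486, 48175681830667380318557124435971,
  124049910849789152446019867479653466060448217838497293149190, 10894514481981931859739652, 89429814282246, 12891194373,
  93540221589653510, 18135085197684825681565699, 103246280549083774817669126, 2317776954853382, 44213469186054,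
  47046564287758847511750515715, 111624954357320966565611356740053109658620934, 16926158225148691900012547,
  79338278753153617705359641606, 122415788730953346788672499482653925719659103323844919695366,
  54294070263736650174259453927442467318649591814, 17765696863127056410696265767939, 134293742877382029112201867192811020639789912070,
  109025495359310686800959184571398, 65776237557599740567972373361618271016931129560070, 126294946808941223261728831965368421382,
  45946272766670942138014723, 142755473655736049088243988414112881913300519942, 101903313129031551594428581684172528747464064423169030,
  4296016901, 15729032547010508091294724, 79873, 5500780417026, 141034554210150010999531827108307273734, 110456215500228614,
  113833771338303494, 114959452210202630, 103701910201042950, 111582871320266758, 112556553779880759506503686, 12889097221,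
  128477065053734918, 15729032548136409069782020, 133787434964141213702, 7521437701, 136168715186967939078, 118350480279603206,
  40270465106306453734406]

theorem model_bc (cx : Ctx G K A C) {v1 s1 y k1 c1 k2 v2 u2 w3 v3 u3 t1 a x1 z x2 : V} {Bs1 Bc1 Bu2 Bu3 : List V}
    (hc : Cyc G.Adj [[v1], Bs1, [k1], Bc1, [v2], Bu2, [v3], Bu3].flatten) (hC : [[v1], Bs1, [k1], Bc1, [v2], Bu2, [v3], Bu3].flatten.Perm C)
    (es1 : Ends s1 y Bs1) (ec1 : Ends c1 k2 Bc1) (eu2 : Ends u2 w3 Bu2) (eu3 : Ends u3 t1 Bu3)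
    (h0 : AllP A [v1, v2, v3])
    (h1 : AllNot A [s1, y, k1, c1, k2, u2, w3, u3, t1, a])
    (h2 : List.IsChain (EE G) [v1, x1, z, x2, v2])
    (h3 : AllNot K [x1, z, x2])
    (h4 : AllNot K [s1, t1, a, y, u2, w3])
    (h5 : NAdj G [x1, z, x2] [s1, y, k1, c1, k2, u2, w3, u3, t1, a])
    (h6 : AdjImp' G A [x1, z, x2] [v3])
    (h7 : NAdj G [s1, t1, a, y] [u2, v2])
    (h8 : NAdj G [v1] [u2])
    (h9 : List.IsChain (EE G) [s1, t1])
    (h10 : List.IsChain (EE G) [v1, a, y])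
    (h11 : AllP K [k1, k2, u3])
    (h12 : AdjImp G K [c1] [s1, t1, a, y]) : False :=
  runM_sound cx (fun i => [v1, s1, y, k1, c1, k2, v2, u2, w3, v3, u3, t1, a, x1, z, x2].getD i v1) (bl := [(0, 0), (1, 2), (3, 3), (4, 5), (6, 6), (7, 8), (9, 9), (10, 11)])
    (gs := [.a [0, 6, 9], .n [1, 2, 3, 4, 5, 7, 8, 10, 11, 12], .e [0, 13, 14, 15, 6], .l [13, 14, 15], .l [1, 11, 12, 2, 7, 8], .x [13, 14, 15] [1, 2, 3, 4, 5, 7, 8, 10, 11, 12], .rx [13, 14, 15] [9], .x [1, 11, 12, 2] [7, 6], .x [0] [7], .e [1, 11], .e [0, 12, 2], .k [3, 5, 10], .cc [4] [1, 11, 12, 2]])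
    (rows := rows_bc) (by decide +kernel)
    hc hC (.cons (Ends.single _) (.cons es1 (.cons (Ends.single _) (.cons ec1 (.cons (Ends.single _) (.cons eu2 (.cons (Ends.single _) (.cons eu3 (.nil))))))))) ⟨h0, h1, h2, h3, h4, h5, h6, h7, h8, h9, h10, h11, h12, trivial⟩

def rows_b3 : List ℕ := [
  19814313074116150252381674499, 2734651982622477993939431071830847121185229594030341055100705247892913507457213668731266857451526,
  16926158224021691406751747, 5904447733332725432964268916435595119006622410036778360892465626825633798, 45808623066714300410672192515,
  10696641345316871534428820524372063364187534526708448041851017438098291799731052957537480190476294, 46908030020330419214100460478467,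
  18974974482058786726326956340978164970747459004899869144885529347601798364534421583168071944589326471862973212302106393368876038,
  11813258245, 9986877949958, 7835353319043304750753152848896003,
  25852337184888590159004375967105918744798063493495857453176742130301497562353459536703007923380192839442909190, 11816404997,
  15012759550875929606, 17349310966738679932481707011, 25635319261631611104993087593474157262683761149159069173990120500230,
  8275682960364386911236, 21057084108137305238064336902, 16926158213887501323474947, 26780225386865293326102531210372657653488646,
  16107742971700789076663737347, 34192946016880227901975388596016600380187736080046442146703366, 19344012158959768886581251,
  32447968495492739994139745227659105801346054, 16878812323610492677757890179637251,
  40517126015282402969905359898060913922307831842991801124268038, 7259464794459497754007555, 34558335509720038945237446431750,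
  7835353319043303597831648242049027, 44969169359909874339481196262493941480860380553607652358, 12996899885135494650884,
  35760847568583527430, 46908030020332725057109674172419, 53479340995591942007113189598302836548750913145223505589053446,
  17332386011020790361202105347, 49256554870528147597634429516925667862649862, 35618169030662, 10744760325, 42824893432072198,
  8275682960365457507332, 44278970583046, 12996892008233126855684, 47298812683749382, 19801951963142, 15807702304294918,
  11816403973, 51836774192777222, 10738468869, 54090476685363206, 5369758725, 56343384592222214, 15406059226114,
  58596435316180998, 19032091390626583776673085266947, 65344620195339182403488774, 8023401798700344079746822089403802627,
  82345058808910773864812751790149453993711800164358, 17599703291906, 73572073748734104035914956148742, 15406055031810,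
  67596890397476870, 7985817566469947344741910046397436934, 76796133151806619925210992646, 74400644662836232981510,
  16926158213887500248684547, 75632856599657169553414, 46908030020331572135605067325443,
  37201914283574059272054993372735836974977390598, 16024809882970491365336247423319675910,
  98574909842949055105948759727753818240910889990, 88743031643176283202924336648198, 30699005769815890067451508965163001768315910,
  4673683381719926790, 81145359363999750, 27752388201985083398, 68091131142379407366, 35505445048107642390534,
  19896587398556203466334668806, 79636109956529259526]

theorem model_b3 (cx : Ctx G K A C) {v1 s1 y k1 k2 v2 u2 w3 v3 u3 t1 a p x1 z x2 : V} {Bs1 Bk1 Bu2 Bu3 : List V}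
    (hc : Cyc G.Adj [[v1], Bs1, Bk1, [v2], Bu2, [v3], Bu3].flatten) (hC : [[v1], Bs1, Bk1, [v2], Bu2, [v3], Bu3].flatten.Perm C)
    (es1 : Ends s1 y Bs1) (ek1 : Ends k1 k2 Bk1) (eu2 : Ends u2 w3 Bu2) (eu3 : Ends u3 t1 Bu3)
    (h0 : AllP A [v1, v2, v3])
    (h1 : AllNot A [s1, y, k1, k2, u2, w3, u3, t1, a, p])
    (h2 : List.IsChain (EE G) [v1, x1, z, x2, v2])
    (h3 : AllNot K [x1, z, x2])
    (h4 : AllNot K [s1, t1, a, p, y, u2, w3])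
    (h5 : NAdj G [x1, z, x2] [s1, y, k1, k2, u2, w3, u3, t1, a, p])
    (h6 : AdjImp' G A [x1, z, x2] [v3])
    (h7 : NAdj G [s1, t1, a, p, y] [u2, v2])
    (h8 : NAdj G [v1] [u2])
    (h9 : List.IsChain (EE G) [s1, t1])
    (h10 : List.IsChain (EE G) [v1, a, p, y])
    (h11 : AllP K [k1, k2, u3])
    (h12 : NAdj G [v1] [p, y])
    (h13 : NAdj G [a] [y]) : False :=
  runM_sound cx (fun i => [v1, s1, y, k1, k2, v2, u2, w3, v3, u3, t1, a, p, x1, z, x2].getD i v1) (bl := [(0, 0), (1, 2), (3, 4), (5, 5), (6, 7), (8, 8), (9, 10)])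
    (gs := [.a [0, 5, 8], .n [1, 2, 3, 4, 6, 7, 9, 10, 11, 12], .e [0, 13, 14, 15, 5], .l [13, 14, 15], .l [1, 10, 11, 12, 2, 6, 7], .x [13, 14, 15] [1, 2, 3, 4, 6, 7, 9, 10, 11, 12], .rx [13, 14, 15] [8], .x [1, 10, 11, 12, 2] [6, 5], .x [0] [6], .e [1, 10], .e [0, 11, 12, 2], .k [3, 4, 9], .x [0] [12, 2], .x [11] [2]])
    (rows := rows_b3) (by decide +kernel)
    hc hC (.cons (Ends.single _) (.cons es1 (.cons ek1 (.cons (Ends.single _) (.cons eu2 (.cons (Ends.single _) (.cons eu3 (.nil)))))))) ⟨h0, h1, h2, h3, h4, h5, h6, h7, h8, h9, h10, h11, h12, h13, trivial⟩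

def rows_b4 : List ℕ := [
  20552939131495901593344003, 2055238644503735590856283682492998318493317792692210312357786692614, 15213065708699074841002737933315,
  6366797853832472213768051632976379665975474353253110289212156392064885648736084047878, 11813258245, 5588831438854,
  16930880588259354006788099, 10054666486669328507601832191845189607758854, 18706742653954,
  12589098444718851104640097175650829271571462, 20558842083977686764492803, 17289965142207210483275902056114378401286450259883467782,
  46908030020315443620540132106243, 20441756438949940543145318575408138869355065727362540550, 7835353319044469213858805324980227,
  22335002237005964199814394518999389044171414183942, 8023401798701552990590843158250136579,
  26677996999031258918568335091753228556554560551445865478, 11306503505926, 8275682960364386911236, 22524605949282310,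
  5369759749, 24792889851643910, 5369758725, 27044698246875142, 9535929675586203173000941091319148717059,
  33394672118354719250662621713414, 8275682960365457507332, 31084831049734, 11816403973, 33809181543761926, 16505570853890,
  36917142103204563974, 36446020831238, 9764791987800272050379585688172660341614595, 47665242326597851759328809332249161897990,
  18699214919682, 19518612519927315151345948046550242511816710, 9535929675586203171820349470601737413635, 43952253619406854,
  18468177989889689606, 21809090960099553079986182, 23147224352436133200006383716913204175875, 50813883831253667416070,
  31171713577314682886, 41548003489575076870]

theorem model_b4 (cx : Ctx G K A C) {v1 s1 y k1 k2 v2 u2 w3 v3 u3 t1 a p o x1 z x2 : V} {Bs1 Bk1 Bu2 Bu3 : List V}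
    (hc : Cyc G.Adj [[v1], Bs1, Bk1, [v2], Bu2, [v3], Bu3].flatten) (hC : [[v1], Bs1, Bk1, [v2], Bu2, [v3], Bu3].flatten.Perm C)
    (es1 : Ends s1 y Bs1) (ek1 : Ends k1 k2 Bk1) (eu2 : Ends u2 w3 Bu2) (eu3 : Ends u3 t1 Bu3)
    (h0 : AllP A [v1, v2, v3])
    (h1 : AllNot A [s1, y, k1, k2, u2, w3, u3, t1, a, p, o])
    (h2 : List.IsChain (EE G) [v1, x1, z, x2, v2])
    (h3 : AllNot K [x1, z, x2])
    (h4 : AllNot K [s1, t1, a, p, o, y, u2, w3])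
    (h5 : NAdj G [x1, z, x2] [s1, y, k1, k2, u2, w3, u3, t1, a, p, o])
    (h6 : AdjImp' G A [x1, z, x2] [v3])
    (h7 : NAdj G [s1, t1, a, p, o, y] [u2, v2])
    (h8 : NAdj G [v1] [u2])
    (h9 : List.IsChain (EE G) [s1, t1])
    (h10 : List.IsChain (EE G) [v1, a, p, o, y])
    (h11 : AllP K [k1, k2, u3])
    (h12 : NAdj G [v1] [p, o, y])
    (h13 : NAdj G [a] [o, y])
    (h14 : NAdj G [p] [y]) : False :=
  runM_sound cx (fun i => [v1, s1, y, k1, k2, v2, u2, w3, v3, u3, t1, a, p, o, x1, z, x2].getD i v1) (bl := [(0, 0), (1, 2), (3, 4), (5, 5), (6, 7), (8, 8), (9, 10)])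
    (gs := [.a [0, 5, 8], .n [1, 2, 3, 4, 6, 7, 9, 10, 11, 12, 13], .e [0, 14, 15, 16, 5], .l [14, 15, 16], .l [1, 10, 11, 12, 13, 2, 6, 7], .x [14, 15, 16] [1, 2, 3, 4, 6, 7, 9, 10, 11, 12, 13], .rx [14, 15, 16] [8], .x [1, 10, 11, 12, 13, 2] [6, 5], .x [0] [6], .e [1, 10], .e [0, 11, 12, 13, 2], .k [3, 4, 9], .x [0] [12, 13, 2], .x [11] [13, 2], .x [12] [2]])
    (rows := rows_b4) (by decide +kernel)
    hc hC (.cons (Ends.single _) (.cons es1 (.cons ek1 (.cons (Ends.single _) (.cons eu2 (.cons (Ends.single _) (.cons eu3 (.nil)))))))) ⟨h0, h1, h2, h3, h4, h5, h6, h7, h8, h9, h10, h11, h12, h13, h14, trivial⟩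

def rows_li : List ℕ := [
  6444549125, 1180047509510, 5506151220228, 3467786157055544326, 4548375611398, 5506152268804, 6757604912007174,
  3222275077, 9014902279636998, 8803612364802, 11146514925574, 9676138147904444393592835, 13845203398322817030, 6445597701,
  15398545130502]

theorem model_li (cx : Ctx G K A C) {v1 s1 s2 v2 t2 t1 r x : V} {Bs1 Bt2 : List V}
    (hc : Cyc G.Adj [[v1], Bs1, [v2], Bt2].flatten) (hC : [[v1], Bs1, [v2], Bt2].flatten.Perm C)
    (es1 : Ends s1 s2 Bs1) (et2 : Ends t2 t1 Bt2)
    (h0 : AllP A [v1, v2])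
    (h1 : AllNot A [s1, s2, t2, t1, r])
    (h2 : NAdj G [x] [s1, s2, t2, t1, r])
    (h3 : List.IsChain (EE G) [v1, x, v2])
    (h4 : AllNot K [x, s1, t1, s2, r])
    (h5 : List.IsChain (EE G) [t1, r, v2])
    (h6 : List.IsChain (EE G) [s1, t1])
    (h7 : NAdj G [r] [v1])
    (h8 : NAdj G [t1] [v2]) : False :=
  runM_sound cx (fun i => [v1, s1, s2, v2, t2, t1, r, x].getD i v1) (bl := [(0, 0), (1, 2), (3, 3), (4, 5)])
    (gs := [.a [0, 3], .n [1, 2, 4, 5, 6], .x [7] [1, 2, 4, 5, 6], .e [0, 7, 3], .l [7, 1, 5, 2, 6], .e [5, 6, 3], .e [1, 5], .x [6] [0], .x [5] [3]])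
    (rows := rows_li) (by decide +kernel)
    hc hC (.cons (Ends.single _) (.cons es1 (.cons (Ends.single _) (.cons et2 (.nil))))) ⟨h0, h1, h2, h3, h4, h5, h6, h7, h8, trivial⟩

def rows_li2Q : List ℕ := [
  11002637717506, 1560943688803311320664220314125912036228900229141767174, 9902050253826, 4001974629758293800845065351035099142,
  9671017477, 5928133855238, 7517242373, 7710545283078, 11002634568706, 9978283821062, 5767994028524045316,
  12174090045446, 5773624630781674500, 14450422712326, 5773624629707932676, 16895250296473606, 5370807301, 19153572013803526,
  9666823173, 21407648160155654, 8593081349, 23661644849612806, 9665774597, 25375745771526, 5767997325982041092,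
  28832071494768003078, 5767997327053685764, 30425696506480646, 8595178501, 32679976659585030, 7518290949,
  34913974911764486, 11002635620354, 38211918189242092550, 5773624630782723076, 39432891466254342, 3222275077,
  41697885415278598, 37534793992198, 7519339525, 45079028630030342, 5773626826583704580, 47333238994110470,
  5773624621127435268, 49584761782405126, 5773627926095332356, 53041190052115253254, 5773624621126386692,
  55367298916054730758, 9669968901, 56342637267912710, 8592032773, 58596359079462918, 8590984197, 60852488220182534,
  5773618030500119556, 63085729484376070, 6445597701, 65365017084561414, 4895958437636665485821958, 8596228101,
  70381195064526243846, 8799315303426, 78056759463538095370909255686, 5369759749, 74971493376327682054, 2324656418719750,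
  8801463835650, 84254938678185786127353381894]

theorem model_li2Q (cx : Ctx G K A C) {v1 s1 s2 v2 t2 rm r rp t1 x : V} {Bs1 Bt2 Brp : List V}
    (hc : Cyc G.Adj [[v1], Bs1, [v2], Bt2, [r], Brp].flatten) (hC : [[v1], Bs1, [v2], Bt2, [r], Brp].flatten.Perm C)
    (es1 : Ends s1 s2 Bs1) (et2 : Ends t2 rm Bt2) (erp : Ends rp t1 Brp)
    (h0 : AllP A [v1, v2])
    (h1 : AllNot A [s1, s2, t2, t1, r])
    (h2 : NAdj G [x] [s1, s2, t2, t1, r])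
    (h3 : List.IsChain (EE G) [v1, x, v2])
    (h4 : AllNot K [x, s1, t1, s2, r])
    (h5 : List.IsChain (EE G) [t1, r, v2])
    (h6 : List.IsChain (EE G) [s1, t1])
    (h7 : List.IsChain (EE G) [r, v1])
    (h8 : AdjImp' G A [x] [rm, rp]) : False :=
  runM_sound cx (fun i => [v1, s1, s2, v2, t2, rm, r, rp, t1, x].getD i v1) (bl := [(0, 0), (1, 2), (3, 3), (4, 5), (6, 6), (7, 8)])
    (gs := [.a [0, 3], .n [1, 2, 4, 8, 6], .x [9] [1, 2, 4, 8, 6], .e [0, 9, 3], .l [9, 1, 8, 2, 6], .e [8, 6, 3], .e [1, 8], .e [6, 0], .rx [9] [5, 7]])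
    (rows := rows_li2Q) (by decide +kernel)
    hc hC (.cons (Ends.single _) (.cons es1 (.cons (Ends.single _) (.cons et2 (.cons (Ends.single _) (.cons erp (.nil))))))) ⟨h0, h1, h2, h3, h4, h5, h6, h7, h8, trivial⟩

def rows_li2t2 : List ℕ := [
  5369758725, 1109180549126, 5500786705412, 3379980353406982, 6444549125, 5372904454]

theorem model_li2t2 (cx : Ctx G K A C) {v1 s1 s2 v2 r t1 x : V} {Bs1 Br : List V}
    (hc : Cyc G.Adj [[v1], Bs1, [v2], Br].flatten) (hC : [[v1], Bs1, [v2], Br].flatten.Perm C)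
    (es1 : Ends s1 s2 Bs1) (er : Ends r t1 Br)
    (h0 : AllP A [v1, v2])
    (h1 : AllNot A [s1, s2, r, t1])
    (h2 : NAdj G [x] [s1, s2, r, t1])
    (h3 : List.IsChain (EE G) [v1, x, v2])
    (h4 : AllNot K [x, s1, t1, s2, r])
    (h5 : List.IsChain (EE G) [v1, r, v2])
    (h6 : List.IsChain (EE G) [s1, t1]) : False :=
  runM_sound cx (fun i => [v1, s1, s2, v2, r, t1, x].getD i v1) (bl := [(0, 0), (1, 2), (3, 3), (4, 5)])
    (gs := [.a [0, 3], .n [1, 2, 4, 5], .x [6] [1, 2, 4, 5], .e [0, 6, 3], .l [6, 1, 5, 2, 4], .e [0, 4, 3], .e [1, 5]])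
    (rows := rows_li2t2) (by decide +kernel)
    hc hC (.cons (Ends.single _) (.cons es1 (.cons (Ends.single _) (.cons er (.nil))))) ⟨h0, h1, h2, h3, h4, h5, h6, trivial⟩

def rows_li2t1 : List ℕ := [
  5506151220228, 1249840728070, 6445597701, 3380049068689414, 7703026995202, 5372904454]

theorem model_li2t1 (cx : Ctx G K A C) {v1 s1 s2 v2 t2 r x : V} {Bs1 Bt2 : List V}
    (hc : Cyc G.Adj [[v1], Bs1, [v2], Bt2].flatten) (hC : [[v1], Bs1, [v2], Bt2].flatten.Perm C)
    (es1 : Ends s1 s2 Bs1) (et2 : Ends t2 r Bt2)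
    (h0 : AllP A [v1, v2])
    (h1 : AllNot A [s1, s2, t2, r])
    (h2 : NAdj G [x] [s1, s2, t2, r])
    (h3 : List.IsChain (EE G) [v1, x, v2])
    (h4 : AllNot K [x, s1, s2, r])
    (h5 : List.IsChain (EE G) [v1, r, v2])
    (h6 : List.IsChain (EE G) [s1, r]) : False :=
  runM_sound cx (fun i => [v1, s1, s2, v2, t2, r, x].getD i v1) (bl := [(0, 0), (1, 2), (3, 3), (4, 5)])
    (gs := [.a [0, 3], .n [1, 2, 4, 5], .x [6] [1, 2, 4, 5], .e [0, 6, 3], .l [6, 1, 2, 5], .e [0, 5, 3], .e [1, 5]])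
    (rows := rows_li2t1) (by decide +kernel)
    hc hC (.cons (Ends.single _) (.cons es1 (.cons (Ends.single _) (.cons et2 (.nil))))) ⟨h0, h1, h2, h3, h4, h5, h6, trivial⟩

def rows_lt : List ℕ := [
  8802538622978, 1248762791942, 6445597701, 3380047999141894, 5506151220228, 5372904454]

theorem model_lt (cx : Ctx G K A C) {v1 s1 s2 v2 t2 t1 x1 x2 : V} {Bs1 Bt2 : List V}
    (hc : Cyc G.Adj [[v1], Bs1, [v2], Bt2].flatten) (hC : [[v1], Bs1, [v2], Bt2].flatten.Perm C)
    (es1 : Ends s1 s2 Bs1) (et2 : Ends t2 t1 Bt2)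
    (h0 : AllP A [v1, v2])
    (h1 : AllNot A [s1, s2, t2, t1])
    (h2 : NAdj G [x1, x2] [s1, s2, t2, t1])
    (h3 : List.IsChain (EE G) [v1, x1, x2, v2])
    (h4 : AllNot K [x1, x2, s1, t1, s2])
    (h5 : List.IsChain (EE G) [t1, v2])
    (h6 : List.IsChain (EE G) [s1, t1]) : False :=
  runM_sound cx (fun i => [v1, s1, s2, v2, t2, t1, x1, x2].getD i v1) (bl := [(0, 0), (1, 2), (3, 3), (4, 5)])
    (gs := [.a [0, 3], .n [1, 2, 4, 5], .x [6, 7] [1, 2, 4, 5], .e [0, 6, 7, 3], .l [6, 7, 1, 5, 2], .e [5, 3], .e [1, 5]])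
    (rows := rows_lt) (by decide +kernel)
    hc hC (.cons (Ends.single _) (.cons es1 (.cons (Ends.single _) (.cons et2 (.nil))))) ⟨h0, h1, h2, h3, h4, h5, h6, trivial⟩

def rows_ac1 : List ℕ := [
  14306546557954, 1569923169135562926306498635332396604088814481633715206, 13199511394306, 4017551114299382017462325045112084486,
  13205955942402, 7000300842620486650065747416785111634418694, 14306539209730, 8904513839102976651512616326150,
  14517748996149265901295619, 13187771495421825196905970019452081844381323108358, 14306541312002,
  14653971229007916205706862328602957830, 4545150191622, 5371855877, 15777039454832646, 13205955937282,
  19669838170465202533830662, 12105370579970, 25297955061655560543441064921652765643512838, 13205953840130, 23226190301391490054,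
  13204879049730, 26599920276128348794523654, 23249732765702, 11814306821, 28174045942908934, 8275682960361163592708,
  30415798762735622, 14517749001778774025443331, 40542605014041027404044173426994703145901062, 20481, 34933915366983686,
  11813258245, 36375157016582, 12996892008233127904260, 40354518844904049670, 14306547598338, 42830360583141854214,
  8275682960365457507332, 43179458955270, 8275682960366531249156, 46178618640959494, 12996892008244927529988,
  48442510935066630, 13002653239160244012036, 50702896388376582, 39672618158086, 11815355397, 54089604798613510, 10741613573,
  56343601488070662, 8590985221, 58597374847617030, 13002649859259351702532, 60815310987462662, 8594130949,
  63110876522088454, 10999412296706, 75360626205620037349259053158633478, 8960376571910, 41945726453766, 2294588377094,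
  13205954888706, 74443024713641182103558, 10739516421, 73235261186639878, 25968287100700678, 68094500192035801094,
  13204880103426, 77762225436100614, 36341049735216998674073606, 13589165930186758, 11816403973, 82234972165900294,
  6837130522265606, 19221673015248902, 14517749001778771877959683, 93170007949543131989411846, 12169615686816442400901126,
  23041678226070843811693574]

theorem model_ac1 (cx : Ctx G K A C) {v1 s1 q qp w2 v2 u2 w3 v3 u3 t1 x p : V} {Bs1 Bqp Bu2 Bu3 : List V}
    (hc : Cyc G.Adj [[v1], Bs1, Bqp, [v2], Bu2, [v3], Bu3].flatten) (hC : [[v1], Bs1, Bqp, [v2], Bu2, [v3], Bu3].flatten.Perm C)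
    (es1 : Ends s1 q Bs1) (eqp : Ends qp w2 Bqp) (eu2 : Ends u2 w3 Bu2) (eu3 : Ends u3 t1 Bu3)
    (h0 : AllP A [v1, v2, v3])
    (h1 : AllNot A [s1, q, w2, u2, w3, u3, t1, p])
    (h2 : NAdj G [x] [s1, q, w2, u2, w3, u3, t1, p])
    (h3 : AdjImp' G A [x] [qp])
    (h4 : AllNot K [x, s1, t1, q, w2, u3])
    (h5 : List.IsChain (EE G) [v1, x, v2])
    (h6 : List.IsChain (EE G) [s1, t1])
    (h7 : List.IsChain (EE G) [v1, q, v2])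
    (h8 : AllNot K [p])
    (h9 : List.IsChain (EE G) [v1, p, v3])
    (h10 : List.IsChain (EE G) [x, v3])
    (h11 : AllP K [u2, w3]) : False :=
  runM_sound cx (fun i => [v1, s1, q, qp, w2, v2, u2, w3, v3, u3, t1, x, p].getD i v1) (bl := [(0, 0), (1, 2), (3, 4), (5, 5), (6, 7), (8, 8), (9, 10)])
    (gs := [.a [0, 5, 8], .n [1, 2, 4, 6, 7, 9, 10, 12], .x [11] [1, 2, 4, 6, 7, 9, 10, 12], .rx [11] [3], .l [11, 1, 10, 2, 4, 9], .e [0, 11, 5], .e [1, 10], .e [0, 2, 5], .l [12], .e [0, 12, 8], .e [11, 8], .k [6, 7]])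
    (rows := rows_ac1) (by decide +kernel)
    hc hC (.cons (Ends.single _) (.cons es1 (.cons eqp (.cons (Ends.single _) (.cons eu2 (.cons (Ends.single _) (.cons eu3 (.nil)))))))) ⟨h0, h1, h2, h3, h4, h5, h6, h7, h8, h9, h10, h11, trivial⟩

def rows_ac2 : List ℕ := [
  11004783100930, 1255205242886, 9666823173, 3380054441592838, 5773624630781674500, 5372904454]

theorem model_ac2 (cx : Ctx G K A C) {v1 s1 q v2 u2 w3 v3 u3 t1 x p : V} {Bs1 Bu2 Bu3 : List V}
    (hc : Cyc G.Adj [[v1], Bs1, [v2], Bu2, [v3], Bu3].flatten) (hC : [[v1], Bs1, [v2], Bu2, [v3], Bu3].flatten.Perm C)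
    (es1 : Ends s1 q Bs1) (eu2 : Ends u2 w3 Bu2) (eu3 : Ends u3 t1 Bu3)
    (h0 : AllP A [v1, v2, v3])
    (h1 : AllNot A [s1, q, u2, w3, u3, t1, p])
    (h2 : NAdj G [x] [s1, q, u2, w3, u3, t1, p])
    (h3 : AllNot K [x, s1, t1, q, u3])
    (h4 : List.IsChain (EE G) [v1, x, v2])
    (h5 : List.IsChain (EE G) [s1, t1])
    (h6 : List.IsChain (EE G) [v1, q, v2])
    (h7 : AllNot K [p])
    (h8 : List.IsChain (EE G) [v1, p, v3])
    (h9 : List.IsChain (EE G) [x, v3])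
    (h10 : AllP K [u2, w3]) : False :=
  runM_sound cx (fun i => [v1, s1, q, v2, u2, w3, v3, u3, t1, x, p].getD i v1) (bl := [(0, 0), (1, 2), (3, 3), (4, 5), (6, 6), (7, 8)])
    (gs := [.a [0, 3, 6], .n [1, 2, 4, 5, 7, 8, 10], .x [9] [1, 2, 4, 5, 7, 8, 10], .l [9, 1, 8, 2, 7], .e [0, 9, 3], .e [1, 8], .e [0, 2, 3], .l [10], .e [0, 10, 6], .e [9, 6], .k [4, 5]])
    (rows := rows_ac2) (by decide +kernel)
    hc hC (.cons (Ends.single _) (.cons es1 (.cons (Ends.single _) (.cons eu2 (.cons (Ends.single _) (.cons eu3 (.nil))))))) ⟨h0, h1, h2, h3, h4, h5, h6, h7, h8, h9, h10, trivial⟩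

def rows_bc1 : List ℕ := [
  5906424760407167075332, 1211302294834177901596678, 13205956985858, 3628777964924046342, 13200587231234, 5784248256518,
  13200584082434, 8168405004186553350, 8876624709638, 6444549125, 11268975208957958, 5906425886307073917956,
  13837324228209150982, 4764193523718, 11817452549, 16904257916635142, 13199510340610, 19681857381766007814, 2264184357128198,
  14373113300998, 7521436677, 23665078675965958, 5370807301, 25917767547881478, 20292597340702726, 10740566021,
  28745147615238, 5912196124426994975748, 31542942054221830, 7519340549, 33808898084308998, 11813258245, 35275645388806,
  12996892008233126855684, 38316902196447238, 10738468869, 40570881710229510, 7701951158274, 47079227733414091082546808838,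
  7517242373, 45078891191076870, 12996885251745979044868, 47305417307456518]

theorem model_bc1 (cx : Ctx G K A C) {v1 s1 w2 v2 u2 q qp w3 v3 u3 t1 x : V} {Bs1 Bu2 Bqp Bu3 : List V}
    (hc : Cyc G.Adj [[v1], Bs1, [v2], Bu2, Bqp, [v3], Bu3].flatten) (hC : [[v1], Bs1, [v2], Bu2, Bqp, [v3], Bu3].flatten.Perm C)
    (es1 : Ends s1 w2 Bs1) (eu2 : Ends u2 q Bu2) (eqp : Ends qp w3 Bqp) (eu3 : Ends u3 t1 Bu3)
    (h0 : AllP A [v1, v2, v3])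
    (h1 : AllNot A [s1, w2, u2, q, w3, u3, t1])
    (h2 : NAdj G [x] [s1, w2, u2, q, w3, u3, t1])
    (h3 : AdjImp' G A [x] [qp, v3])
    (h4 : AllNot K [x, s1, t1, q, u2, w3])
    (h5 : List.IsChain (EE G) [v1, x, v2])
    (h6 : List.IsChain (EE G) [s1, t1])
    (h7 : List.IsChain (EE G) [v1, q, v2])
    (h8 : AllP K [w2, u3]) : False :=
  runM_sound cx (fun i => [v1, s1, w2, v2, u2, q, qp, w3, v3, u3, t1, x].getD i v1) (bl := [(0, 0), (1, 2), (3, 3), (4, 5), (6, 7), (8, 8), (9, 10)])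
    (gs := [.a [0, 3, 8], .n [1, 2, 4, 5, 7, 9, 10], .x [11] [1, 2, 4, 5, 7, 9, 10], .rx [11] [6, 8], .l [11, 1, 10, 5, 4, 7], .e [0, 11, 3], .e [1, 10], .e [0, 5, 3], .k [2, 9]])
    (rows := rows_bc1) (by decide +kernel)
    hc hC (.cons (Ends.single _) (.cons es1 (.cons (Ends.single _) (.cons eu2 (.cons eqp (.cons (Ends.single _) (.cons eu3 (.nil)))))))) ⟨h0, h1, h2, h3, h4, h5, h6, h7, h8, trivial⟩

def rows_bc2 : List ℕ := [
  11004786246658, 1461363673094, 9669968901, 3380260600023046, 10389812042296984580, 5372904454]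

theorem model_bc2 (cx : Ctx G K A C) {v1 s1 w2 v2 u2 q v3 u3 t1 x : V} {Bs1 Bu2 Bu3 : List V}
    (hc : Cyc G.Adj [[v1], Bs1, [v2], Bu2, [v3], Bu3].flatten) (hC : [[v1], Bs1, [v2], Bu2, [v3], Bu3].flatten.Perm C)
    (es1 : Ends s1 w2 Bs1) (eu2 : Ends u2 q Bu2) (eu3 : Ends u3 t1 Bu3)
    (h0 : AllP A [v1, v2, v3])
    (h1 : AllNot A [s1, w2, u2, q, u3, t1])
    (h2 : NAdj G [x] [s1, w2, u2, q, u3, t1])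
    (h3 : AdjImp' G A [x] [v3])
    (h4 : AllNot K [x, s1, t1, q, u2])
    (h5 : List.IsChain (EE G) [v1, x, v2])
    (h6 : List.IsChain (EE G) [s1, t1])
    (h7 : List.IsChain (EE G) [v1, q, v2])
    (h8 : AllP K [w2, u3]) : False :=
  runM_sound cx (fun i => [v1, s1, w2, v2, u2, q, v3, u3, t1, x].getD i v1) (bl := [(0, 0), (1, 2), (3, 3), (4, 5), (6, 6), (7, 8)])
    (gs := [.a [0, 3, 6], .n [1, 2, 4, 5, 7, 8], .x [9] [1, 2, 4, 5, 7, 8], .rx [9] [6], .l [9, 1, 8, 5, 4], .e [0, 9, 3], .e [1, 8], .e [0, 5, 3], .k [2, 7]])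
    (rows := rows_bc2) (by decide +kernel)
    hc hC (.cons (Ends.single _) (.cons es1 (.cons (Ends.single _) (.cons eu2 (.cons (Ends.single _) (.cons eu3 (.nil))))))) ⟨h0, h1, h2, h3, h4, h5, h6, h7, h8, trivial⟩

def rows_bc3 : List ℕ := [
  11813258245, 1190784927750, 10741613573, 3525099653126, 13204882198530, 5786009812148947974, 5906425885208636032004,
  7776043534342, 5370807301, 10141974712551430, 8593082373, 12248178231302, 10633407425187547190276, 14992496647866419206,
  9668920325, 16904185971738630, 9900975466498, 22617657813339898276935669601759400966, 10738467845, 20911127267334,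
  5912191621920447267844, 24213625543561578502, 9666824197, 25919906449983494, 13204879049730, 28844439698127457286,
  6892349818886, 28676423944198, 10742662149, 32681079396632582, 21278349719194752256006, 5906429262902987850756,
  36061870419871750, 9665774597, 37418861331462]

theorem model_bc3 (cx : Ctx G K A C) {v1 s1 w2 v2 u2 w3 v3 u3 qm q t1 x : V} {Bs1 Bu2 Bu3 Bq : List V}
    (hc : Cyc G.Adj [[v1], Bs1, [v2], Bu2, [v3], Bu3, Bq].flatten) (hC : [[v1], Bs1, [v2], Bu2, [v3], Bu3, Bq].flatten.Perm C)
    (es1 : Ends s1 w2 Bs1) (eu2 : Ends u2 w3 Bu2) (eu3 : Ends u3 qm Bu3) (eq : Ends q t1 Bq)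
    (h0 : AllP A [v1, v2, v3])
    (h1 : AllNot A [s1, w2, u2, w3, u3, q, t1])
    (h2 : NAdj G [x] [s1, w2, u2, w3, u3, q, t1])
    (h3 : AdjImp' G A [x] [qm, v3])
    (h4 : AllNot K [x, s1, t1, q, u2, w3])
    (h5 : List.IsChain (EE G) [v1, x, v2])
    (h6 : List.IsChain (EE G) [s1, t1])
    (h7 : List.IsChain (EE G) [v1, q, v2])
    (h8 : AllP K [w2, u3]) : False :=
  runM_sound cx (fun i => [v1, s1, w2, v2, u2, w3, v3, u3, qm, q, t1, x].getD i v1) (bl := [(0, 0), (1, 2), (3, 3), (4, 5), (6, 6), (7, 8), (9, 10)])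
    (gs := [.a [0, 3, 6], .n [1, 2, 4, 5, 7, 9, 10], .x [11] [1, 2, 4, 5, 7, 9, 10], .rx [11] [8, 6], .l [11, 1, 10, 9, 4, 5], .e [0, 11, 3], .e [1, 10], .e [0, 9, 3], .k [2, 7]])
    (rows := rows_bc3) (by decide +kernel)
    hc hC (.cons (Ends.single _) (.cons es1 (.cons (Ends.single _) (.cons eu2 (.cons (Ends.single _) (.cons eu3 (.cons eq (.nil)))))))) ⟨h0, h1, h2, h3, h4, h5, h6, h7, h8, trivial⟩

end HamADH

open SimpleGraph
namespace HamADH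
variable {V : Type*} {G : SimpleGraph V} {K A : V → Prop} {C : List V}

@[simp] theorem allP_nil {P : V → Prop} : AllP P [] ↔ True := by simp [AllP]
@[simp] theorem allP_cons {P : V → Prop} {a : V} {l : List V} : AllP P (a :: l) ↔ P a ∧ AllP P l := by simp [AllP]
@[simp] theorem allNot_nil {P : V → Prop} : AllNot P [] ↔ True := by simp [AllNot]
@[simp] theorem allNot_cons {P : V → Prop} {a : V} {l : List V} :
    AllNot P (a :: l) ↔ ¬ P a ∧ AllNot P l := by simp [AllNot]
theorem nAdj_iff {X Y : List V} : NAdj G X Y ↔ ∀ a ∈ X, ∀ b ∈ Y, ¬ EE G a b := Iff.rfl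
theorem EE.refl (a : V) : EE G a a := Or.inl rfl
theorem EE.of {a b : V} (h : G.Adj a b) : EE G a b := Or.inr h

/-- A walk of length exactly `n` from `a` to `b`, all vertices but the first in `S`. -/
def Wk (G : SimpleGraph V) (S : V → Prop) : ℕ → V → V → Prop
  | 0, a, b => a = b
  | n + 1, a, b => ∃ c, G.Adj a c ∧ S c ∧ Wk G S n c b

theorem Wk.mono {S T : V → Prop} (h : ∀ v, S v → T v) {n : ℕ} {a b : V} (w : Wk G S n a b) : Wk G T n a b := by
  induction n generalizing a with
  | zero => exact w
  | succ n ih => obtain ⟨c, h1, h2, h3⟩ := w; exact ⟨c, h1, h _ h2, ih h3⟩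

theorem Wk.trans {S : V → Prop} {n m : ℕ} {a b c : V} (w : Wk G S n a b) (w' : Wk G S m b c) :
    Wk G S (n + m) a c := by
  induction n generalizing a with
  | zero => obtain rfl : a = b := w; simpa using w'
  | succ n ih =>
    obtain ⟨d, h1, h2, h3⟩ := w
    rw [Nat.add_right_comm]
    exact ⟨d, h1, h2, ih h3⟩

theorem Wk.one {S : V → Prop} {a b : V} (h : G.Adj a b) (hb : S b) : Wk G S 1 a b := ⟨b, h, hb, rfl⟩

theorem Wk.symm {S : V → Prop} {n : ℕ} {a b : V} (w : Wk G S n a b) (ha : S a) : Wk G S n b a := by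
  induction n generalizing a with
  | zero => obtain rfl : a = b := w; rfl
  | succ n ih =>
    obtain ⟨c, h1, h2, h3⟩ := w
    exact (ih h3 h2).trans (Wk.one h1.symm ha)

theorem Wk.mem {S : V → Prop} {n : ℕ} {a b : V} (w : Wk G S n a b) (ha : S a) : S b := by
  induction n generalizing a with
  | zero => obtain rfl : a = b := w; exact ha
  | succ n ih => obtain ⟨c, h1, h2, h3⟩ := w; exact ih h3 h2

theorem Wk.erase {S : V → Prop} {n : ℕ} {a b c : V} (w : Wk G S n c b) :
    (∃ m ≤ n, Wk G (fun v => S v ∧ v ≠ a) m c b) ∨ (∃ m ≤ n, Wk G (fun v => S v ∧ v ≠ a) m a b) := by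
  induction n generalizing c with
  | zero => exact .inl ⟨0, le_rfl, w⟩
  | succ n ih =>
    obtain ⟨c', h1, h2, h3⟩ := w
    rcases ih h3 with ⟨m, hm, h⟩ | ⟨m, hm, h⟩
    · by_cases hc : c' = a
      · subst hc; exact .inr ⟨m, by omega, h⟩
      · exact .inl ⟨m + 1, by omega, c', h1, ⟨h2, hc⟩, h⟩
    · exact .inr ⟨m, by omega, h⟩

theorem Wk.loopErase {S : V → Prop} {n : ℕ} {a b : V} (w : Wk G S n a b) :
    ∃ m ≤ n, Wk G (fun v => S v ∧ v ≠ a) m a b := by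
  rcases w.erase (a := a) with h | h <;> exact h

/-- Leaving `X` through `v`. -/
theorem Wk.cut {S X : V → Prop} {v : V} (hX : ∀ a b, X a → S b → G.Adj a b → X b ∨ b = v) {n : ℕ} {a b : V}
    (w : Wk G S n a b) (ha : X a) (hb : ¬ X b) :
    ∃ r m a', r + 1 + m = n ∧ Wk G X r a a' ∧ X a' ∧ G.Adj a' v ∧ Wk G S m v b := by
  induction n generalizing a with
  | zero => obtain rfl : a = b := w; exact absurd ha hb
  | succ n ih =>
    obtain ⟨c, h1, h2, h3⟩ := w
    by_cases hc : X c
    · obtain ⟨r, m, a', e, w1, xa, h, w2⟩ := ih h3 hc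
      exact ⟨r + 1, m, a', by omega, ⟨c, h1, hc, w1⟩, xa, h, w2⟩
    · rcases hX a c ha h2 h1 with h | rfl
      · exact absurd h hc
      · exact ⟨0, n, a, by omega, rfl, ha, h1, h3⟩

/-- `S` induces a connected subgraph. -/
def Conn (G : SimpleGraph V) (S : V → Prop) : Prop := ∀ a b, S a → S b → ∃ n, Wk G S n a b

theorem Conn.single (v : V) : Conn G (fun u => u = v) := by
  rintro a b rfl rfl; exact ⟨0, rfl⟩

theorem Conn.union {S T : V → Prop} (hS : Conn G S) (hT : Conn G T) {p q : V} (hp : S p) (hq : T q)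
    (h : G.Adj p q) : Conn G (fun v => S v ∨ T v) := by
  have key : ∀ a b, S a → T b → ∃ n, Wk G (fun v => S v ∨ T v) n a b := by
    intro a b ha hb
    obtain ⟨n, w⟩ := hS a p ha hp
    obtain ⟨m, w'⟩ := hT q b hq hb
    exact ⟨_, ((w.mono fun _ => Or.inl).trans (Wk.one h (Or.inr hq))).trans (w'.mono fun _ => Or.inr)⟩
  rintro a b (ha | ha) (hb | hb)
  · obtain ⟨n, w⟩ := hS a b ha hb; exact ⟨n, w.mono fun _ => Or.inl⟩
  · exact key a b ha hb
  · obtain ⟨n, w⟩ := key b a hb ha; exact ⟨n, w.symm (Or.inl hb)⟩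
  · obtain ⟨n, w⟩ := hT a b ha hb; exact ⟨n, w.mono fun _ => Or.inr⟩

/-- The component of `a` in the graph induced by `L`. -/
def Comp (G : SimpleGraph V) (L : V → Prop) (a v : V) : Prop := L a ∧ ∃ n, Wk G L n a v

theorem Comp.self {L : V → Prop} {a : V} (h : L a) : Comp G L a a := ⟨h, 0, rfl⟩
theorem Comp.mem {L : V → Prop} {a v : V} (h : Comp G L a v) : L v := by
  obtain ⟨h, n, w⟩ := h; exact w.mem h
theorem Comp.step {L : V → Prop} {a v w : V} (h : Comp G L a v) (hw : L w) (e : EE G v w) : Comp G L a w := by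
  rcases e with rfl | e
  · exact h
  · obtain ⟨h, n, w⟩ := h; exact ⟨h, n + 1, w.trans (Wk.one e hw)⟩
theorem Comp.symm {L : V → Prop} {a v : V} (h : Comp G L a v) : Comp G L v a := by
  have := h.mem
  obtain ⟨h, n, w⟩ := h; exact ⟨this, n, w.symm h⟩
theorem Comp.trans {L : V → Prop} {a b c : V} (h : Comp G L a b) (h' : Comp G L b c) : Comp G L a c := by
  obtain ⟨h, n, w⟩ := h; obtain ⟨_, m, w'⟩ := h'; exact ⟨h, n + m, w.trans w'⟩
theorem Comp.wk {L : V → Prop} {o : V} : ∀ {n : ℕ} {a b : V}, Comp G L o a → Wk G L n a b → Wk G (Comp G L o) n a b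
  | 0, _, _, _, w => w
  | _ + 1, _, _, h, ⟨c, h1, h2, h3⟩ =>
    ⟨c, h1, h.step h2 (.of h1), Comp.wk (h.step h2 (.of h1)) h3⟩
theorem Comp.conn {L : V → Prop} {o : V} : Conn G (Comp G L o) := by
  intro a b ha hb
  obtain ⟨_, n, w⟩ := ha.symm.trans hb
  exact ⟨n, Comp.wk ha w⟩

/-- Attached vertices. -/
def Att (G : SimpleGraph V) (R : V → Prop) (v : V) : Prop := ¬ R v ∧ ∃ x, R x ∧ G.Adj x v
/-- Light unattached vertices outside `R`. -/
def Lt (G : SimpleGraph V) (K R : V → Prop) (v : V) : Prop := ¬ K v ∧ ¬ R v ∧ ¬ Att G R v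

structure Env (G : SimpleGraph V) (K R : V → Prop) (C : List V) : Prop where
  claw : ∀ a x y z, EE G a x → EE G a y → EE G a z → ¬ EE G x y → ¬ EE G x z → ¬ EE G y z →
    ¬ K x → ¬ K y → ¬ K z → False
  adhset : ∀ (H : V → Prop), Conn G H → ∀ a b d, H a → H b → Near G d a b → ∃ m ≤ d + 1, Wk G H m a b
  heavy : ∀ a b, K a → K b → Near G 2 a b
  Rl : ∀ x, R x → ¬ K x
  RC : ∀ x, R x → x ∉ C
  Rcl : ∀ x y, R x → G.Adj x y → R y ∨ y ∈ C
  Rconn : Conn G R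
  KC : ∀ v, K v → v ∈ C
  nodup : C.Nodup
  len : 3 ≤ C.length
  noHam : ∀ (P : List V) (a b : V), P.Perm C → P.IsChain (FF G K) → P.head? = some a →
    P.getLast? = some b → Att G R a → Att G R b → False
  noIns : ∀ (P : List V) (a b r : V), P.Perm C → P.IsChain (FF G K) → P.head? = some a →
    P.getLast? = some b → r ∉ C → G.Adj r a → G.Adj r b → False
  third : ∀ x y, ∃ v, v ≠ x ∧ v ≠ y ∧ Att G R v
  common3 : ∀ a b x, K a → K b → ¬ EE G a b → R x → ¬ EE G x a → ¬ EE G x b → ∀ c1 c2, ∃ g, g ≠ c1 ∧ g ≠ c2 ∧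
    G.Adj a g ∧ G.Adj b g

section
variable {R : V → Prop}

theorem Env.ctx (E : Env G K R C) : Ctx G K (Att G R) C where
  claw := E.claw
  heavy := E.heavy
  noHam := E.noHam
  adh := by
    intro p L d hL hs hn hN
    have wk : ∀ j ≤ L, ∃ n, Wk G (fun v => ∃ i ≤ L, v = p i) n (p 0) (p j) := by
      intro j
      induction j with
      | zero => intro _; exact ⟨0, rfl⟩
      | succ j ih =>
        intro hj
        obtain ⟨n, w⟩ := ih (by omega)
        rcases hs j (by omega) with h | h
        · exact ⟨n, h ▸ w⟩
        · exact ⟨n + 1, w.trans (Wk.one h ⟨j + 1, hj, rfl⟩)⟩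
    have hc : Conn G (fun v => ∃ i ≤ L, v = p i) := by
      rintro _ _ ⟨i, hi, rfl⟩ ⟨j, hj, rfl⟩
      obtain ⟨n, w⟩ := wk i hi
      obtain ⟨m, w'⟩ := wk j hj
      exact ⟨_, (w.symm ⟨0, by omega, rfl⟩).trans w'⟩
    obtain ⟨m, hm, w⟩ := E.adhset _ hc (p 0) (p L) d ⟨0, by omega, rfl⟩ ⟨L, le_rfl, rfl⟩ hN
    have key : ∀ m i b, i ≤ L → Wk G (fun v => ∃ i ≤ L, v = p i) m (p i) b → ∃ j ≤ i + m, j ≤ L ∧ b = p j := by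
      intro m
      induction m with
      | zero => intro i b hi w; exact ⟨i, le_rfl, hi, Eq.symm w⟩
      | succ m ih =>
        rintro i b hi ⟨_, h1, ⟨j, hj, rfl⟩, w⟩
        have : j ≤ i + 1 := by
          by_contra h
          exact hn i j (by omega) hj (.inr h1)
        obtain ⟨k, h2, h3, h4⟩ := ih j b hj w
        exact ⟨k, by omega, h3, h4⟩
    obtain ⟨j, h1, h2, h3⟩ := key m 0 _ (by omega) w
    by_cases hj : j + 1 < L
    · exact hn j L hj le_rfl (.inl h3.symm)
    · have hj : j = L - 1 := by omega
      subst hj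
      refine hn (L - 2) L (by omega) le_rfl ?_
      have := hs (L - 2) (by omega)
      rwa [show L - 2 + 1 = L - 1 by omega, ← h3] at this

theorem Env.attC (E : Env G K R C) {v : V} (h : Att G R v) : v ∈ C := by
  obtain ⟨h, x, hx, e⟩ := h
  exact (E.Rcl x v hx e).resolve_left h
theorem Env.natt {x v : V} (hx : R x) (h1 : ¬ R v) (h : ¬ Att G R v) : ¬ EE G x v := by
  rintro (rfl | e)
  · exact h1 hx
  · exact h ⟨h1, x, hx, e⟩
theorem Env.nR (E : Env G K R C) {v : V} (h : v ∈ C) : ¬ R v := fun hr => E.RC v hr h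
theorem Env.clq (E : Env G K R C) {v a b : V} (h : Att G R v) (ha : Lt G K R a) (hb : Lt G K R b) (e : EE G v a) (e' : EE G v b) :
    EE G a b := by
  obtain ⟨h, x, hx, ex⟩ := h
  by_contra hn
  exact E.claw v x a b (.of ex.symm) e e' (Env.natt hx ha.2.1 ha.2.2) (Env.natt hx hb.2.1 hb.2.2) hn
    (E.Rl x hx) ha.1 hb.1
end

/-! ### cyclic lists -/
theorem cyc_iff {r : V → V → Prop} {a : V} {l : List V} : Cyc r (a :: l) ↔ (a :: l ++ [a]).IsChain r := by
  rw [List.isChain_append]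
  simp [Cyc]

theorem Cyc.rot {r : V → V → Prop} {l m : List V} (h : Cyc r (l ++ m)) : Cyc r (m ++ l) := by
  rcases l with _ | ⟨a, l⟩
  · simpa using h
  rcases m with _ | ⟨b, m⟩
  · simpa using h
  rw [List.cons_append, cyc_iff] at *
  have e1 : (a :: (l ++ b :: m)) ++ [a] = (a :: l) ++ (b :: m ++ [a]) := by simp
  have e2 : (b :: (m ++ a :: l)) ++ [b] = (b :: m) ++ (a :: l ++ [b]) := by simp
  rw [e1] at h
  rw [e2]
  rw [List.isChain_append, List.isChain_append] at *
  obtain ⟨h1, ⟨h2, -, h3⟩, h4⟩ := h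
  refine ⟨h2, ⟨h1, by simp, ?_⟩, ?_⟩
  · intro x hx y hy
    simp at hy; subst hy
    exact h4 x hx _ (by simp)
  · intro x hx y hy
    simp at hy; subst hy
    exact h3 x hx _ (by simp)

theorem Cyc.rev {r : V → V → Prop} (hr : ∀ a b, r a b → r b a) {l : List V} (h : Cyc r l) : Cyc r l.reverse := by
  refine ⟨?_, ?_⟩
  · rw [List.isChain_reverse]
    exact h.1.imp fun a b => hr a b
  · intro a ha b hb
    rw [List.getLast?_reverse] at ha
    rw [List.head?_reverse] at hb
    exact hr _ _ (h.2 b hb a ha)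

theorem Cyc.imp {r s : V → V → Prop} (hr : ∀ a b, r a b → s a b) {l : List V} (h : Cyc r l) : Cyc s l :=
  ⟨h.1.imp fun a b => hr a b, fun a ha b hb => hr _ _ (h.2 a ha b hb)⟩

theorem Cyc.revG {l : List V} (h : Cyc G.Adj l) : Cyc G.Adj l.reverse := h.rev fun _ _ e => e.symm
theorem Cyc.FF {l : List V} (h : Cyc G.Adj l) : Cyc (FF G K) l := h.imp fun _ _ e => .inl (.of e)

theorem Ends.rev {a b : V} {l : List V} (h : Ends a b l) : Ends b a l.reverse := by
  simpa [Ends] using And.symm h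
theorem Ends.ne {a b : V} {l : List V} (h : Ends a b l) : l ≠ [] := by rintro rfl; simp [Ends] at h
theorem Ends.head_mem {a b : V} {l : List V} (h : Ends a b l) : a ∈ l := List.mem_of_mem_head? h.1
theorem Ends.last_mem {a b : V} {l : List V} (h : Ends a b l) : b ∈ l := List.mem_of_mem_getLast? h.2
theorem ends_cons {a x b : V} {l : List V} (h : Ends a b (x :: l)) : a = x := by have := h.1; simp at this; exact this.symm
theorem exists_ends {l : List V} (h : l ≠ []) : ∃ a b, Ends a b l :=
  ⟨l.head h, l.getLast h, List.head?_eq_some_head h, List.getLast?_eq_some_getLast h⟩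

theorem split_last (p : V → Prop) {l : List V} (h : ∃ v ∈ l, p v) :
    ∃ l1 v l2, l = l1 ++ v :: l2 ∧ p v ∧ ∀ w ∈ l2, ¬ p w := by
  induction l with
  | nil => simp at h
  | cons a l ih =>
    by_cases h' : ∃ v ∈ l, p v
    · obtain ⟨l1, v, l2, rfl, h2, h3⟩ := ih h'
      exact ⟨a :: l1, v, l2, rfl, h2, h3⟩
    · obtain ⟨v, hv, hp⟩ := h
      rcases List.mem_cons.1 hv with rfl | hv
      · exact ⟨[], v, l, rfl, hp, fun w hw hpw => h' ⟨w, hw, hpw⟩⟩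
      · exact absurd ⟨v, hv, hp⟩ h'

theorem split_first (p : V → Prop) {l : List V} (h : ∃ v ∈ l, p v) :
    ∃ l1 v l2, l = l1 ++ v :: l2 ∧ p v ∧ ∀ w ∈ l1, ¬ p w := by
  obtain ⟨l1, v, l2, h1, h2, h3⟩ := split_last p (l := l.reverse) (by simpa using h)
  refine ⟨l2.reverse, v, l1.reverse, ?_, h2, by simpa using h3⟩
  have := congrArg List.reverse h1
  simpa using this
end HamADH

open SimpleGraph
namespace HamADH
variable {V : Type*} {G : SimpleGraph V} {K R : V → Prop} {C : List V}

theorem nAdjR (_ : Env G K R C) {X Y : List V} (hX : AllP R X) (hY : ∀ b ∈ Y, ¬ R b ∧ ¬ Att G R b) : NAdj G X Y :=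
  fun a ha b hb => Env.natt (hX a ha) (hY b hb).1 (hY b hb).2
theorem adjImpR (E : Env G K R C) {X Y : List V} (hX : AllP R X) (hY : ∀ b ∈ Y, b ∈ C) : AdjImp' G (Att G R) X Y := by
  rintro a ha b hb (rfl | e)
  · exact absurd (hY _ hb) (E.RC _ (hX _ ha))
  · exact ⟨E.nR (hY b hb), a, hX a ha, e⟩

/-- Two consecutive vertices of the cycle are not both attached. -/
theorem Env.nA2 (E : Env G K R C) {a b : V} {l : List V} (hc : Cyc G.Adj (a :: b :: l)) (hp : (a :: b :: l).Perm C)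
    (ha : Att G R a) : ¬ Att G R b := by
  intro hb
  have h := Cyc.rot (l := [a]) (m := b :: l) hc
  refine E.noHam (b :: l ++ [a]) b a (List.Perm.trans ?_ hp) (Cyc.FF h).1 (by simp) (by simp [List.getLast?_cons]) hb ha
  exact List.perm_append_comm

/-- The cycle is `v1 P v2 W`, and `v1` is an attachment whose neighbours on the cycle are light. -/
structure Base (G : SimpleGraph V) (K R : V → Prop) (C : List V) (v1 s1 s2 v2 t2 t1 : V) (P W : List V) : Prop where
  cyc : Cyc G.Adj (v1 :: (P ++ v2 :: W))
  perm : (v1 :: (P ++ v2 :: W)).Perm C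
  eP : Ends s1 s2 P
  eW : Ends t2 t1 W
  a1 : Att G R v1
  a2 : Att G R v2
  l1 : Lt G K R s1
  l1' : Lt G K R t1
  good : EE G s1 t1

section
variable {v1 s1 s2 v2 t2 t1 : V} {P W : List V}

theorem Ends.cons_of {a b : V} {l : List V} (h : Ends a b l) : ∃ l', l = a :: l' := by
  rcases l with _ | ⟨x, l'⟩
  · simp [Ends] at h
  · exact ⟨l', by rw [ends_cons h]⟩
theorem Ends.concat_of {a b : V} {l : List V} (h : Ends a b l) : ∃ l', l = l' ++ [b] := by
  obtain ⟨l', h⟩ := h.rev.cons_of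
  exact ⟨l'.reverse, by have := congrArg List.reverse h; simpa using this⟩

theorem cyc_mirror (h : Cyc G.Adj (v1 :: (P ++ v2 :: W))) : Cyc G.Adj (v1 :: (W.reverse ++ v2 :: P.reverse)) := by
  have := h.revG
  have := Cyc.rot (l := W.reverse ++ v2 :: P.reverse) (m := [v1]) (by simpa using this)
  simpa using this
theorem perm_mirror (h : (v1 :: (P ++ v2 :: W)).Perm C) : (v1 :: (W.reverse ++ v2 :: P.reverse)).Perm C := by
  refine List.Perm.trans (List.Perm.cons _ ?_) h
  exact List.perm_append_comm.trans (by simpa using ((List.reverse_perm P).append (List.Perm.cons v2 (List.reverse_perm W))).symm |>.symm |> List.perm_middle.symm.trans)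

theorem Base.mirror (b : Base G K R C v1 s1 s2 v2 t2 t1 P W) :
    Base G K R C v1 t1 t2 v2 s2 s1 W.reverse P.reverse :=
  ⟨cyc_mirror b.cyc, perm_mirror b.perm, b.eW.rev, b.eP.rev, b.a1, b.a2, b.l1', b.l1, b.good.symm⟩

theorem Base.memC (b : Base G K R C v1 s1 s2 v2 t2 t1 P W) {v : V} : v ∈ C ↔ v = v1 ∨ v ∈ P ∨ v = v2 ∨ v ∈ W := by
  rw [← b.perm.mem_iff]; simp

theorem Base.vt1 (b : Base G K R C v1 s1 s2 v2 t2 t1 P W) : G.Adj v1 t1 := by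
  have := b.cyc.2 t1 (by simp [List.getLast?_cons, List.getLast?_append, b.eW.2]) v1 (by simp)
  exact this.symm
theorem Base.vs1 (b : Base G K R C v1 s1 s2 v2 t2 t1 P W) : G.Adj v1 s1 := b.mirror.vt1
theorem Base.vt2 (b : Base G K R C v1 s1 s2 v2 t2 t1 P W) : G.Adj v2 t2 := by
  obtain ⟨l, hl⟩ := b.eW.cons_of
  have := b.cyc.1
  rw [hl, ← List.cons_append, List.isChain_append] at this
  simpa using this.2.1.rel
theorem Base.vs2 (b : Base G K R C v1 s1 s2 v2 t2 t1 P W) : G.Adj v2 s2 := b.mirror.vt2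

theorem Base.nt2 (E : Env G K R C) (b : Base G K R C v1 s1 s2 v2 t2 t1 P W) : ¬ Att G R t2 ∧ ¬ R t2 := by
  refine ⟨?_, E.nR (b.memC.2 (by simp [b.eW.head_mem]))⟩
  obtain ⟨l, hl⟩ := b.eW.cons_of
  have h := Cyc.rot (l := v1 :: P) (m := v2 :: W) b.cyc
  refine E.nA2 (l := l ++ v1 :: P) (by simpa [hl] using h) (List.Perm.trans ?_ b.perm) b.a2
  have : (v1 :: (P ++ v2 :: W)) = (v1 :: P) ++ v2 :: W := by simp
  rw [this]
  refine List.Perm.trans ?_ List.perm_append_comm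
  simp [hl]

theorem Base.ns2 (E : Env G K R C) (b : Base G K R C v1 s1 s2 v2 t2 t1 P W) : ¬ Att G R s2 ∧ ¬ R s2 :=
  b.mirror.nt2 E

theorem light2 (E : Env G K R C) (b : Base G K R C v1 s1 s2 v2 t2 t1 P W) (h2 : Lt G K R s2) {r x : V} (hr : Lt G K R r)
    (hW : r ∈ W) (r1 : G.Adj r v1) (r2 : G.Adj r v2) (hx : R x) (x1 : G.Adj x v1) (x2 : G.Adj x v2) : False := by
  have hrt := E.clq b.a1 b.l1' hr (by
    exact .of b.vt1) (.of r1.symm)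
  obtain ⟨n2, n2'⟩ := b.nt2 E
  obtain ⟨cyc, perm, eP, eW, a1, a2, ⟨l11, l12, l13⟩, ⟨l11', l12', l13'⟩, good⟩ := b
  obtain ⟨h21, h22, h23⟩ := h2
  obtain ⟨hr1, hr2, hr3⟩ := hr
  have hxK := E.Rl x hx
  have := EE.of r1
  have := EE.of r2
  have := EE.of x1.symm
  have := EE.of x2
  have := EE.of r1.symm
  obtain ⟨W1, W2, rfl⟩ := List.append_of_mem hW
  rcases eq_or_ne W1 [] with rfl | hW1
  · obtain rfl : t2 = r := ends_cons eW
    refine model_li2t2 E.ctx (v1 := v1) (v2 := v2) (x := x) (by simpa using cyc) (by simpa using perm) eP eW ?_ ?_ (nAdjR E ?_ ?_) ?_ ?_ ?_ ?_ <;>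
      simp [*]
  rcases eq_or_ne W2 [] with rfl | hW2
  · obtain rfl : t1 = r := by have := eW.2; simp at this; exact this.symm
    refine model_li2t1 E.ctx (v1 := v1) (v2 := v2) (x := x) (by simpa using cyc) (by simpa using perm) eP eW ?_ ?_ (nAdjR E ?_ ?_) ?_ ?_ ?_ ?_ <;>
      simp [*]
  obtain ⟨c, d, e1⟩ := exists_ends hW1
  obtain ⟨c', d', e2⟩ := exists_ends hW2
  have ec : c = t2 := by
    have := eW.1; rw [List.head?_append_of_ne_nil _ hW1, e1.1] at this; simpa using this
  have ed : d' = t1 := by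
    have := eW.2; simp [List.getLast?_append, List.getLast?_cons, e2.2] at this; exact this
  subst ec ed
  have m1 : d ∈ C := perm.mem_iff.1 (by simp [e1.last_mem])
  have m2 : c' ∈ C := perm.mem_iff.1 (by simp [e2.head_mem])
  refine model_li2Q E.ctx (v1 := v1) (v2 := v2) (x := x) (r := r) (by simpa using cyc) (by simpa using perm) eP e1 e2 ?_ ?_ (nAdjR E ?_ ?_)
    ?_ ?_ ?_ ?_ ?_ (adjImpR E ?_ ?_)
  all_goals try simp [*]
end
end HamADH

open SimpleGraph
namespace HamADH
variable {V : Type*} {G : SimpleGraph V} {K R : V → Prop} {C : List V}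
section
variable {v1 s1 s2 v2 t2 t1 : V} {P W : List V}

theorem Att.ne {v w : V} (h : Att G R v) (h' : Lt G K R w) : v ≠ w := by
  rintro rfl; exact h'.2.2 h

theorem Base.t1S (b : Base G K R C v1 s1 s2 v2 t2 t1 P W) : Comp G (Lt G K R) s1 t1 :=
  (Comp.self b.l1).step b.l1' b.good

theorem light (E : Env G K R C) (b : Base G K R C v1 s1 s2 v2 t2 t1 P W) (h2 : Comp G (Lt G K R) s1 s2)
    {x1 : V} (hx : R x1) (e1 : G.Adj x1 v1) :
    G.Adj x1 v2 ∧ ∃ r ∈ P, Comp G (Lt G K R) s1 r ∧ G.Adj r v1 ∧ G.Adj r v2 := by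
  have hL2 := h2.mem
  have t1S := b.t1S
  obtain ⟨-, xx, hxx, exx⟩ := id b.a2
  have hc : Conn G (fun v => (R v ∨ v = v2) ∨ Comp G (Lt G K R) s1 v) :=
    (E.Rconn.union (Conn.single v2) hxx rfl exx).union Comp.conn (Or.inr rfl) h2 b.vs2
  obtain ⟨m, hm, w⟩ := E.adhset _ hc x1 t1 2 (.inl (.inl hx)) (.inr t1S)
    ⟨v1, .of e1, t1, .of b.vt1, rfl⟩
  obtain ⟨r, m', x2, hrm, wR, hx2, ex2, w'⟩ := Wk.cut (X := R) (v := v2) (by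
    rintro a c ha ((hc | hc) | hc) hac
    · exact .inl hc
    · exact .inr hc
    · exact absurd (EE.of hac) (Env.natt ha hc.mem.2.1 hc.mem.2.2)) w hx b.l1'.2.1
  have n2 := b.nt2 E
  have hx1K := E.Rl _ hx
  have hx2K := E.Rl _ hx2
  have nlt : EE G x1 x2 → ¬ EE G t1 v2 := by
    intro h12 htv
    have hs := b.good
    obtain ⟨cyc, perm, eP, eW, a1, a2, ⟨l11, l12, l13⟩, ⟨l11', l12', l13'⟩, good⟩ := b
    obtain ⟨h21, h22, h23⟩ := hL2
    have := EE.of e1.symm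
    have := EE.of ex2
    refine model_lt E.ctx (v1 := v1) (v2 := v2) (x1 := x1) (x2 := x2) (by simpa using cyc) (by simpa using perm) eP eW ?_ ?_ (nAdjR E ?_ ?_)
      ?_ ?_ ?_ ?_ <;> simp [*]
  have hv2t1 : v2 ≠ t1 := b.a2.ne b.l1'
  rcases m' with _ | _ | m'
  · exact absurd w' hv2t1
  · obtain ⟨c, h1, h2, rfl⟩ := w'
    exfalso
    refine nlt ?_ (.of h1.symm)
    rcases r with _ | _ | r
    · exact .inl wR
    · obtain ⟨c', h1, h2, rfl⟩ := wR
      exact .of h1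
    · omega
  · obtain rfl : m' = 0 := by omega
    obtain rfl : r = 0 := by omega
    obtain rfl : x1 = x2 := wR
    obtain ⟨r, er, hr, c, ec, -, rfl⟩ := w'
    have nt := nlt (.inl rfl)
    have hr' : Comp G (Lt G K R) s1 r := by
      rcases hr with (hr | hr) | hr
      · exact absurd (EE.of ec) (Env.natt hr b.l1'.2.1 b.l1'.2.2)
      · subst hr; exact absurd er (G.irrefl)
      · exact hr
    have hrL := hr'.mem
    refine ⟨ex2, r, ?_, hr', ?_, er.symm⟩
    all_goals
      have hrv : EE G r v1 := by
        by_contra hrv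
        obtain ⟨cyc, perm, eP, eW, a1, a2, ⟨l11, l12, l13⟩, ⟨l11', l12', l13'⟩, good⟩ := b
        obtain ⟨h21, h22, h23⟩ := hL2
        obtain ⟨h31, h32, h33⟩ := hrL
        have := EE.of e1.symm
        have := EE.of ex2
        have := EE.of ec.symm
        have := EE.of er.symm
        refine model_li E.ctx (v1 := v1) (v2 := v2) (x := x1) (r := r) (by simpa using cyc) (by simpa using perm) eP eW ?_ ?_ (nAdjR E ?_ ?_)
          ?_ ?_ ?_ ?_ ?_ ?_ <;> simp [nAdj_iff, *]
      have hrv := hrv.resolve_left (b.a1.ne hrL).symm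
    · by_cases hC : r ∈ C
      · rcases b.memC.1 hC with h | h | h | h
        · exact absurd h.symm (b.a1.ne hrL)
        · exact h
        · exact absurd h.symm (b.a2.ne hrL)
        · exact (light2 E b hL2 hrL h hrv er.symm hx e1 ex2).elim
      · exfalso
        have := E.clq b.a1 hrL b.l1 (.of hrv.symm) (.of b.vs1)
        have hs1C : s1 ∈ C := b.memC.2 (by simp [b.eP.head_mem])
        have h3 := this.resolve_left (by rintro rfl; exact hC hs1C)
        have hh := Cyc.rot (l := [v1]) (m := P ++ v2 :: W) b.cyc
        refine E.noIns _ s1 v1 r (List.Perm.trans ?_ b.perm) (Cyc.FF hh).1 ?_ (by simp [List.getLast?_cons]) hC h3 hrv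
        · exact List.perm_append_comm
        · simp [b.eP.1]
    · exact hrv
end
end HamADH

open SimpleGraph
namespace HamADH
variable {V : Type*} {G : SimpleGraph V} {K R : V → Prop} {C : List V}

theorem chain_adj {r : V → V → Prop} {l : List V} (h : l.IsChain r) (l1 l2 : List V) {a b : V}
    (e : l = l1 ++ a :: b :: l2) : r a b := by
  subst e
  rw [List.isChain_append] at h
  exact h.2.1.rel

def Short (G : SimpleGraph V) (X : V → Prop) (v y : V) : Prop := ∃ a, X a ∧ EE G v a ∧ EE G a y
def Long3 (G : SimpleGraph V) (X : V → Prop) (v y : V) : Prop := ∃ a p, X a ∧ X p ∧ EE G v a ∧ EE G a p ∧ EE G p y ∧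
  ¬ EE G v p ∧ ¬ EE G v y ∧ ¬ EE G a y
def Long4 (G : SimpleGraph V) (X : V → Prop) (v y : V) : Prop := ∃ a p o, X a ∧ X p ∧ X o ∧ EE G v a ∧ EE G a p ∧
  EE G p o ∧ EE G o y ∧ ¬ EE G v p ∧ ¬ EE G v o ∧ ¬ EE G v y ∧ ¬ EE G a o ∧ ¬ EE G a y ∧ ¬ EE G p y

theorem chainDich {X : V → Prop} {v y a' : V} {r : ℕ} (w : Wk G X r y a') (hy : X y) (e : G.Adj a' v) (hr : r ≤ 3) :
    Short G X v y ∨ (2 ≤ r ∧ Long3 G X v y) ∨ (3 ≤ r ∧ Long4 G X v y) := by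
  by_cases hs : Short G X v y
  · exact .inl hs
  have s : ∀ a, X a → EE G v a → EE G a y → False := fun a h1 h2 h3 => hs ⟨a, h1, h2, h3⟩
  have key : ∀ a p, X a → X p → EE G v a → EE G a p → EE G p y → Long3 G X v y := fun a p h1 h2 h3 h4 h5 =>
    ⟨a, p, h1, h2, h3, h4, h5, fun h => s p h2 h h5, fun h => s y hy h (.refl y), fun h => s a h1 h3 h⟩
  rcases r with _ | _ | _ | _ | r
  · obtain rfl : y = a' := w
    exact absurd (EE.of e.symm) fun h => s y hy h (.refl y)
  · obtain ⟨a, h1, h2, rfl⟩ := w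
    exact absurd (EE.of e.symm) fun h => s a h2 h (.of h1.symm)
  · obtain ⟨p, h1, h2, a, h3, h4, rfl⟩ := w
    exact .inr (.inl ⟨le_rfl, key a p h4 h2 (.of e.symm) (.of h3.symm) (.of h1.symm)⟩)
  · by_cases h3 : Long3 G X v y
    · exact .inr (.inl ⟨by omega, h3⟩)
    have k : ∀ a p, X a → X p → EE G v a → EE G a p → EE G p y → False := fun a p h1 h2 h4 h5 h6 =>
      h3 (key a p h1 h2 h4 h5 h6)
    obtain ⟨o, h1, ho, p, h2, hp, a, h3, ha, rfl⟩ := w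
    have e1 := EE.of h1.symm
    have e2 := EE.of h2.symm
    have e3 := EE.of h3.symm
    have e4 := EE.of e.symm
    exact .inr (.inr ⟨by omega, a, p, o, ha, hp, ho, e4, e3, e2, e1, fun h => k p o hp ho h e2 e1,
      fun h => s o ho h e1, fun h => s y hy h (.refl y), fun h => k a o ha ho e4 h e1, fun h => s a ha e4 h,
      fun h => k a p ha hp e4 e3 h⟩)
  · omega

/-- A path through `R` of length at most four. -/
structure RPath (G : SimpleGraph V) (R : V → Prop) (v1 x1 z x2 v2 : V) : Prop where
  r1 : R x1
  r2 : R z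
  r3 : R x2
  e1 : EE G v1 x1
  e2 : EE G x1 z
  e3 : EE G z x2
  e4 : EE G x2 v2

theorem RPath.symm {v1 x1 z x2 v2 : V} (h : RPath G R v1 x1 z x2 v2) : RPath G R v2 x2 z x1 v1 :=
  ⟨h.r3, h.r2, h.r1, h.e4.symm, h.e3.symm, h.e2.symm, h.e1.symm⟩

theorem rpath_of {r : ℕ} {x x' v1 v2 : V} (w : Wk G R r x x') (hr : r ≤ 2) (hx : R x) (hx' : R x') (e1 : G.Adj v1 x)
    (e2 : G.Adj x' v2) : ∃ x1 z x2, RPath G R v1 x1 z x2 v2 := by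
  rcases r with _ | _ | _ | r
  · obtain rfl : x = x' := w
    exact ⟨x, x, x, hx, hx, hx, .of e1, .refl _, .refl _, .of e2⟩
  · obtain ⟨a, h1, h2, rfl⟩ := w
    exact ⟨x, x, a, hx, hx, hx', .of e1, .refl _, .of h1, .of e2⟩
  · obtain ⟨p, h1, h2, a, h3, h4, rfl⟩ := w
    exact ⟨x, p, a, hx, h2, hx', .of e1, .of h1, .of h3, .of e2⟩
  · omega

/-- `S1` and `S2` are separated from each other apart from `v1`, `v2`. -/
theorem rpath (E : Env G K R C) {S1 S2 : V → Prop} {v1 v2 : V} (a1 : Att G R v1) (a2 : Att G R v2) (hne : v1 ≠ v2)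
    (L1 : ∀ v, S1 v → Lt G K R v) (L2 : ∀ v, S2 v → Lt G K R v)
    (x12 : ∀ u w, S1 u → S2 w → ¬ EE G u w) (x1v : ∀ u, S1 u → ¬ EE G u v2) (x2v : ∀ w, S2 w → ¬ EE G v1 w)
    {m : ℕ} (hm : m ≤ 4)
    (w : Wk G (fun v => S1 v ∨ v = v1 ∨ R v ∨ v = v2 ∨ S2 v) m v1 v2) :
    ∃ x1 z x2, RPath G R v1 x1 z x2 v2 := by
  by_cases h12 : G.Adj v1 v2
  · obtain ⟨-, x, hx, ex⟩ := id a1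
    obtain ⟨-, xx, hxx, exx⟩ := id a2
    obtain ⟨n, hn, w⟩ := E.adhset _ (E.Rconn.union (Conn.single v2) hxx rfl exx) x v2 2 (.inl hx) (.inr rfl)
      ⟨v1, .of ex, v2, .of h12, rfl⟩
    obtain ⟨r, m, x', e, w1, hx', e', -⟩ := Wk.cut (X := R) (v := v2) (fun a b _ hb _ => hb) w hx a2.1
    exact rpath_of w1 (by omega) hx hx' ex.symm e'
  · obtain ⟨n, hn, w⟩ := w.loopErase
    rcases n with _ | n
    · exact absurd w hne
    obtain ⟨c, h1, ⟨h2, h2'⟩, w⟩ := w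
    rcases h2 with h2 | h2 | h2 | h2 | h2
    · obtain ⟨r, m, a', e, w1, hx', e', -⟩ := Wk.cut (X := S1) (v := v2) (by
        rintro a b ha ⟨hb | hb | hb | hb | hb, hb'⟩ hab
        · exact .inl hb
        · exact absurd hb hb'
        · exact absurd (EE.of hab.symm) (Env.natt hb (L1 a ha).2.1 (L1 a ha).2.2)
        · exact .inr hb
        · exact absurd (EE.of hab) (x12 a b ha hb)) w h2 (fun h => a2.ne (L1 _ h) rfl)
      exact absurd (EE.of e') (x1v _ hx')
    · exact absurd h2 h2'
    · obtain ⟨r, m, x', e, w1, hx', e', -⟩ := Wk.cut (X := R) (v := v2) (by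
        rintro a b ha ⟨hb | hb | hb | hb | hb, hb'⟩ hab
        · exact absurd (EE.of hab) (Env.natt ha (L1 b hb).2.1 (L1 b hb).2.2)
        · exact absurd hb hb'
        · exact .inl hb
        · exact .inr hb
        · exact absurd (EE.of hab) (Env.natt ha (L2 b hb).2.1 (L2 b hb).2.2)) w h2 a2.1
      exact rpath_of w1 (by omega) h2 hx' h1 e'
    · exact absurd (h2 ▸ h1) h12
    · exact absurd (EE.of h1) (x2v _ h2)

structure Sep (G : SimpleGraph V) (K R : V → Prop) (C : List V) (S1 S2 : V → Prop)
    (v1 s1 y k1 k2 y2 s2 v2 t2 t1 x1 z x2 : V) (Pa M Pb W : List V) : Prop where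
  cyc : Cyc G.Adj (v1 :: (Pa ++ (M ++ (Pb ++ v2 :: W))))
  perm : (v1 :: (Pa ++ (M ++ (Pb ++ v2 :: W)))).Perm C
  eA : Ends s1 y Pa
  eM : Ends k1 k2 M
  eB : Ends y2 s2 Pb
  eW : Ends t2 t1 W
  a1 : Att G R v1
  a2 : Att G R v2
  nA : ∀ v ∈ Pa, ¬ Att G R v
  nM : ∀ v ∈ M, ¬ Att G R v
  nB : ∀ v ∈ Pb, ¬ Att G R v
  L1 : ∀ v, S1 v → Lt G K R v
  L2 : ∀ v, S2 v → Lt G K R v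
  s1m : S1 s1
  ym : S1 y
  t1m : S1 t1
  s2m : S2 s2
  y2m : S2 y2
  x12 : ∀ u w, S1 u → S2 w → ¬ EE G u w
  x1v : ∀ u, S1 u → ¬ EE G u v2
  x2v : ∀ w, S2 w → ¬ EE G v1 w
  c1 : ∀ u w, S1 u → Lt G K R w → EE G u w → S1 w
  c2 : ∀ u w, S2 u → Lt G K R w → EE G u w → S2 w
  mid : ∀ c ∈ M, ¬ S1 c ∧ ¬ S2 c
  hk1 : K k1
  hk2 : K k2
  good : EE G s1 t1
  nt2 : ¬ Att G R t2
  nt2' : ¬ R t2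
  rp : RPath G R v1 x1 z x2 v2

theorem Sep.memC {S1 S2 : V → Prop} {v1 s1 y k1 k2 y2 s2 v2 t2 t1 x1 z x2 : V} {Pa M Pb W : List V}
    (s : Sep G K R C S1 S2 v1 s1 y k1 k2 y2 s2 v2 t2 t1 x1 z x2 Pa M Pb W) {v : V} :
    v ∈ C ↔ v = v1 ∨ v ∈ Pa ∨ v ∈ M ∨ v ∈ Pb ∨ v = v2 ∨ v ∈ W := by
  rw [← s.perm.mem_iff]; simp

theorem sepData (E : Env G K R C) {v1 s1 s2 v2 t2 t1 : V} {P W : List V} (b : Base G K R C v1 s1 s2 v2 t2 t1 P W)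
    (hP : ∀ v ∈ P, ¬ Att G R v) (hs2 : Lt G K R s2) (hS : ¬ Comp G (Lt G K R) s1 s2) :
    ∃ y k1 k2 y2 x1 z x2 Pa M Pb,
      Sep G K R C (Comp G (Lt G K R) s1) (Comp G (Lt G K R) s2) v1 s1 y k1 k2 y2 s2 v2 t2 t1 x1 z x2 Pa M Pb W ∧
      P = Pa ++ (M ++ Pb) ∧
      ((Short G (Comp G (Lt G K R) s1) v1 y ∧ Short G (Comp G (Lt G K R) s2) v2 y2) ∨
       (G.Adj v1 v2 ∧ Long3 G (Comp G (Lt G K R) s1) v1 y ∧ EE G v2 y2) ∨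
       (G.Adj v1 v2 ∧ EE G v1 y ∧ Long3 G (Comp G (Lt G K R) s2) v2 y2)) := by
  set S1 := Comp G (Lt G K R) s1 with hS1
  set S2 := Comp G (Lt G K R) s2 with hS2
  have hs1S : S1 s1 := Comp.self b.l1
  have hs2S : S2 s2 := Comp.self hs2
  have disj : ∀ v, S1 v → S2 v → False := fun v h1 h2 => hS (h1.trans h2.symm)
  have c1 : ∀ u w, S1 u → Lt G K R w → EE G u w → S1 w := fun u w h1 h2 h3 => h1.step h2 h3
  have c2 : ∀ u w, S2 u → Lt G K R w → EE G u w → S2 w := fun u w h1 h2 h3 => h1.step h2 h3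
  have L1 : ∀ v, S1 v → Lt G K R v := fun v h => h.mem
  have L2 : ∀ v, S2 v → Lt G K R v := fun v h => h.mem
  have x12 : ∀ u w, S1 u → S2 w → ¬ EE G u w := fun u w h1 h2 h3 => disj w (c1 u w h1 (L2 w h2) h3) h2
  have x1v : ∀ u, S1 u → ¬ EE G u v2 := fun u h1 h2 =>
    x12 u s2 h1 hs2S (E.clq b.a2 (L1 u h1) hs2 h2.symm (.of b.vs2))
  have x2v : ∀ w, S2 w → ¬ EE G v1 w := fun w h1 h2 =>
    x12 s1 w hs1S h1 (E.clq b.a1 b.l1 (L2 w h1) (.of b.vs1) h2)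
  obtain ⟨l1, y, l2, e1, hy, hl2⟩ := split_last S1 ⟨s1, b.eP.head_mem, hs1S⟩
  have hs2l : s2 ∈ l2 := by
    have := b.eP.2
    rw [e1, List.getLast?_append] at this
    rcases l2 with _ | ⟨c, l2⟩
    · simp at this; subst this; exact absurd hs2S (fun h => disj _ hy h)
    · rw [List.getLast?_cons_cons] at this
      have h2 : (c :: l2).getLast? = some s2 := by
        cases h : (c :: l2).getLast? with
        | none => simp at h
        | some d => rw [h] at this; simpa using this
      exact List.mem_of_mem_getLast? h2
  obtain ⟨M, y2, l3, e2, hy2, hM⟩ := split_first S2 ⟨s2, hs2l, hs2S⟩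
  subst e2
  have ch := b.cyc.1
  have hMne : M ≠ [] := by
    rintro rfl
    refine x12 y y2 hy hy2 (.of ?_)
    exact chain_adj ch (v1 :: l1) (l3 ++ v2 :: W) (by simp [e1])
  obtain ⟨k1, k2, eM⟩ := exists_ends hMne
  obtain ⟨M1, hM1⟩ := eM.cons_of
  obtain ⟨M2, hM2⟩ := eM.concat_of
  have ey : G.Adj y k1 := chain_adj ch (v1 :: l1) (M1 ++ y2 :: l3 ++ v2 :: W) (by simp [e1, hM1])
  have ey2 : G.Adj k2 y2 := chain_adj ch (v1 :: l1 ++ y :: M2) (l3 ++ v2 :: W) (by simp [e1, hM2])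
  have mid : ∀ c ∈ M, ¬ S1 c ∧ ¬ S2 c := fun c hc => ⟨hl2 c (by simp [hc]), hM c hc⟩
  have hMP : ∀ c ∈ M, c ∈ P := fun c hc => by simp [e1, hc]
  have mL : ∀ c ∈ M, ¬ K c → Lt G K R c := fun c hc h =>
    ⟨h, E.nR (b.memC.2 (.inr (.inl (hMP c hc)))), hP c (hMP c hc)⟩
  have hk1 : K k1 := by
    by_contra h
    exact (mid k1 eM.head_mem).1 (c1 y k1 hy (mL _ eM.head_mem h) (.of ey))
  have hk2 : K k2 := by
    by_contra h
    exact (mid k2 eM.last_mem).2 (c2 y2 k2 hy2 (mL _ eM.last_mem h) (.of ey2.symm))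
  have hne : v1 ≠ v2 := by
    have := b.perm.nodup_iff.2 E.nodup
    intro h; simp [h] at this
  obtain ⟨-, x, hx, ex⟩ := id b.a1
  obtain ⟨-, x', hx', ex'⟩ := id b.a2
  have hconn : Conn G (fun v => S1 v ∨ v = v1 ∨ R v ∨ v = v2 ∨ S2 v) :=
    (Comp.conn).union ((Conn.single v1).union (E.Rconn.union ((Conn.single v2).union Comp.conn rfl hs2S b.vs2)
      hx' (.inl rfl) ex') rfl (.inl hx) ex.symm) hs1S (.inl rfl) b.vs1.symm
  have near : Near G 4 y y2 := by
    obtain ⟨c, h1, d, h2, rfl⟩ := E.heavy k1 k2 hk1 hk2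
    exact ⟨k1, .of ey, c, h1, d, h2, y2, .of ey2, rfl⟩
  obtain ⟨n, hn, w⟩ := E.adhset _ hconn y y2 4 (.inl hy) (.inr (.inr (.inr (.inr hy2)))) near
  obtain ⟨r, m, a', he, wA, hA', eA', w⟩ := Wk.cut (X := S1) (v := v1) (by
    rintro a b ha (hb | hb | hb | hb | hb) hab
    · exact .inl hb
    · exact .inr hb
    · exact absurd (EE.of hab.symm) (Env.natt hb (L1 a ha).2.1 (L1 a ha).2.2)
    · exact absurd (hb ▸ EE.of hab) (x1v a ha)
    · exact absurd (EE.of hab) (x12 a b ha hb)) w hy (fun h => disj _ h hy2)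
  have w := w.symm (.inr (.inl rfl))
  obtain ⟨r2, L, a2', he2, wB, hB', eB', w⟩ := Wk.cut (X := S2) (v := v2) (by
    rintro a b ha (hb | hb | hb | hb | hb) hab
    · exact absurd (EE.of hab.symm) (x12 b a hb ha)
    · exact absurd (hb ▸ EE.of hab.symm) (x2v a ha)
    · exact absurd (EE.of hab.symm) (Env.natt hb (L2 a ha).2.1 (L2 a ha).2.2)
    · exact .inr hb
    · exact .inl hb) w hy2 (fun h => b.a1.ne (L2 _ h) rfl)
  have hL : 1 ≤ L := by
    rcases L with _ | L
    · exact absurd (Eq.symm w) hne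
    · omega
  have hL2 : ¬ G.Adj v1 v2 → 2 ≤ L := by
    intro h
    rcases L with _ | _ | L
    · omega
    · obtain ⟨c, h1, h2, rfl⟩ := w; exact absurd h1.symm h
    · omega
  obtain ⟨x1, z, x2, rp⟩ := rpath E b.a1 b.a2 hne L1 L2 x12 x1v x2v (by omega) (w.symm (.inr (.inr (.inr (.inl rfl)))))
  refine ⟨y, k1, k2, y2, x1, z, x2, l1 ++ [y], M, y2 :: l3, ?_, by simp [e1], ?_⟩
  · refine ⟨by simpa [e1] using b.cyc, by simpa [e1] using b.perm, ⟨?_, by simp⟩, eM, ⟨rfl, ?_⟩, b.eW, b.a1, b.a2, ?_, ?_, ?_,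
      L1, L2, hs1S, hy, b.t1S, hs2S, hy2, x12, x1v, x2v, c1, c2, mid, hk1, hk2, b.good, (b.nt2 E).1, (b.nt2 E).2, rp⟩
    · have := b.eP.1
      rw [e1] at this
      rcases l1 with _ | ⟨c, l1⟩ <;> simpa using this
    · have := b.eP.2
      rw [e1] at this
      simpa [List.getLast?_append, List.getLast?_cons] using this
    · intro v hv; exact hP v (by simp [e1] at hv ⊢; tauto)
    · intro v hv; exact hP v (by simp [e1, hv])
    · intro v hv; exact hP v (by simp [e1] at hv ⊢; tauto)
  · rcases chainDich wA hy eA' (by omega) with h1 | ⟨hr, h1⟩ | ⟨hr, -⟩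
    · rcases chainDich wB hy2 eB' (by omega) with h2 | ⟨hr2, h2⟩ | ⟨hr2, -⟩
      · exact .inl ⟨h1, h2⟩
      · have h12 : G.Adj v1 v2 := by by_contra h; have := hL2 h; omega
        have : r = 0 := by omega
        subst this
        obtain rfl : y = a' := wA
        exact .inr (.inr ⟨h12, .of eA'.symm, h2⟩)
      · omega
    · have h12 : G.Adj v1 v2 := by by_contra h; have := hL2 h; omega
      have : r2 = 0 := by omega
      subst this
      obtain rfl : y2 = a2' := wB
      exact .inr (.inl ⟨h12, h1, .of eB'.symm⟩)
    · omega
end HamADH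

set_option linter.unusedSimpArgs false
set_option linter.unusedVariables false
open SimpleGraph
namespace HamADH
variable {V : Type*} {G : SimpleGraph V} {K R : V → Prop} {C : List V}

theorem split_mid {a b g : V} {l : List V} (h : Ends a b l) (hg : g ∈ l) (ha : g ≠ a) (hb : g ≠ b) :
    ∃ l1 l2 gm gp, l = l1 ++ g :: l2 ∧ Ends a gm l1 ∧ Ends gp b l2 := by
  obtain ⟨l1, l2, rfl⟩ := List.append_of_mem hg
  rcases eq_or_ne l1 [] with rfl | h1
  · exact absurd (ends_cons h).symm ha
  rcases eq_or_ne l2 [] with rfl | h2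
  · exact absurd (by have := h.2; simpa using this) hb
  obtain ⟨c, d, e1⟩ := exists_ends h1
  obtain ⟨c', d', e2⟩ := exists_ends h2
  have ec : c = a := by
    have := h.1; rw [List.head?_append_of_ne_nil _ h1, e1.1] at this; simpa using this
  have ed : d' = b := by
    have := h.2; simp [List.getLast?_append, List.getLast?_cons, e2.2] at this; exact this
  subst ec ed
  exact ⟨l1, l2, d, c', rfl, e1, e2⟩

section
variable {S1 S2 : V → Prop} {v1 s1 y k1 k2 y2 s2 v2 t2 t1 x1 z x2 : V} {Pa M Pb W : List V}

theorem Sep.symm (s : Sep G K R C S1 S2 v1 s1 y k1 k2 y2 s2 v2 t2 t1 x1 z x2 Pa M Pb W) (ht : S2 t2) (hg : EE G s2 t2) :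
    Sep G K R C S2 S1 v2 s2 y2 k2 k1 y s1 v1 t1 t2 x2 z x1 Pb.reverse M.reverse Pa.reverse W.reverse where
  cyc := by
    have := s.cyc.revG
    have := Cyc.rot (l := W.reverse) (m := v2 :: (Pb.reverse ++ (M.reverse ++ (Pa.reverse ++ [v1])))) (by simpa using this)
    simpa using this
  perm := by
    refine List.Perm.trans ?_ s.perm
    refine List.Perm.trans ?_ (List.reverse_perm _)
    have e : (v1 :: (Pa ++ (M ++ (Pb ++ v2 :: W)))).reverse = W.reverse ++ (v2 :: (Pb.reverse ++ (M.reverse ++ (Pa.reverse ++ [v1])))) := by simp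
    rw [e]
    refine List.Perm.trans ?_ List.perm_append_comm
    simp
  eA := s.eB.rev
  eM := s.eM.rev
  eB := s.eA.rev
  eW := s.eW.rev
  a1 := s.a2
  a2 := s.a1
  nA := fun v h => s.nB v (by simpa using h)
  nM := fun v h => s.nM v (by simpa using h)
  nB := fun v h => s.nA v (by simpa using h)
  L1 := s.L2
  L2 := s.L1
  s1m := s.s2m
  ym := s.y2m
  t1m := ht
  s2m := s.s1m
  y2m := s.ym
  x12 := fun u w h1 h2 h3 => s.x12 w u h2 h1 h3.symm
  x1v := fun u h1 h2 => s.x2v u h1 h2.symm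
  x2v := fun u h1 h2 => s.x1v u h1 h2.symm
  c1 := s.c2
  c2 := s.c1
  mid := fun c h => (s.mid c (by simpa using h)).symm
  hk1 := s.hk2
  hk2 := s.hk1
  good := hg
  nt2 := (s.L1 _ s.t1m).2.2
  nt2' := (s.L1 _ s.t1m).2.1
  rp := s.rp.symm

theorem Sep.cc (E : Env G K R C) (s : Sep G K R C S1 S2 v1 s1 y k1 k2 y2 s2 v2 t2 t1 x1 z x2 Pa M Pb W) {c : V} (hc : c ∈ M) :
    (∀ u, S1 u → EE G c u → K c) ∧ (∀ u, S2 u → EE G c u → K c) := by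
  have hl : ¬ K c → Lt G K R c := fun h => ⟨h, E.nR (s.memC.2 (by simp [hc])), s.nM c hc⟩
  constructor
  · intro u hu e
    by_contra h
    exact (s.mid c hc).1 (s.c1 u c hu (hl h) e.symm)
  · intro u hu e
    by_contra h
    exact (s.mid c hc).2 (s.c2 u c hu (hl h) e.symm)

theorem Sep.nboth (E : Env G K R C) (s : Sep G K R C S1 S2 v1 s1 y k1 k2 y2 s2 v2 t2 t1 x1 z x2 Pa M Pb W) {g : V} (hg : ¬ K g)
    (u w : V) (hu : S1 u) (hw : S2 w) (e1 : EE G g u) (e2 : EE G g w) : False := by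
  by_cases hR : R g
  · exact Env.natt hR (s.L1 u hu).2.1 (s.L1 u hu).2.2 e1
  by_cases hA : Att G R g
  · exact s.x12 u w hu hw (E.clq hA (s.L1 u hu) (s.L2 w hw) e1 e2)
  · exact s.x12 g w (s.c1 u g hu ⟨hg, hR, hA⟩ e1.symm) hw e2

theorem Sep.adjImp (E : Env G K R C) (s : Sep G K R C S1 S2 v1 s1 y k1 k2 y2 s2 v2 t2 t1 x1 z x2 Pa M Pb W) {X Y : List V}
    (hX : ∀ c ∈ X, c ∈ M) (hY : ∀ u ∈ Y, S1 u ∨ S2 u) : AdjImp G K X Y := by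
  intro c hc u hu e
  obtain ⟨h1, h2⟩ := s.cc E (hX c hc)
  rcases hY u hu with h | h
  · exact h1 u h e
  · exact h2 u h e

theorem Sep.nboth' (E : Env G K R C) (s : Sep G K R C S1 S2 v1 s1 y k1 k2 y2 s2 v2 t2 t1 x1 z x2 Pa M Pb W) {g : V} (hg : ¬ K g)
    {X Y : List V} (hX : ∀ c ∈ X, S1 c) (hY : ∀ u ∈ Y, S2 u) : NBoth G [g] X Y := by
  intro c hc u hu w hw e
  obtain rfl : c = g := by simpa using hc
  exact s.nboth E hg u w (hX u hu) (hY w hw) e.1 e.2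

theorem Sep.B0 (E : Env G K R C) (s : Sep G K R C S1 S2 v1 s1 y k1 k2 y2 s2 v2 t2 t1 x1 z x2 Pa M Pb W) (ht : S2 t2) (hg : EE G s2 t2)
    (h1 : Short G S1 v1 y) (h2 : Short G S2 v2 y2) (h12 : ¬ EE G v1 v2) : False := by
  obtain ⟨a, ha, va, ay⟩ := h1
  obtain ⟨a2, ha2, va2, ay2⟩ := h2
  have nR : ∀ v ∈ C, ¬ R v := fun v hv => E.nR hv
  have nk1 := s.nM k1 s.eM.head_mem
  have nk2 := s.nM k2 s.eM.last_mem
  have rk1 := nR k1 (s.memC.2 (by simp [s.eM.head_mem]))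
  have rk2 := nR k2 (s.memC.2 (by simp [s.eM.last_mem]))
  have s' := s
  obtain ⟨cyc, perm, eA, eM, eB, eW, b1, b2, nA, nM, nB, L1, L2, s1m, ym, t1m, s2m, y2m, x12, x1v, x2v, -, -, -, hk1, hk2, good, nt2, nt2', rp⟩ := s
  obtain ⟨r1, r2, r3, e1, e2, e3, e4⟩ := rp
  have K1 := fun v h => (L1 v h).1
  have K2 := fun v h => (L2 v h).1
  have R1 := fun v h => (L1 v h).2.1
  have R2 := fun v h => (L2 v h).2.1
  have A1 := fun v h => (L1 v h).2.2
  have A2 := fun v h => (L2 v h).2.2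
  have xK := E.Rl
  clear L1 L2
  refine model_B0 E.ctx (v1 := v1) (v2 := v2) (a := a) (a2 := a2) (x1 := x1) (z := z) (x2 := x2)
    (by simpa using cyc) (by simpa using perm) eA eM eB eW ?_ ?_ ?_ ?_ ?_ (nAdjR E ?_ ?_) ?_ ?_ ?_ ?_ ?_ ?_ ?_ ?_
  all_goals clear cyc perm eA eM eB eW nA nM nB nR s'
  all_goals simp [nAdj_iff, *]

theorem Sep.kk (E : Env G K R C) (s : Sep G K R C S1 S2 v1 s1 y k1 k2 y2 s2 v2 t2 t1 x1 z x2 Pa M Pb W) (ht : S2 t2) (hg : EE G s2 t2)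
    (h1 : Short G S1 v1 y) (h2 : Short G S2 v2 y2) (h12 : EE G v1 v2) (hkk : EE G k1 k2) : False := by
  obtain ⟨a, ha, va, ay⟩ := h1
  obtain ⟨a2, ha2, va2, ay2⟩ := h2
  have nR : ∀ v ∈ C, ¬ R v := fun v hv => E.nR hv
  have nk1 := s.nM k1 s.eM.head_mem
  have nk2 := s.nM k2 s.eM.last_mem
  have rk1 := nR k1 (s.memC.2 (by simp [s.eM.head_mem]))
  have rk2 := nR k2 (s.memC.2 (by simp [s.eM.last_mem]))
  have s' := s
  obtain ⟨cyc, perm, eA, eM, eB, eW, b1, b2, nA, nM, nB, L1, L2, s1m, ym, t1m, s2m, y2m, x12, x1v, x2v, -, -, -, hk1, hk2, good, nt2, nt2', rp⟩ := s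
  obtain ⟨r1, r2, r3, e1, e2, e3, e4⟩ := rp
  have K1 := fun v h => (L1 v h).1
  have K2 := fun v h => (L2 v h).1
  have R1 := fun v h => (L1 v h).2.1
  have R2 := fun v h => (L2 v h).2.1
  have A1 := fun v h => (L1 v h).2.2
  have A2 := fun v h => (L2 v h).2.2
  have xK := E.Rl
  clear L1 L2
  refine model_kk E.ctx (v1 := v1) (v2 := v2) (a := a) (a2 := a2) (x1 := x1) (z := z) (x2 := x2)
    (by simpa using cyc) (by simpa using perm) eA eM eB eW ?_ ?_ ?_ ?_ ?_ (nAdjR E ?_ ?_) ?_ ?_ ?_ ?_ ?_ ?_ ?_ ?_ ?_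
  all_goals clear cyc perm eA eM eB eW nA nM nB nR s'
  all_goals simp [nAdj_iff, *]

theorem Sep.c31 (E : Env G K R C) (s : Sep G K R C S1 S2 v1 s1 y k1 k2 y2 s2 v2 t2 t1 x1 z x2 Pa M Pb W) (ht : S2 t2) (hg : EE G s2 t2)
    (h1 : Long3 G S1 v1 y) (h2 : EE G v2 y2) (h12 : EE G v1 v2) : False := by
  obtain ⟨a, p, ha, hp, va, ap, py, vp, vy, nay⟩ := h1
  have nR : ∀ v ∈ C, ¬ R v := fun v hv => E.nR hv
  have nk1 := s.nM k1 s.eM.head_mem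
  have nk2 := s.nM k2 s.eM.last_mem
  have rk1 := nR k1 (s.memC.2 (by simp [s.eM.head_mem]))
  have rk2 := nR k2 (s.memC.2 (by simp [s.eM.last_mem]))
  have s' := s
  obtain ⟨cyc, perm, eA, eM, eB, eW, b1, b2, nA, nM, nB, L1, L2, s1m, ym, t1m, s2m, y2m, x12, x1v, x2v, -, -, -, hk1, hk2, good, nt2, nt2', rp⟩ := s
  obtain ⟨r1, r2, r3, e1, e2, e3, e4⟩ := rp
  have K1 := fun v h => (L1 v h).1
  have K2 := fun v h => (L2 v h).1
  have R1 := fun v h => (L1 v h).2.1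
  have R2 := fun v h => (L2 v h).2.1
  have A1 := fun v h => (L1 v h).2.2
  have A2 := fun v h => (L2 v h).2.2
  have xK := E.Rl
  clear L1 L2
  refine model_c31 E.ctx (v1 := v1) (v2 := v2) (a := a) (p := p) (x1 := x1) (z := z) (x2 := x2)
    (by simpa using cyc) (by simpa using perm) eA eM eB eW ?_ ?_ ?_ ?_ ?_ (nAdjR E ?_ ?_) ?_ ?_ ?_ ?_ ?_ ?_ ?_ ?_ ?_ ?_
  all_goals clear cyc perm eA eM eB eW nA nM nB nR s'
  all_goals simp [nAdj_iff, *]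

theorem Sep.k1v2 (E : Env G K R C) (s : Sep G K R C S1 S2 v1 s1 y k1 k2 y2 s2 v2 t2 t1 x1 z x2 Pa M Pb W) (ht : S2 t2) (hg : EE G s2 t2)
    (h1 : Short G S1 v1 y) (h2 : Short G S2 v2 y2) (h12 : EE G v1 v2)
    {c1 c2 : V} {Mc : List V} (hM : M = k1 :: (Mc ++ [k2]))
    (ec : Ends c1 c2 Mc) (hk : EE G k1 v2) : False := by
  obtain ⟨a, ha, va, ay⟩ := h1
  obtain ⟨a2, ha2, va2, ay2⟩ := h2
  subst hM
  have nc1 := s.nM c1 (by simp [ec.head_mem])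
  have nc2 := s.nM c2 (by simp [ec.last_mem])
  have rc1 := E.nR (v := c1) (s.memC.2 (by simp [ec.head_mem]))
  have rc2 := E.nR (v := c2) (s.memC.2 (by simp [ec.last_mem]))
  have nR : ∀ v ∈ C, ¬ R v := fun v hv => E.nR hv
  have nk1 := s.nM k1 s.eM.head_mem
  have nk2 := s.nM k2 s.eM.last_mem
  have rk1 := nR k1 (s.memC.2 (by simp [s.eM.head_mem]))
  have rk2 := nR k2 (s.memC.2 (by simp [s.eM.last_mem]))
  have s' := s
  obtain ⟨cyc, perm, eA, eM, eB, eW, b1, b2, nA, nM, nB, L1, L2, s1m, ym, t1m, s2m, y2m, x12, x1v, x2v, -, -, -, hk1, hk2, good, nt2, nt2', rp⟩ := s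
  obtain ⟨r1, r2, r3, e1, e2, e3, e4⟩ := rp
  have K1 := fun v h => (L1 v h).1
  have K2 := fun v h => (L2 v h).1
  have R1 := fun v h => (L1 v h).2.1
  have R2 := fun v h => (L2 v h).2.1
  have A1 := fun v h => (L1 v h).2.2
  have A2 := fun v h => (L2 v h).2.2
  have xK := E.Rl
  clear L1 L2
  refine model_k1v2c E.ctx (v1 := v1) (v2 := v2) (k1 := k1) (k2 := k2) (a := a) (a2 := a2) (x1 := x1) (z := z) (x2 := x2)
    (by simpa using cyc) (by simpa using perm) eA ec eB eW ?_ ?_ ?_ ?_ ?_ (nAdjR E ?_ ?_) ?_ ?_ ?_ ?_ ?_ ?_ ?_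
    (s'.adjImp E (by simp [ec.head_mem, ec.last_mem]) (by simp [*])) ?_ ?_
  all_goals clear cyc perm eA eM eB eW nA nM nB nR s'
  all_goals simp [nAdj_iff, *]

theorem Sep.lg (E : Env G K R C) (s : Sep G K R C S1 S2 v1 s1 y k1 k2 y2 s2 v2 t2 t1 x1 z x2 Pa M Pb W) (ht : S2 t2) (hg : EE G s2 t2)
    (h1 : Short G S1 v1 y) (h2 : Short G S2 v2 y2) (h12 : EE G v1 v2)
    {c1 c2 : V} {Mc : List V} (hM : M = k1 :: (Mc ++ [k2]))
    (ec : Ends c1 c2 Mc) (hkk : ¬ EE G k1 k2)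
    {g : V} (g1 : EE G k1 g) (g2 : EE G g k2) (n1 : ¬ EE G k1 v2) (n2 : ¬ EE G k2 v1)
    (hgK : ¬ K g) : False := by
  obtain ⟨a, ha, va, ay⟩ := h1
  obtain ⟨a2, ha2, va2, ay2⟩ := h2
  subst hM
  have nc1 := s.nM c1 (by simp [ec.head_mem])
  have nc2 := s.nM c2 (by simp [ec.last_mem])
  have rc1 := E.nR (v := c1) (s.memC.2 (by simp [ec.head_mem]))
  have rc2 := E.nR (v := c2) (s.memC.2 (by simp [ec.last_mem]))
  have nR : ∀ v ∈ C, ¬ R v := fun v hv => E.nR hv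
  have nk1 := s.nM k1 s.eM.head_mem
  have nk2 := s.nM k2 s.eM.last_mem
  have rk1 := nR k1 (s.memC.2 (by simp [s.eM.head_mem]))
  have rk2 := nR k2 (s.memC.2 (by simp [s.eM.last_mem]))
  have s' := s
  obtain ⟨cyc, perm, eA, eM, eB, eW, b1, b2, nA, nM, nB, L1, L2, s1m, ym, t1m, s2m, y2m, x12, x1v, x2v, -, -, -, hk1, hk2, good, nt2, nt2', rp⟩ := s
  obtain ⟨r1, r2, r3, e1, e2, e3, e4⟩ := rp
  have K1 := fun v h => (L1 v h).1
  have K2 := fun v h => (L2 v h).1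
  have R1 := fun v h => (L1 v h).2.1
  have R2 := fun v h => (L2 v h).2.1
  have A1 := fun v h => (L1 v h).2.2
  have A2 := fun v h => (L2 v h).2.2
  have xK := E.Rl
  clear L1 L2
  refine model_lg E.ctx (v1 := v1) (v2 := v2) (k1 := k1) (k2 := k2) (a := a) (a2 := a2) (x1 := x1) (z := z) (x2 := x2) (g := g)
    (by simpa using cyc) (by simpa using perm) eA ec eB eW ?_ ?_ ?_ ?_ ?_ (nAdjR E ?_ ?_) ?_ ?_ ?_ ?_ ?_ ?_ ?_
    (s'.adjImp E (by simp [ec.head_mem, ec.last_mem]) (by simp [*])) ?_ ?_ ?_ ?_ ?_ ?_ (s'.nboth' E hgK (by simp [*]) (by simp [*]))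
  all_goals clear cyc perm eA eM eB eW nA nM nB nR s'
  all_goals simp [nAdj_iff, *]

theorem Sep.gM (E : Env G K R C) (s : Sep G K R C S1 S2 v1 s1 y k1 k2 y2 s2 v2 t2 t1 x1 z x2 Pa M Pb W) (ht : S2 t2) (hg : EE G s2 t2)
    (h1 : Short G S1 v1 y) (h2 : Short G S2 v2 y2) (h12 : EE G v1 v2)
    {c1 c2 : V} {Mc : List V} (hM : M = k1 :: (Mc ++ [k2]))
    (ec : Ends c1 c2 Mc) (hkk : ¬ EE G k1 k2)
    {g : V} (g1 : EE G k1 g) (g2 : EE G g k2) (n1 : ¬ EE G k1 v2) (n2 : ¬ EE G k2 v1)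
    (hgK : K g) (hg1 : g ≠ c1) (hg2 : g ≠ c2) (hgm : g ∈ Mc) : False := by
  obtain ⟨a, ha, va, ay⟩ := h1
  obtain ⟨a2, ha2, va2, ay2⟩ := h2
  subst hM
  have nc1 := s.nM c1 (by simp [ec.head_mem])
  have nc2 := s.nM c2 (by simp [ec.last_mem])
  have rc1 := E.nR (v := c1) (s.memC.2 (by simp [ec.head_mem]))
  have rc2 := E.nR (v := c2) (s.memC.2 (by simp [ec.last_mem]))
  obtain ⟨l1, l2, gm, gp, rfl, eg1, eg2⟩ := split_mid ec hgm hg1 hg2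
  have mgm : gm ∈ C := s.memC.2 (by simp [eg1.last_mem])
  have mg : g ∈ C := s.memC.2 (by simp)
  have mgp : gp ∈ C := s.memC.2 (by simp [eg2.head_mem])
  have rgm := E.nR mgm
  have rg := E.nR mg
  have rgp := E.nR mgp
  have ngm := s.nM gm (by simp [eg1.last_mem])
  have ng := s.nM g (by simp)
  have ngp := s.nM gp (by simp [eg2.head_mem])
  have nR : ∀ v ∈ C, ¬ R v := fun v hv => E.nR hv
  have nk1 := s.nM k1 s.eM.head_mem
  have nk2 := s.nM k2 s.eM.last_mem
  have rk1 := nR k1 (s.memC.2 (by simp [s.eM.head_mem]))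
  have rk2 := nR k2 (s.memC.2 (by simp [s.eM.last_mem]))
  have s' := s
  obtain ⟨cyc, perm, eA, eM, eB, eW, b1, b2, nA, nM, nB, L1, L2, s1m, ym, t1m, s2m, y2m, x12, x1v, x2v, -, -, -, hk1, hk2, good, nt2, nt2', rp⟩ := s
  obtain ⟨r1, r2, r3, e1, e2, e3, e4⟩ := rp
  have K1 := fun v h => (L1 v h).1
  have K2 := fun v h => (L2 v h).1
  have R1 := fun v h => (L1 v h).2.1
  have R2 := fun v h => (L2 v h).2.1
  have A1 := fun v h => (L1 v h).2.2
  have A2 := fun v h => (L2 v h).2.2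
  have xK := E.Rl
  clear L1 L2
  refine model_gM E.ctx (v1 := v1) (v2 := v2) (k1 := k1) (k2 := k2) (a := a) (a2 := a2) (x1 := x1) (z := z) (x2 := x2) (g := g)
    (by simpa using cyc) (by simpa using perm) eA eg1 eg2 eB eW ?_ ?_ ?_ ?_ ?_ (nAdjR E ?_ ?_) ?_ ?_ ?_ ?_ ?_ ?_ ?_
    (s'.adjImp E (by simp [eg1.head_mem, eg1.last_mem, eg2.head_mem, eg2.last_mem]) (by simp [*])) ?_ ?_ ?_ ?_ ?_ ?_
  all_goals clear cyc perm eA eM eB eW nA nM nB nR s'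
  all_goals simp [nAdj_iff, *]

theorem Sep.gQ (E : Env G K R C) (s : Sep G K R C S1 S2 v1 s1 y k1 k2 y2 s2 v2 t2 t1 x1 z x2 Pa M Pb W) (ht : S2 t2) (hg : EE G s2 t2)
    (h1 : Short G S1 v1 y) (h2 : Short G S2 v2 y2) (h12 : EE G v1 v2)
    {c1 c2 : V} {Mc : List V} (hM : M = k1 :: (Mc ++ [k2]))
    (ec : Ends c1 c2 Mc) (hkk : ¬ EE G k1 k2)
    {g : V} (g1 : EE G k1 g) (g2 : EE G g k2) (n1 : ¬ EE G k1 v2) (n2 : ¬ EE G k2 v1)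
    (hgK : K g) (hgm : g ∈ W) : False := by
  obtain ⟨a, ha, va, ay⟩ := h1
  obtain ⟨a2, ha2, va2, ay2⟩ := h2
  subst hM
  have nc1 := s.nM c1 (by simp [ec.head_mem])
  have nc2 := s.nM c2 (by simp [ec.last_mem])
  have rc1 := E.nR (v := c1) (s.memC.2 (by simp [ec.head_mem]))
  have rc2 := E.nR (v := c2) (s.memC.2 (by simp [ec.last_mem]))
  obtain ⟨l1, l2, gm, gp, rfl, eg1, eg2⟩ := split_mid s.eW hgm (by rintro rfl; exact (s.L2 _ ht).1 hgK) (by rintro rfl; exact (s.L1 _ s.t1m).1 hgK)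
  have mgm : gm ∈ C := s.memC.2 (by simp [eg1.last_mem])
  have mg : g ∈ C := s.memC.2 (by simp)
  have mgp : gp ∈ C := s.memC.2 (by simp [eg2.head_mem])
  have rgm := E.nR mgm
  have rg := E.nR mg
  have rgp := E.nR mgp
  have nR : ∀ v ∈ C, ¬ R v := fun v hv => E.nR hv
  have nk1 := s.nM k1 s.eM.head_mem
  have nk2 := s.nM k2 s.eM.last_mem
  have rk1 := nR k1 (s.memC.2 (by simp [s.eM.head_mem]))
  have rk2 := nR k2 (s.memC.2 (by simp [s.eM.last_mem]))
  have s' := s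
  obtain ⟨cyc, perm, eA, eM, eB, eW, b1, b2, nA, nM, nB, L1, L2, s1m, ym, t1m, s2m, y2m, x12, x1v, x2v, -, -, -, hk1, hk2, good, nt2, nt2', rp⟩ := s
  obtain ⟨r1, r2, r3, e1, e2, e3, e4⟩ := rp
  have K1 := fun v h => (L1 v h).1
  have K2 := fun v h => (L2 v h).1
  have R1 := fun v h => (L1 v h).2.1
  have R2 := fun v h => (L2 v h).2.1
  have A1 := fun v h => (L1 v h).2.2
  have A2 := fun v h => (L2 v h).2.2
  have xK := E.Rl
  clear L1 L2
  refine model_gQ E.ctx (v1 := v1) (v2 := v2) (k1 := k1) (k2 := k2) (a := a) (a2 := a2) (x1 := x1) (z := z) (x2 := x2) (g := g)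
    (by simpa using cyc) (by simpa using perm) eA ec eB eg1 eg2 ?_ ?_ ?_ ?_ ?_ (nAdjR E ?_ ?_) (adjImpR E ?_ ?_) ?_ ?_ ?_ ?_ ?_ ?_ ?_
    (s'.adjImp E (by simp [ec.head_mem, ec.last_mem]) (by simp [*])) ?_ ?_ ?_ ?_ ?_ ?_
  all_goals clear cyc perm eA eM eB eW nA nM nB nR s'
  all_goals simp [nAdj_iff, *]

theorem Sep.gS (E : Env G K R C) (s : Sep G K R C S1 S2 v1 s1 y k1 k2 y2 s2 v2 t2 t1 x1 z x2 Pa M Pb W) (ht : S2 t2) (hg : EE G s2 t2)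
    (h1 : Short G S1 v1 y) (h2 : Short G S2 v2 y2) (h12 : EE G v1 v2)
    {c1 c2 : V} {Mc : List V} (hM : M = k1 :: (Mc ++ [k2]))
    (ec : Ends c1 c2 Mc) (hkk : ¬ EE G k1 k2)
    {g : V} (g1 : EE G k1 g) (g2 : EE G g k2) (n1 : ¬ EE G k1 v2) (n2 : ¬ EE G k2 v1)
    (hgK : K g) (hgm : g ∈ Pa) : False := by
  obtain ⟨a, ha, va, ay⟩ := h1
  obtain ⟨a2, ha2, va2, ay2⟩ := h2
  subst hM
  have nc1 := s.nM c1 (by simp [ec.head_mem])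
  have nc2 := s.nM c2 (by simp [ec.last_mem])
  have rc1 := E.nR (v := c1) (s.memC.2 (by simp [ec.head_mem]))
  have rc2 := E.nR (v := c2) (s.memC.2 (by simp [ec.last_mem]))
  obtain ⟨l1, l2, gm, gp, rfl, eg1, eg2⟩ := split_mid s.eA hgm (by rintro rfl; exact (s.L1 _ s.s1m).1 hgK) (by rintro rfl; exact (s.L1 _ s.ym).1 hgK)
  have mgm : gm ∈ C := s.memC.2 (by simp [eg1.last_mem])
  have mg : g ∈ C := s.memC.2 (by simp)
  have mgp : gp ∈ C := s.memC.2 (by simp [eg2.head_mem])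
  have rgm := E.nR mgm
  have rg := E.nR mg
  have rgp := E.nR mgp
  have ngm := s.nA gm (by simp [eg1.last_mem])
  have ng := s.nA g (by simp)
  have ngp := s.nA gp (by simp [eg2.head_mem])
  have nR : ∀ v ∈ C, ¬ R v := fun v hv => E.nR hv
  have nk1 := s.nM k1 s.eM.head_mem
  have nk2 := s.nM k2 s.eM.last_mem
  have rk1 := nR k1 (s.memC.2 (by simp [s.eM.head_mem]))
  have rk2 := nR k2 (s.memC.2 (by simp [s.eM.last_mem]))
  have s' := s
  obtain ⟨cyc, perm, eA, eM, eB, eW, b1, b2, nA, nM, nB, L1, L2, s1m, ym, t1m, s2m, y2m, x12, x1v, x2v, -, -, -, hk1, hk2, good, nt2, nt2', rp⟩ := s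
  obtain ⟨r1, r2, r3, e1, e2, e3, e4⟩ := rp
  have K1 := fun v h => (L1 v h).1
  have K2 := fun v h => (L2 v h).1
  have R1 := fun v h => (L1 v h).2.1
  have R2 := fun v h => (L2 v h).2.1
  have A1 := fun v h => (L1 v h).2.2
  have A2 := fun v h => (L2 v h).2.2
  have xK := E.Rl
  clear L1 L2
  refine model_gS E.ctx (v1 := v1) (v2 := v2) (k1 := k1) (k2 := k2) (a := a) (a2 := a2) (x1 := x1) (z := z) (x2 := x2) (g := g)
    (by simpa using cyc) (by simpa using perm) eg1 eg2 ec eB eW ?_ ?_ ?_ ?_ ?_ (nAdjR E ?_ ?_) ?_ ?_ ?_ ?_ ?_ ?_ ?_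
    (s'.adjImp E (by simp [ec.head_mem, ec.last_mem]) (by simp [*])) ?_ ?_ ?_ ?_ ?_ ?_
  all_goals clear cyc perm eA eM eB eW nA nM nB nR s'
  all_goals simp [nAdj_iff, *]

theorem Sep.case1 (E : Env G K R C) (s : Sep G K R C S1 S2 v1 s1 y k1 k2 y2 s2 v2 t2 t1 x1 z x2 Pa M Pb W) (ht : S2 t2) (hg : EE G s2 t2)
    (h1 : Short G S1 v1 y) (h2 : Short G S2 v2 y2) : False := by
  by_cases h12 : EE G v1 v2
  swap
  · exact s.B0 E ht hg h1 h2 h12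
  by_cases hkk : EE G k1 k2
  · exact s.kk E ht hg h1 h2 h12 hkk
  have s2 := s.symm ht hg
  obtain ⟨M1, hM1⟩ := s.eM.cons_of
  have hM1ne : M1 ≠ [] := by
    rintro rfl
    have := s.eM.2
    simp [hM1] at this
    exact hkk (.inl this)
  obtain ⟨p, q, e1⟩ := exists_ends hM1ne
  obtain rfl : q = k2 := by
    have := s.eM.2
    rw [hM1, List.getLast?_cons, e1.2] at this
    simpa using this
  obtain ⟨Mc, hMc⟩ := e1.concat_of
  have hM : M = k1 :: (Mc ++ [q]) := by rw [hM1, hMc]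
  have hMcne : Mc ≠ [] := by
    rintro rfl
    refine hkk (.of (chain_adj s.cyc.1 (v1 :: Pa) (Pb ++ v2 :: W) ?_))
    simp [hM]
  obtain ⟨c1, c2, ec⟩ := exists_ends hMcne
  have hMr : M.reverse = q :: (Mc.reverse ++ [k1]) := by simp [hM]
  have n1 : ¬ EE G k1 v2 := s.k1v2 E ht hg h1 h2 h12 hM ec
  have n2 : ¬ EE G q v1 := s2.k1v2 E s.t1m s.good h2 h1 h12.symm hMr ec.rev
  obtain ⟨g, hg1, hg2, a1, a2⟩ := E.common3 k1 q x1 s.hk1 s.hk2 hkk s.rp.r1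
    (Env.natt s.rp.r1 (E.nR (s.memC.2 (by simp [s.eM.head_mem]))) (s.nM _ s.eM.head_mem))
    (Env.natt s.rp.r1 (E.nR (s.memC.2 (by simp [s.eM.last_mem]))) (s.nM _ s.eM.last_mem)) c1 c2
  by_cases hgK : K g
  swap
  · exact s.lg E ht hg h1 h2 h12 hM ec hkk (.of a1) (.of a2.symm) n1 n2 hgK
  rcases s.memC.1 (E.KC g hgK) with h | h | h | h | h | h
  · exact n2 (h ▸ .of a2)
  · exact s.gS E ht hg h1 h2 h12 hM ec hkk (.of a1) (.of a2.symm) n1 n2 hgK h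
  · rw [hM] at h
    simp only [List.mem_cons, List.mem_append, List.not_mem_nil, or_false] at h
    rcases h with h | h | h
    · exact absurd (h ▸ a1) G.irrefl
    · exact s.gM E ht hg h1 h2 h12 hM ec hkk (.of a1) (.of a2.symm) n1 n2 hgK hg1 hg2 h
    · exact absurd (h ▸ a2) G.irrefl
  · exact s2.gS E s.t1m s.good h2 h1 h12.symm hMr ec.rev (fun h => hkk h.symm) (.of a2) (.of a1.symm) n2 n1 hgK (by simpa using h)
  · exact n1 (h ▸ .of a1)
  · exact s.gQ E ht hg h1 h2 h12 hM ec hkk (.of a1) (.of a2.symm) n1 n2 hgK h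
end

theorem caseI (E : Env G K R C) {v1 s1 s2 v2 t2 t1 : V} {P W : List V} (b : Base G K R C v1 s1 s2 v2 t2 t1 P W)
    (hP : ∀ v ∈ P, ¬ Att G R v) (hs2 : Lt G K R s2) (ht2 : Lt G K R t2) (hg : EE G s2 t2) : False := by
  by_cases hS : Comp G (Lt G K R) s1 s2
  · obtain ⟨-, x, hx, ex⟩ := id b.a1
    obtain ⟨h1, r, hr, hrS, r1, r2⟩ := light E b hS hx ex
    exact light2 E b.mirror ht2 hrS.mem (by simpa using hr) r1 r2 hx ex h1
  · obtain ⟨y, k1, k2, y2, x1, z, x2, Pa, M, Pb, s, -, h⟩ := sepData E b hP hs2 hS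
    have ht : Comp G (Lt G K R) s2 t2 := (Comp.self hs2).step ht2 hg
    rcases h with ⟨h1, h2⟩ | ⟨h12, h1, h2⟩ | ⟨h12, h1, h2⟩
    · exact s.case1 E ht hg h1 h2
    · exact s.c31 E ht hg h1 h2 (.of h12)
    · exact (s.symm ht hg).c31 E s.t1m s.good h2 h1 (.of h12.symm)
end HamADH

set_option linter.unusedSimpArgs false
set_option linter.unusedVariables false
open SimpleGraph
namespace HamADH
variable {V : Type*} {G : SimpleGraph V} {K R : V → Prop} {C : List V}
section
variable {S1 S2 : V → Prop} {v1 s1 y k1 k2 y2 s2 v2 t2 t1 x1 z x2 : V} {Pa M Pb W : List V}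

theorem Sep.am1 (E : Env G K R C) (s : Sep G K R C S1 S2 v1 s1 y k1 k2 y2 s2 v2 t2 t1 x1 z x2 Pa M Pb W) (ht : K t2) (h1 : Short G S1 v1 y) (h2 : Short G S2 v2 y2) (hM : M = [k1]) : False := by
  obtain ⟨a, ha, va, ay⟩ := h1
  obtain ⟨a2, ha2, va2, ay2⟩ := h2
  subst hM
  have nR : ∀ v ∈ C, ¬ R v := fun v hv => E.nR hv
  have nk1 := s.nM k1 s.eM.head_mem
  have nk2 := s.nM k2 s.eM.last_mem
  have rk1 := nR k1 (s.memC.2 (by simp [s.eM.head_mem]))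
  have rk2 := nR k2 (s.memC.2 (by simp [s.eM.last_mem]))
  have s' := s
  obtain ⟨cyc, perm, eA, eM, eB, eW, b1, b2, nA, nM, nB, L1, L2, s1m, ym, t1m, s2m, y2m, x12, x1v, x2v, -, -, -, hk1, hk2, good, nt2, nt2', rp⟩ := s
  obtain ⟨r1, r2, r3, e1, e2, e3, e4⟩ := rp
  have K1 := fun v h => (L1 v h).1
  have K2 := fun v h => (L2 v h).1
  have R1 := fun v h => (L1 v h).2.1
  have R2 := fun v h => (L2 v h).2.1
  have A1 := fun v h => (L1 v h).2.2
  have A2 := fun v h => (L2 v h).2.2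
  have xK := E.Rl
  clear L1 L2
  refine model_a1 E.ctx (v1 := v1) (v2 := v2) (a := a) (a2 := a2) (x1 := x1) (z := z) (x2 := x2)
    (by simpa using cyc) (by simpa using perm) eA eB eW ?_ ?_ ?_ ?_ ?_ (nAdjR E ?_ ?_) ?_ ?_ ?_ ?_ ?_ ?_ ?_
  all_goals clear cyc perm eA eM eB eW nA nM nB nR s'
  all_goals simp [nAdj_iff, *]

theorem Sep.amc (E : Env G K R C) (s : Sep G K R C S1 S2 v1 s1 y k1 k2 y2 s2 v2 t2 t1 x1 z x2 Pa M Pb W) (ht : K t2) (h1 : Short G S1 v1 y) (h2 : Short G S2 v2 y2)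
    {c1 : V} {Mc : List V} (hM : M = k1 :: Mc) (ec : Ends c1 k2 Mc) : False := by
  obtain ⟨a, ha, va, ay⟩ := h1
  obtain ⟨a2, ha2, va2, ay2⟩ := h2
  subst hM
  have nc1 := s.nM c1 (by simp [ec.head_mem])
  have rc1 := E.nR (v := c1) (s.memC.2 (by simp [ec.head_mem]))
  have nR : ∀ v ∈ C, ¬ R v := fun v hv => E.nR hv
  have nk1 := s.nM k1 s.eM.head_mem
  have nk2 := s.nM k2 s.eM.last_mem
  have rk1 := nR k1 (s.memC.2 (by simp [s.eM.head_mem]))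
  have rk2 := nR k2 (s.memC.2 (by simp [s.eM.last_mem]))
  have s' := s
  obtain ⟨cyc, perm, eA, eM, eB, eW, b1, b2, nA, nM, nB, L1, L2, s1m, ym, t1m, s2m, y2m, x12, x1v, x2v, -, -, -, hk1, hk2, good, nt2, nt2', rp⟩ := s
  obtain ⟨r1, r2, r3, e1, e2, e3, e4⟩ := rp
  have K1 := fun v h => (L1 v h).1
  have K2 := fun v h => (L2 v h).1
  have R1 := fun v h => (L1 v h).2.1
  have R2 := fun v h => (L2 v h).2.1
  have A1 := fun v h => (L1 v h).2.2
  have A2 := fun v h => (L2 v h).2.2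
  have xK := E.Rl
  clear L1 L2
  refine model_ac E.ctx (v1 := v1) (v2 := v2) (k1 := k1) (a := a) (a2 := a2) (x1 := x1) (z := z) (x2 := x2)
    (by simpa using cyc) (by simpa using perm) eA ec eB eW ?_ ?_ ?_ ?_ ?_ (nAdjR E ?_ ?_) ?_ ?_ ?_ ?_ ?_ ?_ ?_
    (s'.adjImp E (by simp [ec.head_mem]) (by simp [*]))
  all_goals clear cyc perm eA eM eB eW nA nM nB nR s'
  all_goals simp [nAdj_iff, *]

theorem Sep.a31 (E : Env G K R C) (s : Sep G K R C S1 S2 v1 s1 y k1 k2 y2 s2 v2 t2 t1 x1 z x2 Pa M Pb W) (ht : K t2) (h1 : Long3 G S1 v1 y) (h2 : EE G v2 y2) : False := by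
  obtain ⟨a, p, ha, hp, va, ap, py, vp, vy, nay⟩ := h1
  have nR : ∀ v ∈ C, ¬ R v := fun v hv => E.nR hv
  have nk1 := s.nM k1 s.eM.head_mem
  have nk2 := s.nM k2 s.eM.last_mem
  have rk1 := nR k1 (s.memC.2 (by simp [s.eM.head_mem]))
  have rk2 := nR k2 (s.memC.2 (by simp [s.eM.last_mem]))
  have s' := s
  obtain ⟨cyc, perm, eA, eM, eB, eW, b1, b2, nA, nM, nB, L1, L2, s1m, ym, t1m, s2m, y2m, x12, x1v, x2v, -, -, -, hk1, hk2, good, nt2, nt2', rp⟩ := s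
  obtain ⟨r1, r2, r3, e1, e2, e3, e4⟩ := rp
  have K1 := fun v h => (L1 v h).1
  have K2 := fun v h => (L2 v h).1
  have R1 := fun v h => (L1 v h).2.1
  have R2 := fun v h => (L2 v h).2.1
  have A1 := fun v h => (L1 v h).2.2
  have A2 := fun v h => (L2 v h).2.2
  have xK := E.Rl
  clear L1 L2
  refine model_a31 E.ctx (v1 := v1) (v2 := v2) (a := a) (p := p) (x1 := x1) (z := z) (x2 := x2)
    (by simpa using cyc) (by simpa using perm) eA eM eB eW ?_ ?_ ?_ ?_ ?_ (nAdjR E ?_ ?_) ?_ ?_ ?_ ?_ ?_ ?_ ?_ ?_ ?_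
  all_goals clear cyc perm eA eM eB eW nA nM nB nR s'
  all_goals simp [nAdj_iff, *]

theorem Sep.a13 (E : Env G K R C) (s : Sep G K R C S1 S2 v1 s1 y k1 k2 y2 s2 v2 t2 t1 x1 z x2 Pa M Pb W) (ht : K t2) (h1 : EE G v1 y) (h2 : Long3 G S2 v2 y2) : False := by
  obtain ⟨a, p, ha, hp, va, ap, py, vp, vy, nay⟩ := h2
  have nR : ∀ v ∈ C, ¬ R v := fun v hv => E.nR hv
  have nk1 := s.nM k1 s.eM.head_mem
  have nk2 := s.nM k2 s.eM.last_mem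
  have rk1 := nR k1 (s.memC.2 (by simp [s.eM.head_mem]))
  have rk2 := nR k2 (s.memC.2 (by simp [s.eM.last_mem]))
  have s' := s
  obtain ⟨cyc, perm, eA, eM, eB, eW, b1, b2, nA, nM, nB, L1, L2, s1m, ym, t1m, s2m, y2m, x12, x1v, x2v, -, -, -, hk1, hk2, good, nt2, nt2', rp⟩ := s
  obtain ⟨r1, r2, r3, e1, e2, e3, e4⟩ := rp
  have K1 := fun v h => (L1 v h).1
  have K2 := fun v h => (L2 v h).1
  have R1 := fun v h => (L1 v h).2.1
  have R2 := fun v h => (L2 v h).2.1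
  have A1 := fun v h => (L1 v h).2.2
  have A2 := fun v h => (L2 v h).2.2
  have xK := E.Rl
  clear L1 L2
  refine model_a13 E.ctx (v1 := v1) (v2 := v2) (a2 := a) (p2 := p) (x1 := x1) (z := z) (x2 := x2)
    (by simpa using cyc) (by simpa using perm) eA eM eB eW ?_ ?_ ?_ ?_ ?_ (nAdjR E ?_ ?_) ?_ ?_ ?_ ?_ ?_ ?_ ?_ ?_ ?_
  all_goals clear cyc perm eA eM eB eW nA nM nB nR s'
  all_goals simp [nAdj_iff, *]

end

/-- A good attachment `v1`, with `w2` light and outside the component of `s1`, and `t2` heavy. -/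
theorem caseA (E : Env G K R C) {v1 s1 s2 v2 t2 t1 : V} {P W : List V} (b : Base G K R C v1 s1 s2 v2 t2 t1 P W)
    (hP : ∀ v ∈ P, ¬ Att G R v) (hs2 : Lt G K R s2) (ht2 : K t2) : Comp G (Lt G K R) s1 s2 := by
  by_contra hS
  obtain ⟨y, k1, k2, y2, x1, z, x2, Pa, M, Pb, s, -, h⟩ := sepData E b hP hs2 hS
  rcases h with ⟨h1, h2⟩ | ⟨h12, h1, h2⟩ | ⟨h12, h1, h2⟩
  · obtain ⟨M1, hM1⟩ := s.eM.cons_of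
    rcases eq_or_ne M1 [] with rfl | hM1ne
    · exact s.am1 E ht2 h1 h2 hM1
    · obtain ⟨p, q, e1⟩ := exists_ends hM1ne
      obtain rfl : q = k2 := by
        have := s.eM.2
        rw [hM1, List.getLast?_cons, e1.2] at this
        simpa using this
      exact s.amc E ht2 h1 h2 hM1 e1
  · exact s.a31 E ht2 h1 h2
  · exact s.a13 E ht2 h1 h2

/-- Three attachments `v1`, `v2`, `v3`, with `v1` good. -/
structure Tri (G : SimpleGraph V) (K R : V → Prop) (C : List V) (v1 s1 w2 v2 u2 w3 v3 u3 t1 : V) (P Q T : List V) : Prop where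
  cyc : Cyc G.Adj (v1 :: (P ++ v2 :: (Q ++ v3 :: T)))
  perm : (v1 :: (P ++ v2 :: (Q ++ v3 :: T))).Perm C
  eP : Ends s1 w2 P
  eQ : Ends u2 w3 Q
  eT : Ends u3 t1 T
  a1 : Att G R v1
  a2 : Att G R v2
  a3 : Att G R v3
  l1 : Lt G K R s1
  l1' : Lt G K R t1
  good : EE G s1 t1
  nP : ∀ v ∈ P, ¬ Att G R v
  nT : ∀ v ∈ T, ¬ Att G R v

section
variable {v1 s1 w2 v2 u2 w3 v3 u3 t1 : V} {P Q T : List V}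
theorem Tri.base (t : Tri G K R C v1 s1 w2 v2 u2 w3 v3 u3 t1 P Q T) : Base G K R C v1 s1 w2 v2 u2 t1 P (Q ++ v3 :: T) where
  cyc := t.cyc
  perm := t.perm
  eP := t.eP
  eW := ⟨by rw [List.head?_append_of_ne_nil _ t.eQ.ne]; exact t.eQ.1,
    by simp [List.getLast?_append, List.getLast?_cons, t.eT.2]⟩
  a1 := t.a1
  a2 := t.a2
  l1 := t.l1
  l1' := t.l1'
  good := t.good

theorem Tri.mirror (t : Tri G K R C v1 s1 w2 v2 u2 w3 v3 u3 t1 P Q T) :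
    Tri G K R C v1 t1 u3 v3 w3 u2 v2 w2 s1 T.reverse Q.reverse P.reverse where
  cyc := by simpa using cyc_mirror t.cyc
  perm := by simpa using perm_mirror t.perm
  eP := t.eT.rev
  eQ := t.eQ.rev
  eT := t.eP.rev
  a1 := t.a1
  a2 := t.a3
  a3 := t.a2
  l1 := t.l1'
  l1' := t.l1
  good := t.good.symm
  nP := fun v h => t.nT v (by simpa using h)
  nT := fun v h => t.nP v (by simpa using h)

theorem Tri.memC (t : Tri G K R C v1 s1 w2 v2 u2 w3 v3 u3 t1 P Q T) {v : V} :
    v ∈ C ↔ v = v1 ∨ v ∈ P ∨ v = v2 ∨ v ∈ Q ∨ v = v3 ∨ v ∈ T := by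
  rw [← t.perm.mem_iff]; simp

theorem caseIIa (E : Env G K R C) (t : Tri G K R C v1 s1 w2 v2 u2 w3 v3 u3 t1 P Q T) (ku2 : K u2) (kw3 : K w3)
    (lw2 : Lt G K R w2) (lu3 : Lt G K R u3) : False := by
  have h2 := caseA E t.base t.nP lw2 ku2
  have h3 := caseA E t.mirror.base t.mirror.nP lu3 kw3
  obtain ⟨-, x, hx, ex⟩ := id t.a1
  obtain ⟨xv2, q, hqP, hqS, q1, q2⟩ := light E t.base h2 hx ex
  obtain ⟨xv3, p, hpT, hpS, p1, p2⟩ := light E t.mirror.base h3 hx ex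
  obtain ⟨nu2, ru2⟩ := t.base.nt2 E
  obtain ⟨nw3, rw3⟩ := t.mirror.base.nt2 E
  obtain ⟨hq1, hq2, hq3⟩ := hqS.mem
  obtain ⟨hp1, hp2, hp3⟩ := hpS.mem
  obtain ⟨lw21, lw22, lw23⟩ := lw2
  obtain ⟨lu31, lu32, lu33⟩ := lu3
  have xK := E.Rl
  have := EE.of ex.symm
  have := EE.of xv2
  have := EE.of xv3
  have := EE.of q1.symm
  have := EE.of q2
  have := EE.of p1.symm
  have := EE.of p2
  have nC : ∀ v ∈ P, v ∈ C := fun v hv => t.memC.2 (by tauto)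
  obtain ⟨cyc, perm, eP, eQ, eT, a1, a2, a3, ⟨l11, l12, l13⟩, ⟨l11', l12', l13'⟩, good, nP, nT⟩ := t
  obtain ⟨P1, P2, rfl⟩ := List.append_of_mem hqP
  rcases eq_or_ne P2 [] with rfl | hP2
  · obtain rfl : w2 = q := by have := eP.2; simp at this; exact this.symm
    refine model_ac2 E.ctx (v1 := v1) (v2 := v2) (v3 := v3) (x := x) (p := p) (by simpa using cyc) (by simpa using perm) eP eQ eT
      ?_ ?_ (nAdjR E ?_ ?_) ?_ ?_ ?_ ?_ ?_ ?_ ?_ ?_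
    all_goals clear cyc perm eP eQ eT nP nT nC
    all_goals simp [nAdj_iff, *]
  · obtain ⟨c, d, e⟩ := exists_ends hP2
    have ed : d = w2 := by
      have := eP.2; simp [List.getLast?_append, List.getLast?_cons, e.2] at this; exact this
    subst ed
    have hc : c ∈ C := nC c (by simp [e.head_mem])
    have eP1 : Ends s1 q (P1 ++ [q]) := by
      refine ⟨?_, by simp⟩
      have := eP.1
      rcases P1 with _ | ⟨c, l1⟩ <;> simpa using this
    refine model_ac1 E.ctx (v1 := v1) (v2 := v2) (v3 := v3) (x := x) (p := p) (by simpa using cyc) (by simpa using perm) eP1 e eQ eT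
      ?_ ?_ (nAdjR E ?_ ?_) (adjImpR E ?_ ?_) ?_ ?_ ?_ ?_ ?_ ?_ ?_ ?_
    all_goals clear cyc perm eP eQ eT nP nT nC
    all_goals simp [nAdj_iff, *]
end
end HamADH

set_option linter.unusedSimpArgs false
set_option linter.unusedVariables false
open SimpleGraph
namespace HamADH
variable {V : Type*} {G : SimpleGraph V} {K R : V → Prop} {C : List V}
section
variable {v1 s1 w2 v2 u2 w3 v3 u3 t1 : V} {P Q T : List V}

theorem caseIIb1 (E : Env G K R C) (t : Tri G K R C v1 s1 w2 v2 u2 w3 v3 u3 t1 P Q T) (kw2 : K w2) (ku3 : K u3)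
    (lu2 : Lt G K R u2) (lw3 : Lt G K R w3) (hS : Comp G (Lt G K R) s1 u2) : False := by
  obtain ⟨-, x, hx, ex⟩ := id t.a1
  obtain ⟨xv2, q, hqW, hqS, q1, q2⟩ := light E t.base.mirror (t.base.t1S.symm.trans hS) hx ex
  have hqL := hqS.mem
  have hqW : q ∈ Q ∨ q ∈ T := by
    have : q ≠ v3 := (t.a3.ne hqL).symm
    simp at hqW
    tauto
  obtain ⟨nw2, rw2⟩ := t.base.ns2 E
  obtain ⟨nu3, ru3⟩ := t.mirror.base.ns2 E
  obtain ⟨hq1, hq2, hq3⟩ := hqL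
  obtain ⟨lu21, lu22, lu23⟩ := lu2
  obtain ⟨lw31, lw32, lw33⟩ := lw3
  have xK := E.Rl
  have := EE.of ex.symm
  have := EE.of xv2
  have := EE.of q1.symm
  have := EE.of q2
  have nC : ∀ v, v ∈ Q ∨ v ∈ T → v ∈ C := fun v hv => t.memC.2 (by tauto)
  have hv3 : v3 ∈ C := t.memC.2 (by tauto)
  obtain ⟨cyc, perm, eP, eQ, eT, a1, a2, a3, ⟨l11, l12, l13⟩, ⟨l11', l12', l13'⟩, good, nP, nT⟩ := t
  rcases hqW with hqQ | hqT
  · obtain ⟨Q1, Q2, rfl⟩ := List.append_of_mem hqQ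
    rcases eq_or_ne Q2 [] with rfl | hQ2
    · obtain rfl : w3 = q := by have := eQ.2; simp at this; exact this.symm
      refine model_bc2 E.ctx (v1 := v1) (v2 := v2) (v3 := v3) (x := x) (by simpa using cyc) (by simpa using perm) eP eQ eT
        ?_ ?_ (nAdjR E ?_ ?_) (adjImpR E ?_ ?_) ?_ ?_ ?_ ?_ ?_
      all_goals clear cyc perm eP eQ eT nP nT nC
      all_goals simp [nAdj_iff, *]
    · obtain ⟨c, d, e⟩ := exists_ends hQ2
      have ed : d = w3 := by
        have := eQ.2; simp [List.getLast?_append, List.getLast?_cons, e.2] at this; exact this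
      subst ed
      have hc : c ∈ C := nC c (by simp [e.head_mem])
      have eQ1 : Ends u2 q (Q1 ++ [q]) := by
        refine ⟨?_, by simp⟩
        have := eQ.1
        rcases Q1 with _ | ⟨c, l1⟩ <;> simpa using this
      refine model_bc1 E.ctx (v1 := v1) (v2 := v2) (v3 := v3) (x := x) (by simpa using cyc) (by simpa using perm) eP eQ1 e eT
        ?_ ?_ (nAdjR E ?_ ?_) (adjImpR E ?_ ?_) ?_ ?_ ?_ ?_ ?_
      all_goals clear cyc perm eP eQ eT nP nT nC
      all_goals simp [nAdj_iff, *]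
  · obtain ⟨T1, T2, rfl⟩ := List.append_of_mem hqT
    rcases eq_or_ne T1 [] with rfl | hT1
    · obtain rfl : u3 = q := ends_cons eT
      exact hq1 ku3
    obtain ⟨c, d, e⟩ := exists_ends hT1
    have ec : c = u3 := by
      have := eT.1; rw [List.head?_append_of_ne_nil _ hT1, e.1] at this; simpa using this
    subst ec
    have hd : d ∈ C := nC d (by simp [e.last_mem])
    have eT2 : Ends q t1 (q :: T2) := ⟨by simp, by
      have := eT.2; simp [List.getLast?_append, List.getLast?_cons] at this ⊢; exact this⟩
    refine model_bc3 E.ctx (v1 := v1) (v2 := v2) (v3 := v3) (x := x) (by simpa using cyc) (by simpa using perm) eP eQ e eT2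
      ?_ ?_ (nAdjR E ?_ ?_) (adjImpR E ?_ ?_) ?_ ?_ ?_ ?_ ?_
    all_goals clear cyc perm eP eQ eT nP nT nC
    all_goals simp [nAdj_iff, *]

theorem caseIIb2 (E : Env G K R C) (t : Tri G K R C v1 s1 w2 v2 u2 w3 v3 u3 t1 P Q T) (kw2 : K w2) (ku3 : K u3)
    (lu2 : Lt G K R u2) (lw3 : Lt G K R w3) (hS : ¬ Comp G (Lt G K R) s1 u2) : False := by
  have b := t.base
  set S1 := Comp G (Lt G K R) s1 with hS1
  have s1m : S1 s1 := Comp.self t.l1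
  have t1m : S1 t1 := t.base.t1S
  have c1 : ∀ u w, S1 u → Lt G K R w → EE G u w → S1 w := fun u w h1 h2 h3 => h1.step h2 h3
  have L1 : ∀ v, S1 v → Lt G K R v := fun v h => h.mem
  have x12 : ∀ u, S1 u → ¬ EE G u u2 := fun u h1 h3 => hS (c1 u u2 h1 lu2 h3)
  have x1v : ∀ u, S1 u → ¬ EE G u v2 := fun u h1 h2 =>
    x12 u h1 (E.clq b.a2 (L1 u h1) lu2 h2.symm (.of b.vt2))
  have x2v : ¬ EE G v1 u2 := fun h2 => x12 s1 s1m (E.clq b.a1 b.l1 lu2 (.of b.vs1) h2)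
  obtain ⟨l1, y, M, rfl, ym, hM⟩ := split_last S1 ⟨s1, b.eP.head_mem, s1m⟩
  have hMne : M ≠ [] := by
    rintro rfl
    have := b.eP.2
    simp at this
    exact (L1 y ym).1 (this ▸ kw2)
  obtain ⟨k1, k2, eM⟩ := exists_ends hMne
  obtain rfl : k2 = w2 := by
    have := b.eP.2; simp [List.getLast?_append, List.getLast?_cons, eM.2] at this; exact this
  have eA : Ends s1 y (l1 ++ [y]) := by
    refine ⟨?_, by simp⟩
    have := b.eP.1
    rcases l1 with _ | ⟨c, l1⟩ <;> simpa using this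
  obtain ⟨M1, hM1⟩ := eM.cons_of
  have ch := b.cyc.1
  have ey : G.Adj y k1 := chain_adj ch (v1 :: l1) (M1 ++ v2 :: (Q ++ v3 :: T)) (by simp [hM1])
  have mL : ∀ c ∈ M, ¬ K c → Lt G K R c := fun c hc h =>
    ⟨h, E.nR (t.memC.2 (by simp [hc])), t.nP c (by simp [hc])⟩
  have hk1 : K k1 := by
    by_contra h
    exact hM k1 eM.head_mem (c1 y k1 ym (mL _ eM.head_mem h) (.of ey))
  have hne : v1 ≠ v2 := by
    have := b.perm.nodup_iff.2 E.nodup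
    intro h; simp [h] at this
  obtain ⟨-, x, hx, ex⟩ := id b.a1
  obtain ⟨-, x', hx', ex'⟩ := id b.a2
  have hconn : Conn G (fun v => S1 v ∨ v = v1 ∨ R v ∨ v = v2) :=
    (Comp.conn).union ((Conn.single v1).union (E.Rconn.union (Conn.single v2)
      hx' rfl ex') rfl (.inl hx) ex.symm) s1m (.inl rfl) b.vs1.symm
  have near : Near G 4 y v2 := by
    obtain ⟨c, h1, d, h2, rfl⟩ := E.heavy k1 k2 hk1 kw2
    exact ⟨k1, .of ey, c, h1, d, h2, v2, .of b.vs2.symm, rfl⟩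
  obtain ⟨n, hn, w⟩ := E.adhset _ hconn y v2 4 (.inl ym) (.inr (.inr (.inr rfl))) near
  obtain ⟨r, m, a', he, wA, hA', eA', w⟩ := Wk.cut (X := S1) (v := v1) (by
    rintro a b ha (hb | hb | hb | hb) hab
    · exact .inl hb
    · exact .inr hb
    · exact absurd (EE.of hab.symm) (Env.natt hb (L1 a ha).2.1 (L1 a ha).2.2)
    · exact absurd (hb ▸ EE.of hab) (x1v a ha)) w ym (fun h => b.a2.ne (L1 _ h) rfl)
  have hm : 1 ≤ m := by
    rcases m with _ | m
    · exact absurd w hne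
    · omega
  obtain ⟨x1, z, x2, rp⟩ := rpath E (S2 := fun _ => False) b.a1 b.a2 hne L1 (by simp) (by simp) x1v (by simp) (m := m) (by omega)
    (w.mono (by tauto))
  obtain ⟨nu3, ru3⟩ := t.mirror.base.ns2 E
  have nk1 := t.nP k1 (by simp [eM.head_mem])
  have nk2 := t.nP k2 (by simp [eM.last_mem])
  have rk1 := E.nR (v := k1) (t.memC.2 (by simp [eM.head_mem]))
  have rk2 := E.nR (v := k2) (t.memC.2 (by simp [eM.last_mem]))
  have hv3 : v3 ∈ C := t.memC.2 (by tauto)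
  have nMA : ∀ c ∈ M, ¬ Att G R c ∧ ¬ R c := fun c hc => ⟨t.nP c (by simp [hc]), E.nR (v := c) (t.memC.2 (by simp [hc]))⟩
  obtain ⟨cyc, perm, eP, eQ, eT, a1, a2, a3, -, -, good, -, -⟩ := t
  obtain ⟨lu21, lu22, lu23⟩ := lu2
  obtain ⟨lw31, lw32, lw33⟩ := lw3
  obtain ⟨r1, r2, r3, e1, e2, e3, e4⟩ := rp
  have K1 := fun v h => (L1 v h).1
  have R1 := fun v h => (L1 v h).2.1
  have A1 := fun v h => (L1 v h).2.2
  have xK := E.Rl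
  clear_value S1
  rcases chainDich wA ym eA' (by omega) with ⟨a, ha, va, ay⟩ | ⟨hr, a, p, ha, hp, va, ap, py, vp, vy, nay⟩ |
    ⟨hr, a, p, o, ha, hp, ho, va, ap, po, oy, vp, vo, vy, nao, nay, npy⟩
  · by_cases hkk : EE G k1 k2
    · refine model_bkk E.ctx (v1 := v1) (v2 := v2) (v3 := v3) (a := a) (x1 := x1) (z := z) (x2 := x2)
        (by simpa using cyc) (by simpa using perm) eA eM eQ eT ?_ ?_ ?_ ?_ ?_ (nAdjR E ?_ ?_) (adjImpR E ?_ ?_) ?_ ?_ ?_ ?_ ?_ ?_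
      all_goals clear cyc perm eA eM eQ eT eP ch b L1 mL near hconn w wA hS1 nMA hM
      all_goals simp [nAdj_iff, *]
    · have hM1ne : M1 ≠ [] := by
        rintro rfl
        have := eM.2
        simp [hM1] at this
        exact hkk (.inl this)
      obtain ⟨p, q, ec⟩ := exists_ends hM1ne
      obtain rfl : q = k2 := by
        have := eM.2
        rw [hM1, List.getLast?_cons, ec.2] at this
        simpa using this
      obtain ⟨np, rp⟩ := nMA p (by simp [hM1, ec.head_mem])
      have hpK : ∀ u, S1 u → EE G p u → K p := by
        intro u hu e
        by_contra h
        exact hM p (by simp [hM1, ec.head_mem]) (c1 u p hu (mL _ (by simp [hM1, ec.head_mem]) h) e.symm)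
      subst hM1
      refine model_bc E.ctx (v1 := v1) (v2 := v2) (v3 := v3) (k1 := k1) (a := a) (x1 := x1) (z := z) (x2 := x2)
        (by simpa using cyc) (by simpa using perm) eA ec eQ eT ?_ ?_ ?_ ?_ ?_ (nAdjR E ?_ ?_) (adjImpR E ?_ ?_) ?_ ?_ ?_ ?_ ?_
        (by
          intro c hc u hu
          obtain rfl : c = p := by simpa using hc
          refine hpK u ?_
          simp at hu
          rcases hu with rfl | rfl | rfl | rfl <;> assumption)
      all_goals clear cyc perm eA eM eQ eT eP ch b L1 mL near hconn w wA hS1 nMA hM hpK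
      all_goals simp [nAdj_iff, *]
  · refine model_b3 E.ctx (v1 := v1) (v2 := v2) (v3 := v3) (a := a) (p := p) (x1 := x1) (z := z) (x2 := x2)
      (by simpa using cyc) (by simpa using perm) eA eM eQ eT ?_ ?_ ?_ ?_ ?_ (nAdjR E ?_ ?_) (adjImpR E ?_ ?_) ?_ ?_ ?_ ?_ ?_ ?_ ?_
    all_goals clear cyc perm eA eM eQ eT eP ch b L1 mL near hconn w wA hS1 nMA hM
    all_goals simp [nAdj_iff, *]
  · refine model_b4 E.ctx (v1 := v1) (v2 := v2) (v3 := v3) (a := a) (p := p) (o := o) (x1 := x1) (z := z) (x2 := x2)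
      (by simpa using cyc) (by simpa using perm) eA eM eQ eT ?_ ?_ ?_ ?_ ?_ (nAdjR E ?_ ?_) (adjImpR E ?_ ?_) ?_ ?_ ?_ ?_ ?_ ?_ ?_ ?_
    all_goals clear cyc perm eA eM eQ eT eP ch b L1 mL near hconn w wA hS1 nMA hM
    all_goals simp [nAdj_iff, *]
end
end HamADH

set_option linter.unusedSimpArgs false
set_option linter.unusedVariables false
open SimpleGraph
namespace HamADH
variable {V : Type*} {G : SimpleGraph V} {K R : V → Prop} {C : List V}
variable {v1 s1 s2 v2 t2 t1 : V} {P W : List V}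

theorem pairS (E : Env G K R C) (hc : Cyc G.Adj (v1 :: (P ++ v2 :: W))) (hp : (v1 :: (P ++ v2 :: W)).Perm C)
    (eP : Ends s1 s2 P) (eW : Ends t2 t1 W) (a1 : Att G R v1) (a2 : Att G R v2) (k1 : K s1) (k2 : K t2) : False := by
  obtain ⟨P', rfl⟩ := eP.cons_of
  obtain ⟨W', rfl⟩ := eW.cons_of
  have h := hc.1
  refine E.noHam (((s1 :: P') ++ [v2]).reverse ++ ((t2 :: W') ++ [v1])) v2 v1 ?_ ?_ (by simp) (by simp [List.getLast?_cons]) a2 a1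
  · refine List.Perm.trans ?_ hp
    refine ((List.reverse_perm _).append_right _).trans ?_
    rw [← List.append_assoc]
    refine (List.perm_append_singleton _ _).trans ?_
    simp
  · rw [List.isChain_append]
    have h1 : ((s1 :: P') ++ [v2]).IsChain G.Adj := by
      have := List.IsChain.tail h
      have : List.IsChain G.Adj (((s1 :: P') ++ [v2]) ++ (t2 :: W')) := by simpa using this
      exact this.left_of_append
    have h2 : ((t2 :: W') ++ [v1]).IsChain G.Adj := by
      rw [List.isChain_append]
      refine ⟨?_, by simp, ?_⟩
      · have : List.IsChain G.Adj ((v1 :: (s1 :: P') ++ [v2]) ++ (t2 :: W')) := by simpa using h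
        exact this.right_of_append
      · intro a ha b hb
        refine hc.2 a ?_ b (by simpa using hb)
        simp [List.getLast?_cons, List.getLast?_append] at ha ⊢
        exact ha
    refine ⟨?_, h2.imp fun _ _ h => .inl (.of h), ?_⟩
    · rw [List.isChain_reverse]
      exact h1.imp fun _ _ h => .inl (.of h.symm)
    · intro a ha b hb
      simp [List.getLast?_cons] at ha hb
      subst ha; subst hb
      exact .inr ⟨k1, k2⟩

theorem pairW (E : Env G K R C) (hc : Cyc G.Adj (v1 :: (P ++ v2 :: W))) (hp : (v1 :: (P ++ v2 :: W)).Perm C)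
    (eP : Ends s1 s2 P) (eW : Ends t2 t1 W) (a1 : Att G R v1) (a2 : Att G R v2) (k1 : K t1) (k2 : K s2) : False :=
  pairS E (cyc_mirror hc) (perm_mirror hp) eW.rev eP.rev a1 a2 k1 k2

structure Raw (G : SimpleGraph V) (K R : V → Prop) (C : List V) (v1 s1 w2 v2 u2 w3 v3 u3 t1 : V) (P Q T : List V) : Prop where
  cyc : Cyc G.Adj (v1 :: (P ++ v2 :: (Q ++ v3 :: T)))
  perm : (v1 :: (P ++ v2 :: (Q ++ v3 :: T))).Perm C
  eP : Ends s1 w2 P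
  eQ : Ends u2 w3 Q
  eT : Ends u3 t1 T
  a1 : Att G R v1
  a2 : Att G R v2
  a3 : Att G R v3
  nP : ∀ v ∈ P, ¬ Att G R v
  nT : ∀ v ∈ T, ¬ Att G R v

theorem raw_exists (E : Env G K R C) {a : V} {l : List V} (hc : Cyc G.Adj (a :: l)) (hp : (a :: l).Perm C) (ha : Att G R a) :
    ∃ s1 w2 v2 u2 w3 v3 u3 t1 P Q T, l = P ++ v2 :: (Q ++ v3 :: T) ∧ Raw G K R C a s1 w2 v2 u2 w3 v3 u3 t1 P Q T := by
  obtain ⟨b, hb, -, hb'⟩ := E.third a a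
  have hbl : b ∈ l := by
    have := hp.mem_iff.2 (E.attC hb'); simp [hb] at this; exact this
  obtain ⟨P, v2, l2, rfl, a2, nP⟩ := split_first (Att G R) ⟨b, hbl, hb'⟩
  obtain ⟨c, hca, hc2, hc'⟩ := E.third a v2
  have hcl : c ∈ l2 := by
    have := hp.mem_iff.2 (E.attC hc'); simp [hca, hc2] at this
    exact this.resolve_left fun h => nP _ h hc'
  obtain ⟨Q, v3, T, rfl, a3, nT⟩ := split_last (Att G R) ⟨c, hcl, hc'⟩
  have h0 : P ≠ [] := by
    rintro rfl
    exact E.nA2 hc hp ha a2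
  have h1 : Q ≠ [] := by
    rintro rfl
    have h := Cyc.rot (l := a :: P) (m := v2 :: v3 :: T) (by simpa using hc)
    exact E.nA2 h (List.Perm.trans (List.perm_append_comm (l₁ := v2 :: v3 :: T) (l₂ := a :: P)) (by simpa using hp)) a2 a3
  have h2 : T ≠ [] := by
    rintro rfl
    have h := Cyc.rot (l := a :: (P ++ v2 :: Q)) (m := [v3]) (by simpa using hc)
    exact E.nA2 h (List.Perm.trans (List.perm_append_comm (l₁ := [v3])) (by simpa using hp)) a3 ha
  obtain ⟨s1, w2, eP⟩ := exists_ends h0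
  obtain ⟨u2, w3, eQ⟩ := exists_ends h1
  obtain ⟨u3, t1, eT⟩ := exists_ends h2
  exact ⟨s1, w2, v2, u2, w3, v3, u3, t1, P, Q, T, rfl, hc, hp, eP, eQ, eT, ha, a2, a3, nP, nT⟩

section
variable {w2 u2 w3 v3 u3 : V} {Q T : List V}
theorem Raw.at_most (E : Env G K R C) (t : Raw G K R C v1 s1 w2 v2 u2 w3 v3 u3 t1 P Q T) :
    ¬ (K s1 ∧ K u2) ∧ ¬ (K s1 ∧ K u3) ∧ ¬ (K u2 ∧ K u3) ∧ ¬ (K t1 ∧ K w2) ∧ ¬ (K t1 ∧ K w3) ∧ ¬ (K w2 ∧ K w3) := by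
  have e1 : Ends u2 t1 (Q ++ v3 :: T) := by
    obtain ⟨h1, h2⟩ := t.eQ; obtain ⟨h3, h4⟩ := t.eT
    constructor <;> simp [List.head?_append, List.getLast?_append, List.getLast?_cons, *]
  have e2 : Ends s1 w3 (P ++ v2 :: Q) := by
    obtain ⟨h1, h2⟩ := t.eQ; obtain ⟨h3, h4⟩ := t.eP
    constructor <;> simp [List.head?_append, List.getLast?_append, List.getLast?_cons, *]
  have e3 : Ends u3 w2 (T ++ v1 :: P) := by
    obtain ⟨h1, h2⟩ := t.eT; obtain ⟨h3, h4⟩ := t.eP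
    constructor <;> simp [List.head?_append, List.getLast?_append, List.getLast?_cons, *]
  have c2 : Cyc G.Adj (v1 :: ((P ++ v2 :: Q) ++ v3 :: T)) := by simpa using t.cyc
  have p2 : (v1 :: ((P ++ v2 :: Q) ++ v3 :: T)).Perm C := by simpa using t.perm
  have c3 : Cyc G.Adj (v2 :: (Q ++ v3 :: (T ++ v1 :: P))) := by
    have := Cyc.rot (l := v1 :: P) (m := v2 :: (Q ++ v3 :: T)) (by simpa using t.cyc)
    simpa using this
  have p3 : (v2 :: (Q ++ v3 :: (T ++ v1 :: P))).Perm C := by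
    have : ((v2 :: (Q ++ v3 :: T)) ++ (v1 :: P)).Perm C := List.perm_append_comm.trans (by simpa using t.perm)
    simpa using this
  refine ⟨fun h => pairS E t.cyc t.perm t.eP e1 t.a1 t.a2 h.1 h.2, fun h => pairS E c2 p2 e2 t.eT t.a1 t.a3 h.1 h.2,
    fun h => pairS E c3 p3 t.eQ e3 t.a2 t.a3 h.1 h.2, fun h => pairW E t.cyc t.perm t.eP e1 t.a1 t.a2 h.1 h.2,
    fun h => pairW E c2 p2 e2 t.eT t.a1 t.a3 h.1 h.2, fun h => pairW E c3 p3 t.eQ e3 t.a2 t.a3 h.1 h.2⟩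

theorem Raw.base12 (E : Env G K R C) (t : Raw G K R C v1 s1 w2 v2 u2 w3 v3 u3 t1 P Q T) (l1 : Lt G K R s1) (l1' : Lt G K R t1)
    (hg : EE G s1 t1) : Tri G K R C v1 s1 w2 v2 u2 w3 v3 u3 t1 P Q T :=
  ⟨t.cyc, t.perm, t.eP, t.eQ, t.eT, t.a1, t.a2, t.a3, l1, l1', hg, t.nP, t.nT⟩

theorem Raw.lts (E : Env G K R C) (t : Raw G K R C v1 s1 w2 v2 u2 w3 v3 u3 t1 P Q T) :
    (¬ K s1 → Lt G K R s1) ∧ (¬ K w2 → Lt G K R w2) ∧ (¬ K u2 → Lt G K R u2) ∧ (¬ K w3 → Lt G K R w3) ∧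
    (¬ K u3 → Lt G K R u3) ∧ (¬ K t1 → Lt G K R t1) := by
  have m : ∀ v, v ∈ P ∨ v ∈ Q ∨ v ∈ T → ¬ R v := fun v hv => E.nR (t.perm.mem_iff.1 (by simp; tauto))
  have nu2 : ¬ Att G R u2 := by
    obtain ⟨l, hl⟩ := t.eQ.cons_of
    have h := Cyc.rot (l := v1 :: P) (m := v2 :: (Q ++ v3 :: T)) (by simpa using t.cyc)
    have p3 : ((v2 :: (Q ++ v3 :: T)) ++ (v1 :: P)).Perm C := List.perm_append_comm.trans (by simpa using t.perm)
    subst hl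
    exact E.nA2 (l := l ++ v3 :: (T ++ v1 :: P)) (by simpa using h) (by simpa using p3) t.a2
  have nw3 : ¬ Att G R w3 := by
    obtain ⟨l, hl⟩ := t.eQ.rev.cons_of
    have c2 : Cyc G.Adj (v1 :: ((P ++ v2 :: Q) ++ v3 :: T)) := by simpa using t.cyc
    have p2 : (v1 :: ((P ++ v2 :: Q) ++ v3 :: T)).Perm C := by simpa using t.perm
    have c := cyc_mirror c2
    have p := perm_mirror p2
    have h := Cyc.rot (l := v1 :: T.reverse) (m := v3 :: (P ++ v2 :: Q).reverse) (by simpa using c)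
    have p3 : ((v3 :: (P ++ v2 :: Q).reverse) ++ (v1 :: T.reverse)).Perm C := List.perm_append_comm.trans (by simpa using p)
    simp [hl] at h p3
    exact E.nA2 h p3 t.a3
  exact ⟨fun h => ⟨h, m _ (.inl t.eP.head_mem), t.nP _ t.eP.head_mem⟩,
    fun h => ⟨h, m _ (.inl t.eP.last_mem), t.nP _ t.eP.last_mem⟩,
    fun h => ⟨h, m _ (.inr (.inl t.eQ.head_mem)), nu2⟩, fun h => ⟨h, m _ (.inr (.inl t.eQ.last_mem)), nw3⟩,
    fun h => ⟨h, m _ (.inr (.inr t.eT.head_mem)), t.nT _ t.eT.head_mem⟩,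
    fun h => ⟨h, m _ (.inr (.inr t.eT.last_mem)), t.nT _ t.eT.last_mem⟩⟩

theorem Raw.final (E : Env G K R C) (t : Raw G K R C v1 s1 w2 v2 u2 w3 v3 u3 t1 P Q T) (k1 : ¬ K s1) (k2 : ¬ K t1) : False := by
  obtain ⟨l1, l2, l3, l4, l5, l6⟩ := t.lts E
  have adj1 : EE G v1 s1 := by
    obtain ⟨l, hl⟩ := t.eP.cons_of
    have := t.cyc.1
    rw [hl] at this
    exact .of (by simpa using this.rel)
  have adj2 : EE G v1 t1 :=
    .of (t.cyc.2 t1 (by simp [List.getLast?_cons, List.getLast?_append, t.eT.2]) v1 (by simp)).symm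
  have tri := t.base12 E (l1 k1) (l6 k2) (E.clq t.a1 (l1 k1) (l6 k2) adj1 adj2)
  by_cases h2 : ¬ K w2 ∧ ¬ K u2
  · have b := tri.base
    exact caseI E b t.nP (l2 h2.1) (l3 h2.2) (E.clq t.a2 (l2 h2.1) (l3 h2.2) (.of b.vs2) (.of b.vt2))
  by_cases h3 : ¬ K w3 ∧ ¬ K u3
  · have b := tri.mirror.base
    exact caseI E b tri.mirror.nP (l5 h3.2) (l4 h3.1) (E.clq t.a3 (l5 h3.2) (l4 h3.1) (.of b.vs2) (.of b.vt2))
  obtain ⟨m1, m2, m3, m4, m5, m6⟩ := t.at_most E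
  by_cases ku2 : K u2
  · have ku3 : ¬ K u3 := fun h => m3 ⟨ku2, h⟩
    have kw3 : K w3 := by by_contra h; exact h3 ⟨h, ku3⟩
    exact caseIIa E tri ku2 kw3 (l2 fun h => m6 ⟨h, kw3⟩) (l5 ku3)
  · have kw2 : K w2 := by by_contra h; exact h2 ⟨h, ku2⟩
    have kw3 : ¬ K w3 := fun h => m6 ⟨kw2, h⟩
    have ku3 : K u3 := by by_contra h; exact h3 ⟨kw3, h⟩
    by_cases h : Comp G (Lt G K R) s1 u2
    · exact caseIIb1 E tri kw2 ku3 (l3 ku2) (l4 kw3) h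
    · exact caseIIb2 E tri kw2 ku3 (l3 ku2) (l4 kw3) h

theorem final' (E : Env G K R C) {a s t : V} {l : List V} (hc : Cyc G.Adj (a :: l)) (hp : (a :: l).Perm C) (ha : Att G R a)
    (hl : Ends s t l) (k1 : ¬ K s) (k2 : ¬ K t) : False := by
  obtain ⟨s1, w2, v2, u2, w3, v3, u3, t1, P, Q, T, rfl, r⟩ := raw_exists E hc hp ha
  have e1 : s1 = s := by
    have := hl.1; simp [List.head?_append, r.eP.1] at this; exact this
  have e2 : t1 = t := by
    have := hl.2; simp [List.getLast?_append, List.getLast?_cons, r.eT.2] at this; exact this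
  subst e1 e2
  exact r.final E k1 k2
end

theorem prop_aux {a b c d e f : Prop} (m1 : ¬ (a ∧ b)) (m2 : ¬ (a ∧ c)) (m3 : ¬ (b ∧ c)) (m4 : ¬ (d ∧ e)) (m5 : ¬ (d ∧ f))
    (m6 : ¬ (e ∧ f)) (h1 : ¬ a → ¬ d → False) (h2 : ¬ b → ¬ e → False) (h3 : ¬ c → ¬ f → False) : False := by
  grind

theorem Env.absurd (E : Env G K R C) (hc : Cyc G.Adj C) : False := by
  obtain ⟨b, -, -, hb⟩ := E.third (C.head (by intro h; simpa [h] using E.len)) (C.head (by intro h; simpa [h] using E.len))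
  obtain ⟨l1, l2, hC⟩ := List.append_of_mem (E.attC hb)
  have c1 : Cyc G.Adj (b :: (l2 ++ l1)) := by
    rw [hC] at hc
    simpa using Cyc.rot hc
  have p1 : (b :: (l2 ++ l1)).Perm C := by
    rw [hC]
    exact (List.perm_append_comm (l₁ := b :: l2) (l₂ := l1))
  obtain ⟨s1, w2, v2, u2, w3, v3, u3, t1, P, Q, T, hl, t⟩ := raw_exists E c1 p1 hb
  have e1 : Ends u3 w2 (T ++ b :: P) := by
    obtain ⟨h1, h2⟩ := t.eT; obtain ⟨h3, h4⟩ := t.eP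
    constructor <;> simp [List.head?_append, List.getLast?_append, List.getLast?_cons, *]
  have c3 : Cyc G.Adj (v2 :: (Q ++ v3 :: (T ++ b :: P))) := by
    have := Cyc.rot (l := b :: P) (m := v2 :: (Q ++ v3 :: T)) (by simpa using t.cyc)
    simpa using this
  have p3 : (v2 :: (Q ++ v3 :: (T ++ b :: P))).Perm C := by
    have : ((v2 :: (Q ++ v3 :: T)) ++ (b :: P)).Perm C := List.perm_append_comm.trans (by simpa using t.perm)
    simpa using this
  have c4 : Cyc G.Adj (v3 :: (T ++ b :: (P ++ v2 :: Q))) := by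
    have := Cyc.rot (l := v2 :: Q) (m := v3 :: (T ++ b :: P)) (by simpa using c3)
    simpa using this
  have p4 : (v3 :: (T ++ b :: (P ++ v2 :: Q))).Perm C := by
    have : ((v3 :: (T ++ b :: P)) ++ (v2 :: Q)).Perm C := List.perm_append_comm.trans (by simpa using p3)
    simpa using this
  have e2 : Ends u2 w2 (Q ++ v3 :: (T ++ b :: P)) := by
    obtain ⟨h1, h2⟩ := t.eQ; obtain ⟨h3, h4⟩ := t.eP
    constructor <;> simp [List.head?_append, List.getLast?_append, List.getLast?_cons, *]
  have e3 : Ends u3 w3 (T ++ b :: (P ++ v2 :: Q)) := by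
    obtain ⟨h1, h2⟩ := t.eT; obtain ⟨h3, h4⟩ := t.eQ
    constructor <;> simp [List.head?_append, List.getLast?_append, List.getLast?_cons, *]
  obtain ⟨m1, m2, m3, m4, m5, m6⟩ := t.at_most E
  have h1 := t.final E
  have h2 := final' E c3 p3 t.a2 e2
  have h3 := final' E c4 p4 t.a3 e3
  exact prop_aux m1 m2 m3 m4 m5 m6 h1 h2 h3

end HamADH

set_option linter.unusedSimpArgs false
set_option linter.unusedVariables false
open SimpleGraph
namespace HamADH
variable {V : Type*} {G : SimpleGraph V} {K R : V → Prop} {C : List V}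

theorem wk_of_walk {s : Set V} {x y : s} (p : (G.induce s).Walk x y) : Wk G (fun v => v ∈ s) p.length x y := by
  induction p with
  | nil => rfl
  | cons h p ih => exact ⟨_, by simpa using h, Subtype.property _, ih⟩

theorem walk_of_wk {s : Set V} {n : ℕ} {x y : s} (w : Wk G (fun v => v ∈ s) n x y) :
    ∃ p : (G.induce s).Walk x y, p.length = n := by
  induction n generalizing x with
  | zero => obtain rfl : x = y := Subtype.ext w; exact ⟨.nil, rfl⟩
  | succ n ih =>
    obtain ⟨c, h1, h2, h3⟩ := w
    obtain ⟨p, hp⟩ := ih (x := ⟨c, h2⟩) h3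
    exact ⟨.cons (by simpa using h1) p, by simp [hp]⟩

theorem walk_of_near {n : ℕ} {x y : V} (w : Near G n x y) : ∃ p : G.Walk x y, p.length ≤ n := by
  induction n generalizing x with
  | zero => obtain rfl : x = y := w; exact ⟨.nil, le_rfl⟩
  | succ n ih =>
    obtain ⟨c, h1, h3⟩ := w
    obtain ⟨p, hp⟩ := ih h3
    rcases h1 with rfl | h1
    · exact ⟨p, by omega⟩
    · exact ⟨.cons h1 p, by simp [hp]⟩

theorem conn_of_connected {s : Set V} (h : (G.induce s).Connected) : Conn G (fun v => v ∈ s) := by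
  intro a b ha hb
  obtain ⟨p⟩ := h.preconnected ⟨a, ha⟩ ⟨b, hb⟩
  exact ⟨_, wk_of_walk p⟩

theorem adhset_of (h : AlmostDH G) (H : V → Prop) (hH : Conn G H) (a b : V) (d : ℕ) (ha : H a) (hb : H b)
    (hd : Near G d a b) : ∃ m ≤ d + 1, Wk G H m a b := by
  have hc : (G.induce {v | H v}).Connected := by
    have : Nonempty {v | H v} := ⟨⟨a, ha⟩⟩
    refine ⟨?_⟩
    intro x y
    obtain ⟨n, w⟩ := hH x y x.2 y.2
    obtain ⟨p, -⟩ := walk_of_wk (s := {v | H v}) (x := x) (y := y) w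
    exact ⟨p⟩
  have h1 := h _ hc ⟨a, ha⟩ ⟨b, hb⟩
  obtain ⟨q, hq⟩ := walk_of_near hd
  have h2 := SimpleGraph.dist_le q
  obtain ⟨p, hp⟩ := (hc.preconnected ⟨a, ha⟩ ⟨b, hb⟩).exists_walk_length_eq_dist
  exact ⟨p.length, by simp at h1; omega, wk_of_walk p⟩

theorem Wk.path {n : ℕ} : ∀ {S : V → Prop} {a b : V}, Wk G S n a b →
    ∃ l, (a :: l).Nodup ∧ (a :: l).IsChain G.Adj ∧ (a :: l).getLast? = some b ∧ ∀ v ∈ l, S v := by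
  induction n using Nat.strong_induction_on with
  | _ n ih =>
    intro S a b w
    obtain ⟨m, hm, w⟩ := w.loopErase
    rcases m with _ | m
    · obtain rfl : a = b := w
      exact ⟨[], by simp, by simp, by simp, by simp⟩
    · obtain ⟨c, h1, ⟨h2, h3⟩, w⟩ := w
      obtain ⟨l, i1, i2, i3, i4⟩ := ih m (by omega) w
      refine ⟨c :: l, ?_, ?_, ?_, ?_⟩
      · rw [List.nodup_cons]
        refine ⟨?_, i1⟩
        intro h
        rcases List.mem_cons.1 h with rfl | h
        · exact h3 rfl
        · exact (i4 _ h).2 rfl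
      · exact List.IsChain.cons_cons h1 i2
      · simpa [List.getLast?_cons] using i3
      · intro v hv
        rcases List.mem_cons.1 hv with rfl | h
        · exact h2
        · exact (i4 _ h).1

theorem Wk.leave {S X : V → Prop} {n : ℕ} {a b : V} (w : Wk G S n a b) (ha : X a) (hb : ¬ X b) :
    ∃ c d, X c ∧ ¬ X d ∧ G.Adj c d ∧ S d := by
  induction n generalizing a with
  | zero => obtain rfl : a = b := w; exact absurd ha hb
  | succ n ih =>
    obtain ⟨c, h1, h2, h3⟩ := w
    by_cases hc : X c
    · exact ih h3 hc
    · exact ⟨a, c, ha, hc, h1, h2⟩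

/-! Hamiltonicity from a list. -/
theorem walk_of_list : ∀ {l : List V} {a b : V}, (a :: l).IsChain G.Adj → (a :: l).getLast? = some b →
    ∃ p : G.Walk a b, p.support = a :: l
  | [], a, b, _, h => by
    obtain rfl : a = b := by simpa using h
    exact ⟨.nil, by simp⟩
  | c :: l, a, b, hc, h => by
    rw [List.isChain_cons_cons] at hc
    obtain ⟨p, hp⟩ := walk_of_list hc.2 (by simpa [List.getLast?_cons] using h)
    exact ⟨.cons hc.1 p, by simp [hp]⟩

theorem ham_of_list [Fintype V] [DecidableEq V] (hn : C.Nodup) (hl : 3 ≤ C.length) (hc : Cyc G.Adj C) (hall : ∀ v, v ∈ C) :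
    G.IsHamiltonian := by
  intro _
  obtain ⟨a, b, e⟩ := exists_ends (l := C) (by rintro rfl; simp at hl)
  obtain ⟨l, rfl⟩ := e.cons_of
  obtain ⟨p, hp⟩ := walk_of_list hc.1 e.2
  have hpath : p.IsPath := by rw [SimpleGraph.Walk.isPath_def, hp]; exact hn
  have hba : G.Adj b a := hc.2 b e.2 a e.1
  refine ⟨b, .cons hba p, ?_⟩
  have hcyc : (SimpleGraph.Walk.cons hba p).IsCycle := by
    rw [SimpleGraph.Walk.cons_isCycle_iff]
    refine ⟨hpath, ?_⟩
    intro he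
    cases p with
    | nil => exact hba.ne rfl
    | @cons _ c _ h q =>
      rw [SimpleGraph.Walk.cons_isPath_iff] at hpath
      rw [SimpleGraph.Walk.edges_cons, List.mem_cons] at he
      rcases he with he | he
      · have : b = c := by
          rw [Sym2.eq_iff] at he
          rcases he with ⟨h1, -⟩ | ⟨h1, -⟩
          · exact absurd h1 hba.ne
          · exact h1
        subst this
        have := SimpleGraph.Walk.isPath_iff_eq_nil.1 hpath.1
        subst this
        have := congrArg List.length hp
        simp at this hl
        omega
      · exact hpath.2 (SimpleGraph.Walk.snd_mem_support_of_mem_edges _ he)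
  rw [SimpleGraph.Walk.isHamiltonianCycle_iff_isCycle_and_support_count_tail_eq_one]
  refine ⟨hcyc, fun v => ?_⟩
  rw [SimpleGraph.Walk.support_cons, List.tail_cons, hp]
  exact List.count_eq_one_of_mem hn (hall v)

/-! Edge counts. -/
open Classical in
noncomputable def ind (p : Prop) : ℕ := if p then 1 else 0

noncomputable def ec (G : SimpleGraph V) : List V → ℕ
  | [] => 0
  | [_] => 0
  | a :: b :: l => ind (G.Adj a b) + ec G (b :: l)

theorem ind_le (p : Prop) : ind p ≤ 1 := by unfold ind; split <;> simp
theorem ind_true {p : Prop} (h : p) : ind p = 1 := by simp [ind, h]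
theorem ind_false {p : Prop} (h : ¬ p) : ind p = 0 := by simp [ind, h]

theorem ec_le : ∀ l : List V, ec G l ≤ l.length
  | [] => by simp [ec]
  | [_] => by simp [ec]
  | a :: b :: l => by
    have := ec_le (b :: l)
    have := ind_le (G.Adj a b)
    simp [ec] at *
    omega

theorem ec_append : ∀ (l m : List V) (x : V), ec G (l ++ x :: m) = ec G (l ++ [x]) + ec G (x :: m)
  | [], m, x => by simp [ec]
  | [a], m, x => by simp [ec]
  | a :: b :: l, m, x => by
    have := ec_append (b :: l) m x
    simp [ec] at *
    omega

theorem ec_concat {l : List V} {a b x : V} (h : Ends a b l) : ec G (l ++ [x]) = ec G l + ind (G.Adj b x) := by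
  obtain ⟨l', rfl⟩ := h.concat_of
  have := ec_append (G := G) l' [x] b
  simp [ec] at *
  omega

theorem ec_app {l m : List V} {a b c d : V} (h : Ends a b l) (h' : Ends c d m) :
    ec G (l ++ m) = ec G l + ind (G.Adj b c) + ec G m := by
  obtain ⟨m', rfl⟩ := h'.cons_of
  rw [ec_append, ec_concat h]

theorem ec_reverse : ∀ (l : List V), ec G l.reverse = ec G l
  | [] => by simp [ec]
  | [_] => by simp [ec]
  | a :: b :: l => by
    have := ec_reverse (b :: l)
    rw [List.reverse_cons]
    obtain ⟨p, q, e⟩ := exists_ends (l := b :: l) (by simp)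
    have hb : p = b := ends_cons e
    subst hb
    rw [ec_concat e.rev, this, G.adj_comm]
    simp [ec]; omega

noncomputable def ecc (G : SimpleGraph V) (l : List V) : ℕ := ec G (l ++ l.head?.toList)

theorem ecc_eq {l : List V} {a b : V} (h : Ends a b l) : ecc G l = ec G l + ind (G.Adj b a) := by
  unfold ecc
  rw [h.1]
  exact ec_concat h

theorem ecc_rot {l m : List V} : ecc G (l ++ m) = ecc G (m ++ l) := by
  rcases eq_or_ne l [] with rfl | hl
  · simp
  rcases eq_or_ne m [] with rfl | hm
  · simp
  obtain ⟨a, b, e⟩ := exists_ends hl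
  obtain ⟨c, d, e'⟩ := exists_ends hm
  have h1 : Ends a d (l ++ m) := by
    constructor
    · rw [List.head?_append_of_ne_nil _ hl]; exact e.1
    · simp [List.getLast?_append, e'.2]
  have h2 : Ends c b (m ++ l) := by
    constructor
    · rw [List.head?_append_of_ne_nil _ hm]; exact e'.1
    · simp [List.getLast?_append, e.2]
  rw [ecc_eq h1, ecc_eq h2, ec_app e e', ec_app e' e]
  omega

theorem ecc_le (l : List V) : ecc G l ≤ l.length + 1 := by
  refine (ec_le _).trans ?_
  cases l <;> simp

theorem not_chain {r : V → V → Prop} : ∀ {l : List V}, ¬ l.IsChain r → ∃ l1 a b l2, l = l1 ++ a :: b :: l2 ∧ ¬ r a b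
  | [], h => by simp at h
  | [_], h => by simp at h
  | a :: b :: l, h => by
    rw [List.isChain_cons_cons, not_and_or] at h
    rcases h with h | h
    · exact ⟨[], a, b, l, rfl, h⟩
    · obtain ⟨l1, c, d, l2, h1, h2⟩ := not_chain h
      exact ⟨a :: l1, c, d, l2, by simp [h1], h2⟩

open Classical in
theorem crossing {x y : V} : ∀ {l : List V} {a : V},
    (∀ l1 c d l2, a :: l = l1 ++ c :: d :: l2 → ¬ (G.Adj y c ∧ G.Adj x d)) → ∀ {b}, (a :: l).getLast? = some b → ¬ G.Adj y b →
    l.countP (fun v => decide (G.Adj x v)) + (a :: l).countP (fun v => decide (G.Adj y v)) ≤ l.length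
  | [], a, _, b, hb, hy => by
    obtain rfl : a = b := by simpa using hb
    simp [hy]
  | c :: l, a, h, b, hb, hy => by
    have ih := crossing (l := l) (a := c) (fun l1 c' d l2 e => h (a :: l1) c' d l2 (by simp [e])) (b := b)
      (by simpa [List.getLast?_cons] using hb) hy
    have h0 := h [] a c l rfl
    rw [List.countP_cons (l := l), List.countP_cons (a := a)]
    simp only [decide_eq_true_eq, List.length_cons]
    split_ifs with h1 h2
    · exact absurd ⟨h2, h1⟩ h0
    all_goals omega

theorem exists_max {α : Type*} (p : α → Prop) (f : α → ℕ) (B : ℕ) (hB : ∀ a, p a → f a ≤ B) (h : ∃ a, p a) :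
    ∃ a, p a ∧ ∀ b, p b → f b ≤ f a := by
  by_contra hn
  push Not at hn
  have : ∀ n, ∃ a, p a ∧ n ≤ f a := by
    intro n
    induction n with
    | zero => obtain ⟨a, ha⟩ := h; exact ⟨a, ha, by omega⟩
    | succ n ih =>
      obtain ⟨a, ha, hf⟩ := ih
      obtain ⟨b, hb, hfb⟩ := hn a ha
      exact ⟨b, hb, by omega⟩
  obtain ⟨a, ha, hf⟩ := this (B + 1)
  have := hB a ha
  omega

end HamADH

set_option linter.unusedSimpArgs false
set_option linter.unusedVariables false
set_option linter.unusedSectionVars false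
open SimpleGraph
namespace HamADH
variable {V : Type*} [Fintype V] [DecidableEq V] {G : SimpleGraph V}

theorem heavy_common {a b : V} (ha : Heavy G a) (hb : Heavy G b) (S : Finset V)
    (hS : ∀ v ∈ S, ¬ G.Adj a v ∧ ¬ G.Adj b v) (T : Finset V) (hT : T.card < S.card) :
    ∃ g, g ∉ T ∧ G.Adj a g ∧ G.Adj b g := by
  by_contra hn
  push Not at hn
  have h1 : G.neighborSet a ∩ G.neighborSet b ⊆ (T : Set V) := by
    rintro v ⟨h1, h2⟩
    by_contra h
    exact hn v (by simpa using h) h1 h2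
  have h2 : G.neighborSet a ∪ G.neighborSet b ⊆ ((Sᶜ : Finset V) : Set V) := by
    intro v h
    simp only [Finset.coe_compl, Set.mem_compl_iff, SetLike.mem_coe]
    intro hv
    rcases h with h | h
    · exact (hS v hv).1 h
    · exact (hS v hv).2 h
  have h3 := Set.ncard_le_ncard h1 (Set.toFinite _)
  have h4 := Set.ncard_le_ncard h2 (Set.toFinite _)
  have h5 := Set.ncard_union_add_ncard_inter (G.neighborSet a) (G.neighborSet b)
  rw [Set.ncard_coe_finset] at h3 h4
  rw [Finset.card_compl] at h4
  have h6 := Finset.card_le_univ S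
  unfold Heavy at ha hb
  omega

structure Valid (G : SimpleGraph V) (C : List V) : Prop where
  nd : C.Nodup
  len : 3 ≤ C.length
  cyc : Cyc (FF G (Heavy G)) C
  hv : ∀ v, Heavy G v → v ∈ C

theorem Valid.perm {C D : List V} (h : Valid G C) (hp : D.Perm C) (hc : Cyc (FF G (Heavy G)) D) : Valid G D :=
  ⟨hp.nodup_iff.2 h.nd, hp.length_eq ▸ h.len, hc, fun v hv => hp.mem_iff.2 (h.hv v hv)⟩

theorem ff_symm {a b : V} (h : FF G (Heavy G) a b) : FF G (Heavy G) b a := by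
  rcases h with h | ⟨h1, h2⟩
  · exact .inl h.symm
  · exact .inr ⟨h2, h1⟩

theorem two_conn (h3 : ∀ x y : V, (G.induce {x, y}ᶜ).Connected) (x y : V) : Conn G (fun v => v ≠ x ∧ v ≠ y) := by
  intro a b ha hb
  obtain ⟨n, w⟩ := conn_of_connected (h3 x y) a b (by simpa using ha) (by simpa using hb)
  exact ⟨n, w.mono fun v hv => by simpa using hv⟩

theorem exists_ne2 (h4 : 4 ≤ Fintype.card V) (x y : V) : ∃ z, z ≠ x ∧ z ≠ y := by
  by_contra hn
  push Not at hn
  have : (Finset.univ : Finset V) ⊆ {x, y} := by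
    intro z _
    by_cases h : z = x
    · simp [h]
    · simp [hn z h]
  have h1 := Finset.card_le_card this
  have h2 := Finset.card_le_two (a := x) (b := y)
  rw [Finset.card_univ] at h1
  omega

theorem nbr (h4 : 4 ≤ Fintype.card V) (h3 : ∀ x y : V, (G.induce {x, y}ᶜ).Connected) {p q : V} (hpq : p ≠ q) :
    ∃ a, G.Adj p a ∧ a ≠ q := by
  obtain ⟨z, hz1, hz2⟩ := exists_ne2 h4 p q
  obtain ⟨n, w⟩ := two_conn h3 q q p z ⟨hpq, hpq⟩ ⟨hz2, hz2⟩
  rcases n with _ | n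
  · exact absurd (Eq.symm w) hz1
  · obtain ⟨c, h1, h2, -⟩ := w
    exact ⟨c, h1, h2.1⟩

theorem valid_of_pair (h4 : 4 ≤ Fintype.card V) (h3 : ∀ x y : V, (G.induce {x, y}ᶜ).Connected) {p q : V} (hpq : p ≠ q)
    (hf : FF G (Heavy G) p q) (hk : ∀ v, Heavy G v → v = p ∨ v = q) : ∃ C, Valid G C := by
  obtain ⟨a, pa, aq⟩ := nbr h4 h3 hpq
  obtain ⟨b, qb, bp⟩ := nbr h4 h3 hpq.symm
  obtain ⟨n, w⟩ := two_conn h3 p q a b ⟨pa.ne', aq⟩ ⟨bp, qb.ne'⟩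
  obtain ⟨l, l1, l2, l3, l4⟩ := w.path
  have hm : ∀ v ∈ a :: l, v ≠ p ∧ v ≠ q := by
    intro v hv
    rcases List.mem_cons.1 hv with rfl | hv
    · exact ⟨pa.ne', aq⟩
    · exact l4 v hv
  refine ⟨q :: p :: a :: l, ?_, by simp, ?_, ?_⟩
  · rw [List.nodup_cons, List.nodup_cons]
    refine ⟨?_, fun h => (hm _ h).1 rfl, l1⟩
    intro h
    rcases List.mem_cons.1 h with h | h
    · exact hpq h.symm
    · exact (hm _ h).2 rfl
  · constructor
    · refine List.IsChain.cons_cons (ff_symm hf) (List.IsChain.cons_cons (.inl (.of pa)) ?_)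
      exact l2.imp fun _ _ h => .inl (.of h)
    · intro x hx y hy
      have e1 : b = x := by
        rw [List.getLast?_cons_cons, List.getLast?_cons_cons, l3] at hx
        simpa using hx
      obtain rfl : q = y := by simpa using hy
      subst e1
      exact .inl (.of qb.symm)
  · intro v hv
    rcases hk v hv with rfl | rfl <;> simp

open Classical in
theorem valid_exists (h4 : 4 ≤ Fintype.card V) (h3 : ∀ x y : V, (G.induce {x, y}ᶜ).Connected) : ∃ C, Valid G C := by
  let F : Finset V := Finset.univ.filter fun v => Heavy G v
  have hF : ∀ v, v ∈ F ↔ Heavy G v := by simp [F]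
  rcases Nat.lt_or_ge 2 F.card with h | h
  · have hm : ∀ v ∈ F.toList, Heavy G v := fun v hv => (hF v).1 (by simpa using hv)
    refine ⟨F.toList, F.nodup_toList, by rw [Finset.length_toList]; omega, ⟨?_, ?_⟩, fun v hv => by simpa using (hF v).2 hv⟩
    · exact (List.pairwise_of_forall_mem_list fun a ha b hb => .inr ⟨hm a ha, hm b hb⟩).isChain
    · intro a ha b hb
      exact .inr ⟨hm a (List.mem_of_mem_getLast? ha), hm b (List.mem_of_mem_head? hb)⟩
  · rcases Nat.lt_or_ge F.card 2 with h | h'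
    · have : ∃ p, ∀ v, Heavy G v → v = p := by
        rcases F.eq_empty_or_nonempty with he | ⟨p, hp⟩
        · have : Nonempty V := Fintype.card_pos_iff.1 (by omega)
          exact ⟨Classical.arbitrary V, fun v hv => by simpa [he] using (hF v).2 hv⟩
        · refine ⟨p, fun v hv => ?_⟩
          exact Finset.card_le_one.1 (by omega) v ((hF v).2 hv) p hp
      obtain ⟨p, hp⟩ := this
      obtain ⟨z, hz, -⟩ := exists_ne2 h4 p p
      obtain ⟨q, hq, -⟩ := nbr h4 h3 hz.symm
      exact valid_of_pair h4 h3 hq.ne (.inl (.of hq)) fun v hv => .inl (hp v hv)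
    · obtain ⟨p, q, hpq, he⟩ := Finset.card_eq_two.1 (le_antisymm h h')
      have hp := (hF p).1 (by simp [he])
      have hq := (hF q).1 (by simp [he])
      exact valid_of_pair h4 h3 hpq (.inr ⟨hp, hq⟩) fun v hv => by simpa [he] using (hF v).2 hv

structure Best (G : SimpleGraph V) (C : List V) : Prop extends Valid G C where
  mx : ∀ D, Valid G D → D.length ≤ C.length
  mxe : ∀ D, Valid G D → D.length = C.length → ecc G D ≤ ecc G C

theorem best_exists (h4 : 4 ≤ Fintype.card V) (h3 : ∀ x y : V, (G.induce {x, y}ᶜ).Connected) : ∃ C, Best G C := by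
  obtain ⟨C, hC, hm⟩ := exists_max (Valid G) List.length (Fintype.card V) (fun C h => h.nd.length_le_card) (valid_exists h4 h3)
  obtain ⟨D, hD, hmD⟩ := exists_max (fun D => Valid G D ∧ D.length = C.length) (ecc G) (C.length + 1)
    (fun D h => h.2 ▸ ecc_le D) ⟨C, hC, rfl⟩
  exact ⟨D, hD.1, fun D' h => hD.2 ▸ hm D' h, fun D' h h' => hmD D' ⟨h, h'.trans hD.2⟩⟩

theorem Best.rot {l m : List V} (h : Best G (l ++ m)) : Best G (m ++ l) :=
  ⟨h.toValid.perm List.perm_append_comm h.cyc.rot, fun D hD => by simpa [Nat.add_comm] using h.mx D hD,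
    fun D hD e => by rw [ecc_rot]; exact h.mxe D hD (by simpa [Nat.add_comm] using e)⟩

theorem Best.noPath {C : List V} (h : Best G C) {P L : List V} {a b c d : V} (hP : P.Perm C) (hc : P.IsChain (FF G (Heavy G)))
    (e : Ends a b P) (e' : Ends c d L) (hL : L.Nodup) (hLC : ∀ v ∈ L, v ∉ C) (hLc : L.IsChain G.Adj) (bc : G.Adj b c)
    (da : G.Adj d a) : False := by
  have : Valid G (P ++ L) := by
    refine ⟨?_, ?_, ⟨?_, ?_⟩, ?_⟩
    · rw [List.nodup_append]
      refine ⟨hP.nodup_iff.2 h.nd, hL, ?_⟩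
      rintro v hv w hw rfl
      exact hLC v hw (hP.mem_iff.1 hv)
    · have := h.len; rw [List.length_append, hP.length_eq]; omega
    · rw [List.isChain_append]
      refine ⟨hc, hLc.imp fun _ _ h => .inl (.of h), ?_⟩
      intro x hx y hy
      rw [e.2] at hx; rw [e'.1] at hy
      simp at hx hy; subst hx hy
      exact .inl (.of bc)
    · intro x hx y hy
      rw [List.getLast?_append, e'.2] at hx
      rw [List.head?_append_of_ne_nil _ e.ne, e.1] at hy
      simp at hx hy; subst hx hy
      exact .inl (.of da)
    · intro v hv
      exact List.mem_append_left _ (hP.mem_iff.2 (h.hv v hv))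
  have := h.mx _ this
  rw [List.length_append, hP.length_eq] at this
  have := List.length_pos_of_ne_nil e'.ne
  omega

open Classical in
theorem deg_split (x : V) {C : List V} (hn : C.Nodup) :
    (G.neighborSet x).ncard = C.countP (fun v => decide (G.Adj x v)) +
      ((C.toFinset)ᶜ.filter fun v => G.Adj x v).card := by
  have h1 : C.countP (fun v => decide (G.Adj x v)) = (C.toFinset.filter fun v => G.Adj x v).card := by
    rw [List.countP_eq_length_filter, ← List.toFinset_card_of_nodup (hn.filter _), List.toFinset_filter]
    congr 1; ext; simp
  have h2 : (G.neighborSet x) = ((Finset.univ.filter fun v => G.Adj x v : Finset V) : Set V) := by ext; simp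
  rw [h1, h2, Set.ncard_coe_finset, ← Finset.card_union_of_disjoint]
  · congr 1
    ext v
    simp
    tauto
  · rw [Finset.disjoint_left]
    intro v hv hv'
    simp at hv hv'
    exact hv'.1 hv.1

open Classical in
theorem Best.close {C : List V} (h : Best G C) {x y : V} (e : Ends x y C) : G.Adj y x := by
  by_contra hyx
  have hne : y ≠ x := by
    rintro rfl
    obtain ⟨l, rfl⟩ := e.cons_of
    have hn := h.nd
    have hl := h.len
    have h2 := e.2
    rcases l with _ | ⟨c, l⟩
    · simp at hl
    · rw [List.getLast?_cons_cons] at h2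
      exact (List.nodup_cons.1 hn).1 (List.mem_of_mem_getLast? h2)
  have hf := h.cyc.2 y e.2 x e.1
  obtain ⟨hy, hx⟩ : Heavy G y ∧ Heavy G x := by
    rcases hf with (h | h) | h
    · exact absurd h hne
    · exact absurd h hyx
    · exact h
  by_cases hcom : ∃ g, g ∉ C ∧ G.Adj x g ∧ G.Adj y g
  · obtain ⟨g, hg, gx, gy⟩ := hcom
    exact h.noPath (P := C) (L := [g]) (c := g) (d := g) List.Perm.rfl h.cyc.1 e ⟨rfl, rfl⟩ (by simp) (by simpa using hg) (by simp)
      gy gx.symm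
  push Not at hcom
  obtain ⟨l, rfl⟩ := e.cons_of
  by_cases hcr : ∃ l1 c d l2, x :: l = l1 ++ c :: d :: l2 ∧ G.Adj y c ∧ G.Adj x d
  · obtain ⟨l1, c, d, l2, hl, yc, xd⟩ := hcr
    have e1 : Ends x c (l1 ++ [c]) := by
      constructor
      · have := congrArg List.head? hl
        rw [show l1 ++ c :: d :: l2 = (l1 ++ [c]) ++ (d :: l2) by simp, List.head?_append_of_ne_nil _ (by simp)] at this
        rw [← this]; simp
      · simp
    have e2 : Ends d y (d :: l2) := by
      refine ⟨rfl, ?_⟩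
      have := e.2
      rw [hl, show l1 ++ c :: d :: l2 = (l1 ++ [c]) ++ (d :: l2) by simp, List.getLast?_append_of_ne_nil _ (by simp)] at this
      exact this
    have hl' : x :: l = (l1 ++ [c]) ++ (d :: l2) := by simp [hl]
    have hch := h.cyc.1
    rw [hl', List.isChain_append] at hch
    have e3 : Ends x d ((l1 ++ [c]) ++ (d :: l2).reverse) := by
      constructor
      · rw [List.head?_append_of_ne_nil _ e1.ne]; exact e1.1
      · rw [List.getLast?_append, e2.rev.2]; rfl
    have hperm : ((l1 ++ [c]) ++ (d :: l2).reverse).Perm (x :: l) := by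
      rw [hl']; exact (List.reverse_perm _).append_left _
    have hv : Valid G ((l1 ++ [c]) ++ (d :: l2).reverse) := by
      refine h.toValid.perm hperm ⟨?_, ?_⟩
      · rw [List.isChain_append]
        refine ⟨hch.1, ?_, ?_⟩
        · rw [List.isChain_reverse]
          exact hch.2.1.imp fun _ _ h => ff_symm h
        · intro p hp q hq
          rw [e1.2] at hp; rw [e2.rev.1] at hq
          simp only [Option.mem_def, Option.some.injEq] at hp hq; subst hp hq
          exact .inl (.of yc.symm)
      · intro p hp q hq
        rw [e3.2] at hp; rw [e3.1] at hq
        simp only [Option.mem_def, Option.some.injEq] at hp hq; subst hp hq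
        exact .inl (.of xd.symm)
    have hle := h.mxe _ hv hperm.length_eq
    rw [ecc_eq e3, ecc_eq e, hl', ec_app e1 e2, ec_app e1 e2.rev, ec_reverse, ind_true yc.symm, ind_true xd.symm, ind_false hyx] at hle
    have := ind_le (G.Adj c d)
    omega
  · push Not at hcr
    have h1 := crossing (G := G) (x := x) (y := y) (l := l) (a := x) (fun l1 c d l2 e hh => hcr l1 c d l2 e hh.1 hh.2) (b := y) e.2
      (G.loopless.irrefl y)
    have dx := deg_split (G := G) x h.nd
    have dy := deg_split (G := G) y h.nd
    rw [List.countP_cons_of_neg (by simp)] at dx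
    have hdis : Disjoint (((x :: l).toFinset)ᶜ.filter fun v => G.Adj x v) (((x :: l).toFinset)ᶜ.filter fun v => G.Adj y v) := by
      rw [Finset.disjoint_left]
      intro v hv hv'
      rw [Finset.mem_filter, Finset.mem_compl, List.mem_toFinset] at hv hv'
      exact hcom v hv.1 hv.2 hv'.2
    have hsub : (((x :: l).toFinset)ᶜ.filter fun v => G.Adj x v) ∪ (((x :: l).toFinset)ᶜ.filter fun v => G.Adj y v)
        ⊆ ((x :: l).toFinset)ᶜ := Finset.union_subset (Finset.filter_subset _ _) (Finset.filter_subset _ _)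
    have hcard := Finset.card_le_card hsub
    rw [Finset.card_union_of_disjoint hdis, Finset.card_compl, List.toFinset_card_of_nodup h.nd, List.length_cons] at hcard
    have hcl := h.nd.length_le_card
    rw [List.length_cons] at hcl
    unfold Heavy at hx hy
    omega

theorem Best.isCycle {C : List V} (h : Best G C) : Cyc G.Adj C := by
  refine ⟨?_, ?_⟩
  · by_contra hn
    obtain ⟨l1, a, b, l2, rfl, hab⟩ := not_chain hn
    have h' : Best G ((b :: l2) ++ (l1 ++ [a])) := Best.rot (by simpa using h)
    exact hab (h'.close (x := b) (y := a) ⟨rfl, by rw [List.getLast?_append_of_ne_nil _ (by simp)]; simp⟩)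
  · intro a ha b hb
    exact h.close ⟨hb, ha⟩

theorem Best.env {C : List V} (h : Best G C) (h4 : 4 ≤ Fintype.card V) (h3 : ∀ x y : V, (G.induce {x, y}ᶜ).Connected)
    (h1h : OneHeavy G) (hadh : AlmostDH G) {r : V} (hr : r ∉ C) :
    Env G (Heavy G) (Comp G (fun v => v ∉ C) r) C where
  claw := by
    intro a x y z ax ay az xy xz yz kx ky kz
    have h1 : G.Adj a x := ax.resolve_left (by rintro rfl; exact xy ay)
    have h2 : G.Adj a y := ay.resolve_left (by rintro rfl; exact xy ax.symm)
    have h3 : G.Adj a z := az.resolve_left (by rintro rfl; exact xz ax.symm)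
    rcases h1h a x y z ⟨h1, h2, h3, fun h => xy (.of h), fun h => xz (.of h), fun h => yz (.of h),
      fun h => xy (.inl h), fun h => xz (.inl h), fun h => yz (.inl h)⟩ with h | h | h
    · exact kx h
    · exact ky h
    · exact kz h
  adhset := adhset_of hadh
  heavy := by
    intro a b ha hb
    by_cases hab : EE G a b
    · exact ⟨b, hab, b, .refl b, rfl⟩
    · obtain ⟨g, -, h1, h2⟩ := heavy_common ha hb {a} (by
        intro v hv
        obtain rfl : v = a := by simpa using hv
        exact ⟨G.loopless.irrefl v, fun h => hab (.of h.symm)⟩) ∅ (by simp)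
      exact ⟨g, .of h1, b, .of h2.symm, rfl⟩
  Rl := fun x hx hk => hx.mem (h.hv x hk)
  RC := fun x hx => hx.mem
  Rcl := by
    intro x y hx hxy
    by_cases hy : y ∈ C
    · exact .inr hy
    · exact .inl (hx.step hy (.of hxy))
  Rconn := Comp.conn
  KC := h.hv
  nodup := h.nd
  len := h.len
  noHam := by
    rintro P a b hP hc ha hb ⟨-, xa, ra, ea⟩ ⟨-, xb, rb, eb⟩
    obtain ⟨n, w⟩ := Comp.conn xb xa rb ra
    obtain ⟨l, l1, l2, l3, l4⟩ := w.path
    refine h.noPath (L := xb :: l) hP hc ⟨ha, hb⟩ ⟨rfl, l3⟩ l1 ?_ l2 eb.symm ea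
    intro v hv
    rcases List.mem_cons.1 hv with rfl | hv
    · exact rb.mem
    · exact (l4 v hv).mem
  noIns := by
    intro P a b s hP hc ha hb hs sa sb
    exact h.noPath (L := [s]) hP hc ⟨ha, hb⟩ ⟨rfl, rfl⟩ (by simp) (by simpa using hs) (by simp) sb.symm sa
  third := by
    set R := Comp G (fun v => v ∉ C) r with hR
    have rr : R r := Comp.self hr
    have key : ∀ x y, ¬ R x → ¬ R y → ∃ v, v ≠ x ∧ v ≠ y ∧ Att G R v := by
      intro x y hx hy
      have : ∃ c ∈ C, c ≠ x ∧ c ≠ y := by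
        by_contra hn
        push Not at hn
        have : C.toFinset ⊆ {x, y} := by
          intro z hz
          by_cases h : z = x
          · simp [h]
          · simp [hn z (by simpa using hz) h]
        have h1 := Finset.card_le_card this
        have h2 := Finset.card_le_two (a := x) (b := y)
        rw [List.toFinset_card_of_nodup h.nd] at h1
        have := h.len
        omega
      obtain ⟨c, hc, c1, c2⟩ := this
      obtain ⟨n, w⟩ := two_conn h3 x y r c ⟨fun h => hx (h ▸ rr), fun h => hy (h ▸ rr)⟩ ⟨c1, c2⟩
      obtain ⟨p, q, hp, hq, hpq, h1, h2⟩ := w.leave (X := R) rr (fun hc' => hc'.mem hc)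
      exact ⟨q, h1, h2, hq, p, hp, hpq⟩
    have hc0 : ∃ c, ¬ R c := by
      obtain ⟨a, b, e⟩ := exists_ends (l := C) (by intro h'; have := h.len; simp [h'] at this)
      exact ⟨a, fun h => h.mem e.head_mem⟩
    obtain ⟨c, hc⟩ := hc0
    have red : ∀ x, ∃ x', ¬ R x' ∧ ∀ v, ¬ R v → v ≠ x' → v ≠ x := by
      intro x
      by_cases hx : R x
      · exact ⟨c, hc, fun v hv _ hvx => hv (hvx ▸ hx)⟩
      · exact ⟨x, hx, fun v _ h => h⟩
    intro x y
    obtain ⟨x', hx, hx'⟩ := red x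
    obtain ⟨y', hy, hy'⟩ := red y
    obtain ⟨v, v1, v2, hv⟩ := key x' y' hx hy
    exact ⟨v, hx' v hv.1 v1, hy' v hv.1 v2, hv⟩
  common3 := by
    intro a b x ha hb hab hx xa xb c1 c2
    obtain ⟨g, hg, h1, h2⟩ := heavy_common ha hb {a, b, x} (by
        intro v hv
        simp only [Finset.mem_insert, Finset.mem_singleton] at hv
        rcases hv with rfl | rfl | rfl
        · exact ⟨G.loopless.irrefl _, fun h => hab (.of h.symm)⟩
        · exact ⟨fun h => hab (.of h), G.loopless.irrefl _⟩
        · exact ⟨fun h => xa (.of h.symm), fun h => xb (.of h.symm)⟩) {c1, c2} (by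
        have h1 : a ≠ b := fun h => hab (.inl h)
        have h2 : a ≠ x := fun h => xa (.inl h.symm)
        have h3 : b ≠ x := fun h => xb (.inl h.symm)
        have : ({a, b, x} : Finset V).card = 3 := Finset.card_eq_three.2 ⟨a, b, x, h1, h2, h3, rfl⟩
        have := Finset.card_le_two (a := c1) (b := c2)
        omega)
    simp only [Finset.mem_insert, Finset.mem_singleton, not_or] at hg
    exact ⟨g, hg.1, hg.2, h1, h2⟩

theorem main_aux (h4 : 4 ≤ Fintype.card V) (h3 : ∀ x y : V, (G.induce {x, y}ᶜ).Connected)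
    (h1h : OneHeavy G) (hadh : AlmostDH G) : G.IsHamiltonian := by
  obtain ⟨C, h⟩ := best_exists h4 h3
  have hc := h.isCycle
  refine ham_of_list h.nd h.len hc ?_
  intro v
  by_contra hv
  exact (h.env h4 h3 h1h hadh hv).absurd hc

end HamADH

/-- Every 3-connected (at least 4 vertices, connected after deleting any two
vertices), 1-heavy, almost distance-hereditary graph is Hamiltonian. -/
theorem hamiltonian_of_oneHeavy_adh {V : Type*} [Fintype V] [DecidableEq V] (G : SimpleGraph V)
    (h4 : 4 ≤ Fintype.card V)
    (h3conn : ∀ x y : V, (G.induce {x, y}ᶜ).Connected)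
    (h1h : OneHeavy G) (hadh : AlmostDH G) :
    G.IsHamiltonian := by
  exact HamADH.main_aux h4 h3conn h1h hadh
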